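/- arXiv:2207.09359 — 3 statements merged into one kernel-verified Lean document; each statement's English description precedes it below -/
import Mathlib

section
/- Let 1 ≤ k ≤ n and let (p_{i_1,…,i_k}) be a specialization of A_{k,n} with values in ℤ such that p_{i_1,…,i_k} > 0 for all 1 ≤ i_1 < … < i_k ≤ n, and let ε be the greatest common divisor of all the p_{i_1,…,i_k}. Then the following are equivalent: (I) there exist ℓ ≥ n, vectors y_1,…,y_ℓ ∈ ℤ^k with det(y_{j_1} ⋯ y_{j_k}) > 0 for all 1 ≤ j_1 < … < j_k ≤ ℓ and det(y_{[i,i+1,…,i+k−1]}) = 1 for all i = 1,…,ℓ (indices reduced modulo ℓ and sorted ascending), together with indices 1 ≤ i_1 < … < i_n ≤ ℓ such that p_{r_1,…,r_k} = det(y_{i_{r_1}} ⋯ y_{i_{r_k}}) for all 1 ≤ r_1 < … < r_k ≤ n (i.e. the specialization appears as a subpolygon of an SL_k-frieze pattern); (II) the following two conditions hold: (1) for every i ∈ {1,…,n}, gcd( p_{[i,i_2,…,i_k]} : 1 ≤ i_2 < … < i_k ≤ n ) = ε; (2) for every prime number q dividing ε and every subset S ⊆ {1,…,n} with |S| = (q^k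 − 1)/(q − 1), there exist distinct i, j ∈ S such that for every choice of indices i_1,…,i_{k−2} making {i_1,…,i_{k−2},i,j} a k-element set, ν_q(p_{[i_1,…,i_{k−2},i,j]}) ≠ ν_q(ε). -/
/-- The tuple `(i₁, …, i_{k-1}, x)` used in the first factor of the Plücker relation. -/
def pluTuple {n k : ℕ} (i : Fin (k - 1) → Fin n) (x : Fin n) : Fin k → Fin n :=
  fun s => if h : (s : ℕ) < k - 1 then i ⟨s, h⟩ else x

/-- A specialization of the coordinate ring `A_{k,n}` of the Grassmannian `Gr(k,n)`. -/
def IsSpecialization {R : Type*} [CommRing R] (k n : ℕ) (p : (Fin k → Fin n) → R) : Prop :=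
  (∀ (f : Fin k → Fin n) (σ : Equiv.Perm (Fin k)),
      p (f ∘ σ) = (Equiv.Perm.sign σ : ℤ) • p f) ∧
  (∀ f : Fin k → Fin n, ¬ Function.Injective f → p f = 0) ∧
  (∀ (i : Fin (k - 1) → Fin n) (j : Fin (k + 1) → Fin n),
      ∑ r : Fin (k + 1), (-1 : R) ^ (r : ℕ) *
        p (pluTuple i (j r)) * p (j ∘ r.succAbove) = 0)

/-- The determinant of the `k × k` matrix whose columns are `v 0, …, v (k-1)`. -/
def colDet {k : ℕ} (v : Fin k → (Fin k → ℤ)) : ℤ :=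
  (Matrix.of fun r s => v s r).det


namespace Fz

/-- Determinant of a list of vectors. -/
def D {k : ℕ} (l : List (Fin k → ℤ)) : ℤ :=
  (Matrix.detRowAlternating (R := ℤ) (n := Fin k)) (fun s : Fin k => l.getD s 0)

variable {k : ℕ}

lemma getD_app (A B : List (Fin k → ℤ)) (y : Fin k → ℤ) (h : A.length < k) :
    (fun s : Fin k => (A ++ y :: B).getD s 0) =
      Function.update (fun s : Fin k => (A ++ 0 :: B).getD s 0) ⟨A.length, h⟩ y := by
  funext s
  by_cases hs : s = ⟨A.length, h⟩
  · subst hs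
    simp
  · rw [Function.update_of_ne hs]
    have hs' : (s : ℕ) ≠ A.length := fun e => hs (Fin.ext e)
    rcases lt_or_gt_of_ne hs' with h1 | h1
    · rw [List.getD_append _ _ _ _ h1, List.getD_append _ _ _ _ h1]
    · rw [List.getD_append_right _ _ _ _ h1.le, List.getD_append_right _ _ _ _ h1.le]
      obtain ⟨m, hm⟩ : ∃ m, (s : ℕ) - A.length = m + 1 := ⟨s - A.length - 1, by omega⟩
      rw [hm]; simp

lemma D_lin (A B : List (Fin k → ℤ)) (h : A.length < k) :
    ∃ φ : (Fin k → ℤ) →ₗ[ℤ] ℤ, ∀ y, D (A ++ y :: B) = φ y := by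
  refine ⟨(Matrix.detRowAlternating (R := ℤ) (n := Fin k)).toMultilinearMap.toLinearMap
    (fun s : Fin k => (A ++ 0 :: B).getD s 0) ⟨A.length, h⟩, fun y => ?_⟩
  unfold D
  rw [getD_app A B y h]
  rfl

lemma D_rep (A B C : List (Fin k → ℤ)) (y : Fin k → ℤ) (h : A.length + 1 + B.length < k) :
    D (A ++ y :: (B ++ y :: C)) = 0 := by
  unfold D
  refine AlternatingMap.map_eq_zero_of_eq _ _ (i := ⟨A.length, by omega⟩)
    (j := ⟨A.length + 1 + B.length, h⟩) ?_ ?_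
  · simp only
    rw [List.getD_append_right _ _ _ _ (by simp), List.getD_append_right _ _ _ _ (by omega)]
    have : A.length + 1 + B.length - A.length = B.length + 1 := by omega
    rw [this]
    simp
  · intro e
    have := congrArg Fin.val e
    simp at this
    omega

lemma D_swap (A B : List (Fin k → ℤ)) (y z : Fin k → ℤ) (h : A.length + 1 < k) :
    D (A ++ y :: z :: B) = - D (A ++ z :: y :: B) := by
  obtain ⟨φ, hφ⟩ : ∃ φ : (Fin k → ℤ) →ₗ[ℤ] ℤ, ∀ w, D (A ++ w :: (y + z) :: B) = φ w :=
    D_lin A _ (by omega)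
  have h0 : D (A ++ (y + z) :: (y + z) :: B) = 0 := D_rep A [] B (y + z) (by simpa using h)
  have h1 : ∀ w : Fin k → ℤ, D (A ++ w :: w :: B) = 0 := fun w => D_rep A [] B w (by simpa using h)
  have h2 : ∀ w, D (A ++ w :: (y + z) :: B) = D (A ++ w :: y :: B) + D (A ++ w :: z :: B) := by
    intro w
    obtain ⟨ψ, hψ⟩ := D_lin (A ++ [w]) B (k := k) (by simpa using h)
    have e := fun v => hψ v
    simp only [List.append_assoc, List.singleton_append] at e
    rw [e, e, e, map_add]
  rw [hφ, map_add, ← hφ, ← hφ, h2, h2, h1, h1] at h0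
  linarith

lemma D_move (R : List (Fin k → ℤ)) : ∀ (A C : List (Fin k → ℤ)) (y : Fin k → ℤ)
    (_ : A.length + R.length < k), D (A ++ y :: (R ++ C)) = (-1) ^ R.length * D (A ++ R ++ y :: C) := by
  induction R with
  | nil => intro A C y h; simp
  | cons r R ih =>
    intro A C y h
    have h' : A.length + (R.length + 1) < k := by simpa using h
    rw [List.cons_append, D_swap _ _ _ _ (by omega)]
    have := ih (A ++ [r]) C y (by simp; omega)
    simp only [List.append_assoc, List.singleton_append] at this
    rw [this]
    simp [pow_succ]

lemma D_mem (A B : List (Fin k → ℤ)) (y : Fin k → ℤ) (h : A.length + B.length < k)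
    (hy : y ∈ A ∨ y ∈ B) : D (A ++ y :: B) = 0 := by
  rcases hy with hy | hy
  · obtain ⟨A1, A2, rfl⟩ := List.append_of_mem hy
    have := D_rep A1 A2 B y (by simp at h; omega)
    simpa using this
  · obtain ⟨B1, B2, rfl⟩ := List.append_of_mem hy
    exact D_rep A B1 B2 y (by simp at h; omega)

lemma set_eq (l : List (Fin k → ℤ)) (s : ℕ) (h : s < l.length) (z : Fin k → ℤ) :
    l.set s z = l.take s ++ z :: l.drop (s+1) := by
  rw [List.set_eq_take_append_cons_drop, if_pos h]

/-- Cramer rule. -/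
lemma D_cramer (l : List (Fin k → ℤ)) (hl : l.length = k) (z : Fin k → ℤ) :
    D l • z = ∑ s ∈ Finset.range k, D (l.set s z) • l.getD s 0 := by
  have h := Matrix.mulVec_cramer (Matrix.of fun r s : Fin k => l.getD s 0 r) z
  have hd : (Matrix.of fun r s : Fin k => l.getD s 0 r).det = D l := by
    rw [← Matrix.det_transpose]; rfl
  rw [hd] at h
  rw [← h, ← Fin.sum_univ_eq_sum_range (fun s => D (l.set s z) • l.getD s 0)]
  funext r
  simp only [Matrix.mulVec, dotProduct, Matrix.of_apply, Finset.sum_apply, Pi.smul_apply, smul_eq_mul]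
  refine Finset.sum_congr rfl fun s _ => ?_
  rw [mul_comm]
  congr 1
  rw [Matrix.cramer_apply, ← Matrix.det_transpose]
  unfold D
  change _ = Matrix.det _
  congr 1
  funext a b
  by_cases ha : a = s
  · subst ha
    simp [hl]
  · have : (s:ℕ) ≠ a := fun e => ha (Fin.ext e.symm)
    simp [ha, this]

/-- sign -/
def sg (k : ℕ) : ℤ := (-1) ^ (k - 1)

lemma sg_sq (k : ℕ) : sg k * sg k = 1 := by
  unfold sg; rw [← pow_add, ← two_mul, pow_mul]; simp

lemma D_rot (hk : 1 ≤ k) (a : Fin k → ℤ) (l : List (Fin k → ℤ)) (hl : l.length + 1 = k) :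
    D (l ++ [sg k • a]) = D (a :: l) := by
  obtain ⟨φ, hφ⟩ := D_lin l [] (k := k) (by omega)
  have := D_move l [] [] a (by simp; omega)
  simp only [List.nil_append, List.append_nil] at this
  rw [this, hφ, hφ, map_smul, smul_eq_mul]
  congr 1
  unfold sg; congr 1; omega

/-- three-term relation -/
lemma D_three (K : List (Fin k → ℤ)) (hK : K.length + 2 = k) (j v y c : Fin k → ℤ) :
    D (y :: c :: K) * D (j :: v :: K) =
      D (v :: c :: K) * D (j :: y :: K) + D (y :: v :: K) * D (j :: c :: K) := by
  obtain ⟨φ, hφ⟩ := D_lin [j] K (k := k) (by simp; omega)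
  simp only [List.singleton_append] at hφ
  have h := D_cramer (y :: c :: K) (by simpa using hK) v
  have h2 := congrArg φ h
  rw [map_smul, ← hφ, map_sum] at h2
  have hr : Finset.range k = Finset.range (K.length + 1 + 1) := congrArg _ (by omega)
  rw [hr, Finset.sum_range_succ', Finset.sum_range_succ', Finset.sum_eq_zero] at h2
  · rw [map_smul, map_smul, ← hφ, ← hφ] at h2
    simp only [smul_eq_mul, zero_add, List.set_cons_zero, List.set_cons_succ,
      List.getD_cons_zero, List.getD_cons_succ] at h2
    rw [h2]; ring
  · intro i hi
    rw [map_smul, ← hφ]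
    have hi' : i < K.length := by simpa using hi
    have : D (j :: (y :: c :: K).getD (i+1+1) 0 :: K) = 0 := by
      refine D_mem [j] K _ (by simp; omega) (Or.inr ?_)
      simp [hi']
    rw [this]; simp

/-- three-term relation, sorted form -/
lemma D_three' (A R B : List (Fin k → ℤ)) (hK : A.length + R.length + B.length + 2 = k)
    (j v y c : Fin k → ℤ) :
    D (A ++ j :: R ++ B ++ [v]) * D (A ++ y :: R ++ c :: B) =
      D (A ++ y :: R ++ B ++ [v]) * D (A ++ j :: R ++ c :: B) +
      D (A ++ R ++ c :: B ++ [v]) * D (A ++ y :: j :: R ++ B) := by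
  have h := D_three (A ++ R ++ B) (by simp; omega) j v y c
  -- move to normal form
  have mv : ∀ p q : Fin k → ℤ, D (p :: q :: (A ++ R ++ B)) =
      (-1) ^ (A.length + 1) * ((-1) ^ (A.length + R.length + B.length) *
        D (A ++ p :: R ++ B ++ [q])) * (-1) := by
    intro p q
    have h1 := D_swap [] (A ++ R ++ B) p q (by simp; omega)
    have h2 := D_move A [q] (R ++ B) p (by simp; omega)
    have h3 := D_move (A ++ p :: (R ++ B)) [] [] q (by simp; omega)
    simp only [List.nil_append, List.append_nil, List.append_assoc,
      List.cons_append, List.length_append, List.length_cons] at h1 h2 h3 ⊢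
    rw [h1, h2, h3]
    have e1 : (-1 : ℤ) ^ (A.length + (R.length + B.length + 1)) =
      (-1) ^ (A.length + R.length + B.length) * (-1) := by rw [← pow_succ]; congr 1; omega
    rw [e1, pow_succ]; ring
  have m1 : ∀ p : Fin k → ℤ, D (A ++ p :: R ++ B ++ [c]) = (-1) ^ B.length * D (A ++ p :: R ++ c :: B) := by
    intro p
    have h3 := D_move B (A ++ p :: R) [] c (by simp; omega)
    simp only [List.append_nil] at h3
    rw [h3, ← mul_assoc, ← pow_add, ← two_mul, pow_mul]
    simp
  have m2 : D (A ++ c :: R ++ B ++ [v]) = (-1) ^ R.length * D (A ++ R ++ c :: B ++ [v]) := by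
    have h3 := D_move R A (B ++ [v]) c (by omega)
    simpa using h3
  have m3 : D (A ++ y :: R ++ B ++ [j]) = (-1) ^ (R.length + B.length) * D (A ++ y :: j :: R ++ B) := by
    have h3 := D_move (R ++ B) (A ++ [y]) [] j (by simp; omega)
    simp only [List.append_nil, List.append_assoc, List.singleton_append, List.length_append,
      List.cons_append, List.nil_append] at h3 ⊢
    rw [h3, ← mul_assoc, ← pow_add, ← two_mul, pow_mul]
    simp
  have as1 : ∀ p q, D (p :: q :: (A ++ R ++ B)) = - D (q :: p :: (A ++ R ++ B)) := fun p q =>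
    D_swap [] (A ++ R ++ B) p q (by simp; omega)
  rw [as1 v c, as1 j y] at h
  simp only [mv] at h
  rw [m1, m1, m2, m3] at h
  have s1 : ((-1 : ℤ) ^ A.length) ^ 2 = 1 := by rw [← pow_mul, mul_comm, pow_mul]; simp
  have s2 : ((-1 : ℤ) ^ R.length) ^ 2 = 1 := by rw [← pow_mul, mul_comm, pow_mul]; simp
  have s3 : ((-1 : ℤ) ^ B.length) ^ 2 = 1 := by rw [← pow_mul, mul_comm, pow_mul]; simp
  rw [pow_succ, pow_add, pow_add, pow_add] at h
  generalize D (A ++ j :: R ++ B ++ [v]) = a1 at *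
  generalize D (A ++ y :: R ++ c :: B) = a2 at *
  generalize D (A ++ y :: R ++ B ++ [v]) = a3 at *
  generalize D (A ++ j :: R ++ c :: B) = a4 at *
  generalize D (A ++ R ++ c :: B ++ [v]) = a5 at *
  generalize D (A ++ y :: j :: R ++ B) = a6 at *
  have u1 : (-1 : ℤ) ^ A.length ≠ 0 := by positivity
  have u3 : (-1 : ℤ) ^ B.length ≠ 0 := by positivity
  have u2 : (-1 : ℤ) ^ R.length ≠ 0 := by positivity
  generalize (-1 : ℤ) ^ A.length = α at *
  generalize (-1 : ℤ) ^ B.length = β at *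
  generalize (-1 : ℤ) ^ R.length = γ at *
  have : α^4 * β^3 * γ^2 * (a1 * a2) = α^4 * β^3 * γ^2 * (a3 * a4 + a5 * a6) := by
    linear_combination h + (α^4*β^3*γ^2 * a5 * a6) * (s2)
  exact mul_left_cancel₀ (by positivity) this

end Fz

namespace Fz
variable {k : ℕ}

/-- All ordered minors are positive. -/
def Pos (L : List (Fin k → ℤ)) : Prop := ∀ l : List (Fin k → ℤ), l.Sublist L → l.length = k → 0 < D l

lemma pos_insert_aux (L : List (Fin k → ℤ)) (hL : Pos L) (hn : k ≤ L.length) (v : Fin k → ℤ)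
    (h : ∀ A R B, L = A ++ R ++ B → A.length + B.length + 1 = k → 0 < D (A ++ B ++ [v])) :
    ∀ (m : ℕ) (A R B R' : List (Fin k → ℤ)), R'.length = m → L = A ++ R ++ B → R'.Sublist R →
      A.length + R'.length + B.length + 1 = k → 0 < D (A ++ R' ++ B ++ [v]) := by
  intro m
  induction m with
  | zero =>
    intro A R B R' hR' hLe hs hlen
    have : R' = [] := List.length_eq_zero_iff.mp hR'
    subst this
    simpa using h A R B hLe (by simpa using hlen)
  | succ m ih =>
    intro A R B R' hR' hLe hs hlen
    have hLlen : L.length = A.length + R.length + B.length := by rw [hLe]; simp; omega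
    have hRl : R'.length + 1 ≤ R.length := by omega
    cases R with
    | nil => simp at hRl
    | cons y R1 =>
    cases hs with
    | cons_cons _ hs =>
      rename_i R''
      have := ih (A ++ [y]) R1 B R'' (by simpa using hR') (by simp [hLe]) hs
        (by simp at hlen ⊢; omega)
      simpa using this
    | cons _ hs =>
    rcases List.eq_nil_or_concat R1 with rfl | ⟨R2, c, rfl⟩
    · simp only [List.length_cons, List.length_nil] at hRl; omega
    rw [List.concat_eq_append] at *
    obtain ⟨S1, S2, rfl, h1, h2⟩ := List.sublist_append_iff.mp hs
    cases h2 with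
    | cons_cons _ h2 =>
      have e := List.sublist_nil.mp h2
      subst e
      have : S1.length = m := by simpa using hR'
      have h3 := ih A (y :: R2) (c :: B) S1 this (by simp [hLe]) (h1.cons _)
        (by simp at hlen hR' ⊢; omega)
      simpa using h3
    | cons _ h2 =>
    have e : S2 = [] := by simpa using h2
    subst e
    simp only [List.append_nil] at *
    cases S1 with
    | nil => simp at hR'
    | cons j T =>
    have hT : T.Sublist R2 := (List.sublist_cons_self j T).trans h1
    have hTl : T.length = m := by simpa using hR'
    simp only [List.length_cons] at hlen
    have a1 := ih (A ++ [y]) (R2 ++ [c]) B T hTl (by simp [hLe])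
      (hT.trans (List.sublist_append_left _ _)) (by simp; omega)
    have a2 := ih A (y :: R2) (c :: B) T hTl (by simp [hLe]) (hT.cons _) (by simp; omega)
    have a3 : 0 < D (A ++ y :: T ++ c :: B) := by
      apply hL
      · rw [hLe]
        have : (A ++ y :: T ++ c :: B).Sublist (A ++ y :: R2 ++ c :: B) :=
          ((List.Sublist.refl A).append (hT.cons_cons y)).append (List.Sublist.refl _)
        simpa using this
      · simp; omega
    have a4 : 0 < D (A ++ j :: T ++ c :: B) := by
      apply hL
      · rw [hLe]
        have : (A ++ j :: T ++ c :: B).Sublist (A ++ y :: R2 ++ c :: B) :=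
          ((List.Sublist.refl A).append (h1.cons y)).append (List.Sublist.refl _)
        simpa using this
      · simp; omega
    have a5 : 0 < D (A ++ y :: j :: T ++ B) := by
      apply hL
      · rw [hLe]
        have : (A ++ y :: j :: T ++ B).Sublist (A ++ y :: R2 ++ c :: B) :=
          ((List.Sublist.refl A).append (h1.cons_cons y)).append ((List.Sublist.refl _).cons _)
        simpa using this
      · simp; omega
    have key := D_three' A T B (by omega) j v y c
    have a1' : 0 < D (A ++ y :: T ++ B ++ [v]) := by simpa using a1
    have : 0 < D (A ++ j :: T ++ B ++ [v]) * D (A ++ y :: T ++ c :: B) := by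
      rw [key]; positivity
    exact pos_of_mul_pos_left this a3.le

/-- minors containing the appended vector -/
def ee (L : List (Fin k → ℤ)) (v : Fin k → ℤ) (b : ℕ) : ℤ :=
  D (L.take b ++ L.drop (L.length - k + 1 + b) ++ [v])

lemma sublist_append_one {l L : List (Fin k → ℤ)} {v : Fin k → ℤ} (h : l.Sublist (L ++ [v])) :
    l.Sublist L ∨ ∃ J, l = J ++ [v] ∧ J.Sublist L := by
  obtain ⟨S1, S2, rfl, h1, h2⟩ := List.sublist_append_iff.mp h
  cases h2 with
  | cons_cons _ h2 =>
    have e := List.sublist_nil.mp h2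
    subst e
    exact Or.inr ⟨S1, rfl, h1⟩
  | cons _ h2 =>
    have e := List.sublist_nil.mp h2
    subst e
    left; simpa using h1

lemma pos_insert (L : List (Fin k → ℤ)) (hL : Pos L) (hn : k ≤ L.length) (v : Fin k → ℤ)
    (h : ∀ b < k, 0 < ee L v b) : Pos (L ++ [v]) := by
  intro l hl hlen
  rcases sublist_append_one hl with h1 | ⟨J, rfl, hJ⟩
  · exact hL l h1 hlen
  · have := pos_insert_aux L hL hn v ?_ J.length [] L [] J rfl (by simp) hJ
      (by simpa using hlen)
    · simpa using this
    · intro A R B hLe hAB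
      have := h A.length (by omega)
      unfold ee at this
      have e1 : L.take A.length = A := by rw [hLe]; simp
      have e2 : L.drop (L.length - k + 1 + A.length) = B := by
        have : L.length - k + 1 + A.length = (A ++ R).length := by
          have : L.length = A.length + R.length + B.length := by rw [hLe]; simp; omega
          simp; omega
        rw [this, hLe, List.drop_left]
      rwa [e1, e2] at this

/-- twisted rotation -/
def rot : List (Fin k → ℤ) → List (Fin k → ℤ)
  | [] => []
  | a :: L => L ++ [sg k • a]

lemma rot_length (L : List (Fin k → ℤ)) : (rot L).length = L.length := by
  cases L <;> simp [rot]

lemma pos_rot (hk : 1 ≤ k) (L : List (Fin k → ℤ)) (hL : Pos L) : Pos (rot L) := by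
  cases L with
  | nil => simpa [rot] using hL
  | cons a L =>
    intro l hl hlen
    rcases sublist_append_one hl with h1 | ⟨J, rfl, hJ⟩
    · exact hL l (h1.cons _) hlen
    · rw [D_rot hk _ _ (by simpa using hlen)]
      exact hL _ (hJ.cons_cons _) (by simpa using hlen)

/-- cyclic windows -/
def win (L : List (Fin k → ℤ)) (i : ℕ) : ℤ := D (L.take (i + k - L.length) ++ (L.drop i).take k)

lemma win_rot (hk : 1 ≤ k) (L : List (Fin k → ℤ)) (hn : k ≤ L.length) (i : ℕ)
    (hi : i + 1 < L.length) : win (rot L) i = win L (i+1) := by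
  cases L with
  | nil => simp at hi
  | cons a L =>
    unfold win
    rw [rot_length]
    simp only [List.length_cons] at *
    rcases le_or_gt (i + 1 + k) (L.length + 1) with h | h
    · have e1 : i + k - (L.length + 1) = 0 := by omega
      have e2 : i + 1 + k - (L.length + 1) = 0 := by omega
      rw [e1, e2]
      simp only [rot, List.take_zero, List.nil_append, List.drop_succ_cons]
      rw [List.drop_append_of_le_length (by omega), List.take_append_of_le_length (by simp; omega)]
    · obtain ⟨b, hb⟩ : ∃ b, i + k - (L.length + 1) = b := ⟨_, rfl⟩
      have e2 : i + 1 + k - (L.length + 1) = b + 1 := by omega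
      rw [hb, e2]
      simp only [rot, List.take_succ_cons, List.drop_succ_cons]
      rw [List.drop_append_of_le_length (by omega), List.take_append_of_le_length (by omega),
        List.take_of_length_le (l := L.drop i ++ _) (by simp; omega),
        List.take_of_length_le (l := L.drop i) (by simp; omega), ← List.append_assoc,
        D_rot hk _ _ (by simp; omega)]
      simp

lemma win_rot_last (hk : 1 ≤ k) (L : List (Fin k → ℤ)) (hn : k ≤ L.length) (i : ℕ)
    (hi : i + 1 = L.length) : win (rot L) i = win L 0 := by
  cases L with
  | nil => simp at hi
  | cons a L =>
    unfold win
    rw [rot_length]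
    simp only [List.length_cons] at *
    have e1 : i + k - (L.length + 1) = k - 1 := by omega
    have e2 : 0 + k - (L.length + 1) = 0 := by omega
    rw [e1, e2]
    have hi : i = L.length := by omega
    subst hi
    simp only [rot, List.drop_left, List.take_zero, List.nil_append, List.drop_zero]
    obtain ⟨K, hK⟩ : ∃ K, k = K + 1 := ⟨k - 1, by omega⟩
    rw [List.take_append_of_le_length (by omega), List.take_of_length_le (l := [_]) (by simp; omega),
      D_rot hk _ _ (by simp; omega)]
    congr 1
    have : (a :: L).take k = (a :: L).take (k - 1 + 1) := by congr 1; omega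
    rw [this]; simp

/-- number of windows with value `M` -/
def cnt (L : List (Fin k → ℤ)) (M : ℤ) : ℕ := ∑ i ∈ Finset.range L.length, if win L i = M then 1 else 0

lemma cnt_rot (hk : 1 ≤ k) (L : List (Fin k → ℤ)) (hn : k ≤ L.length) (M : ℤ) :
    cnt (rot L) M = cnt L M := by
  unfold cnt
  rw [rot_length]
  obtain ⟨n, hh⟩ : ∃ n, L.length = n + 1 := ⟨L.length - 1, by omega⟩
  rw [hh, Finset.sum_range_succ, Finset.sum_range_succ', win_rot_last hk L hn n hh.symm]
  congr 1
  refine Finset.sum_congr rfl fun i hi => ?_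
  rw [win_rot hk L hn i (by simp at hi; omega)]

/-- bound on windows -/
def Bdd (L : List (Fin k → ℤ)) (M : ℤ) : Prop := ∀ i < L.length, win L i ≤ M

lemma bdd_rot (hk : 1 ≤ k) (L : List (Fin k → ℤ)) (hn : k ≤ L.length) (M : ℤ) (h : Bdd L M) :
    Bdd (rot L) M := by
  intro i hi
  rw [rot_length] at hi
  rcases lt_or_eq_of_le (Nat.succ_le_of_lt hi) with h1 | h1
  · rw [win_rot hk L hn i h1]; exact h _ h1
  · rw [win_rot_last hk L hn i h1]; exact h _ (by omega)

lemma win_append_old (L : List (Fin k → ℤ)) (v : Fin k → ℤ) (i : ℕ) (hi : i + k ≤ L.length) :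
    win (L ++ [v]) i = win L i := by
  unfold win
  have e1 : i + k - (L ++ [v]).length = 0 := by simp; omega
  have e2 : i + k - L.length = 0 := by omega
  rw [e1, e2, List.drop_append_of_le_length (by omega), List.take_append_of_le_length (l₁ := L.drop i) (by simp; omega)]
  simp

lemma win_append_new (L : List (Fin k → ℤ)) (hn : k ≤ L.length) (v : Fin k → ℤ) (b : ℕ) (hb : b < k) :
    win (L ++ [v]) (L.length - k + 1 + b) = ee L v b := by
  unfold win ee
  have e1 : L.length - k + 1 + b + k - (L ++ [v]).length = b := by simp; omega
  rw [e1, List.drop_append_of_le_length (by omega), List.take_append_of_le_length (by omega),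
    List.take_of_length_le (l := _ ++ [v]) (by simp; omega), List.append_assoc]

lemma win_mid (L : List (Fin k → ℤ)) (hn : k ≤ L.length) (b : ℕ) (hb : b + 1 < k) :
    win L (L.length - k + 1 + b) = D (L.take (b+1) ++ L.drop (L.length - k + 1 + b)) := by
  unfold win
  have e1 : L.length - k + 1 + b + k - L.length = b + 1 := by omega
  rw [e1, List.take_of_length_le (l := L.drop _) (by simp; omega)]

lemma pos_win (L : List (Fin k → ℤ)) (hL : Pos L) (hn : k ≤ L.length) (i : ℕ) (hi : i < L.length) :
    0 < win L i := by
  unfold win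
  apply hL
  · rcases le_or_gt (i + k) L.length with h | h
    · have : i + k - L.length = 0 := by omega
      rw [this]
      simpa using (List.take_sublist _ _).trans (List.drop_sublist _ _)
    · rw [List.take_of_length_le (l := L.drop i) (by simp; omega)]
      conv_rhs => rw [← List.take_append_drop i L]
      refine List.Sublist.append ?_ (List.Sublist.refl _)
      have : L.take (i + k - L.length) = (L.take i).take (i + k - L.length) := by
        rw [List.take_take]; congr 1; omega
      rw [this]
      exact List.take_sublist _ _
  · simp; omega

/-- Bookkeeping for appending a vector. -/
lemma append_step (hk : 1 ≤ k) (L : List (Fin k → ℤ)) (hn : k ≤ L.length) (v : Fin k → ℤ) (M : ℤ)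
    (hB : Bdd L M) (h1 : ∀ b, b + 1 < k → ee L v b ≤ win L (L.length - k + 1 + b))
    (h2 : ee L v (k-1) < M) :
    Bdd (L ++ [v]) M ∧ cnt (L ++ [v]) M ≤ cnt L M ∧
    ((∃ b, b + 1 < k ∧ win L (L.length - k + 1 + b) = M ∧ ee L v b < M) →
      cnt (L ++ [v]) M < cnt L M) := by
  have hB' : Bdd (L ++ [v]) M := by
    intro i hi
    simp at hi
    rcases le_or_gt (i + k) L.length with h | h
    · rw [win_append_old L v i h]; exact hB i (by omega)
    · obtain ⟨b, rfl⟩ : ∃ b, i = L.length - k + 1 + b := ⟨i - (L.length - k + 1), by omega⟩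
      rw [win_append_new L hn v b (by omega)]
      rcases lt_or_eq_of_le (show b + 1 ≤ k by omega) with h3 | h3
      · exact (h1 b h3).trans (hB _ (by omega))
      · have : b = k - 1 := by omega
        subst this; exact h2.le
  obtain ⟨K, hK⟩ : ∃ K, k = K + 1 := ⟨k - 1, by omega⟩
  have c1 : cnt (L ++ [v]) M = (∑ i ∈ Finset.range (L.length - k + 1), if win L i = M then 1 else 0)
      + ∑ b ∈ Finset.range K, if ee L v b = M then 1 else 0 := by
    unfold cnt
    have : (L ++ [v]).length = L.length - k + 1 + (K + 1) := by simp; omega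
    rw [this, Finset.sum_range_add, Finset.sum_range_succ (n := K)]
    rw [win_append_new L hn v K (by omega), if_neg (by
      have : k - 1 = K := by omega
      rw [this] at h2; exact h2.ne), add_zero]
    congr 1
    · refine Finset.sum_congr rfl fun i hi => ?_
      rw [win_append_old L v i (by simp at hi; omega)]
    · refine Finset.sum_congr rfl fun i hi => ?_
      rw [win_append_new L hn v i (by simp at hi; omega)]
  have c2 : cnt L M = (∑ i ∈ Finset.range (L.length - k + 1), if win L i = M then 1 else 0)
      + ∑ b ∈ Finset.range K, if win L (L.length - k + 1 + b) = M then 1 else 0 := by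
    unfold cnt
    have : Finset.range L.length = Finset.range (L.length - k + 1 + K) := congrArg _ (by omega)
    rw [this, Finset.sum_range_add]
  have cc : ∀ b ∈ Finset.range K, (if ee L v b = M then 1 else 0) ≤
      (if win L (L.length - k + 1 + b) = M then 1 else 0) := by
    intro b hb
    have hb' : b + 1 < k := by simp at hb; omega
    have := h1 b hb'
    have := hB (L.length - k + 1 + b) (by omega)
    split_ifs <;> omega
  refine ⟨hB', ?_, ?_⟩
  · rw [c1, c2]
    exact Nat.add_le_add_left (Finset.sum_le_sum cc) _
  · rintro ⟨b, hb, hw, he⟩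
    rw [c1, c2]
    refine Nat.add_lt_add_left (Finset.sum_lt_sum cc ⟨b, by simp; omega, ?_⟩) _
    rw [if_pos hw, if_neg he.ne]; omega

end Fz

namespace Fz
variable {k : ℕ}

/-- primitive vectors -/
def Prim {k : ℕ} (x : Fin k → ℤ) : Prop := ∃ c : Fin k → ℤ, ∑ i, c i * x i = 1

lemma prim_sg (x : Fin k → ℤ) (m : ℕ) (h : Prim x) : Prim (sg m • x) := by
  obtain ⟨c, hc⟩ := h
  refine ⟨sg m • c, ?_⟩
  rw [← hc]
  refine Finset.sum_congr rfl fun i _ => ?_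
  simp only [Pi.smul_apply, smul_eq_mul]
  linear_combination (c i * x i) * sg_sq m

lemma prim_dvd (x : Fin k → ℤ) (h : Prim x) (M α : ℤ) (w : Fin k → ℤ) (e : α • x = M • w) : M ∣ α := by
  obtain ⟨c, hc⟩ := h
  refine ⟨∑ i, c i * w i, ?_⟩
  calc α = α * ∑ i, c i * x i := by rw [hc, mul_one]
    _ = ∑ i, c i * (α • x) i := by
      rw [Finset.mul_sum]; refine Finset.sum_congr rfl fun i _ => ?_
      simp; ring
    _ = _ := by
      rw [e, Finset.mul_sum]; refine Finset.sum_congr rfl fun i _ => ?_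
      simp; ring

lemma prim_part (v : Fin k → ℤ) (hv : v ≠ 0) : ∃ g : ℤ, 1 ≤ g ∧ ∃ v', Prim v' ∧ v = g • v' := by
  obtain ⟨g, hg⟩ := (IsPrincipalIdealRing.principal (Ideal.span (Set.range v))).principal
  have hm : ∀ i, g ∣ v i := fun i => by
    have : v i ∈ Ideal.span (Set.range v) := Ideal.subset_span ⟨i, rfl⟩
    rw [hg] at this
    exact Ideal.mem_span_singleton.mp this
  have hgm : g ∈ Ideal.span (Set.range v) := by rw [hg]; exact Ideal.mem_span_singleton_self g
  obtain ⟨c, hc⟩ := (Ideal.mem_span_range_iff_exists_fun).mp hgm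
  choose w hw using hm
  have hg0 : g ≠ 0 := by
    rintro rfl
    apply hv; funext i; rw [hw i]; simp
  have hwp : Prim w := by
    refine ⟨c, mul_left_cancel₀ hg0 ?_⟩
    rw [mul_one, Finset.mul_sum]
    conv_rhs => rw [← hc]
    refine Finset.sum_congr rfl fun i _ => ?_
    rw [hw i]; ring
  rcases lt_or_gt_of_ne hg0 with h | h
  · refine ⟨-g, by omega, -w, ?_, ?_⟩
    · obtain ⟨c, hc⟩ := hwp
      exact ⟨-c, by simpa using hc⟩
    · funext i; rw [hw i]; simp
  · exact ⟨g, by omega, w, hwp, by funext i; rw [hw i]; simp⟩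

lemma shift_pos (a d e : ℤ) (hd : 0 < d) (he : e = d ∨ e = -d) : ∃ c : ℤ, 0 < a + c * e ∧ a + c * e ≤ d := by
  have key : ∃ c : ℤ, 0 < a + c * d ∧ a + c * d ≤ d := by
    refine ⟨-((a-1)/d), ?_⟩
    have h1 := Int.emod_add_mul_ediv (a-1) d
    have h2 := Int.emod_nonneg (a-1) hd.ne'
    have h3 := Int.emod_lt_of_pos (a-1) hd
    constructor <;> nlinarith
  obtain ⟨c, hc⟩ := key
  rcases he with rfl | rfl
  · exact ⟨c, hc⟩
  · exact ⟨-c, by simpa using hc⟩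

lemma reduce (f : ℕ → (Fin k → ℤ) →ₗ[ℤ] ℤ) (P : ℕ → Fin k → ℤ) (d : ℕ → ℤ) : ∀ (N : ℕ)
    (_ : ∀ b < N, 0 < d b) (_ : ∀ b < N, f b (P b) = d b ∨ f b (P b) = - d b)
    (_ : ∀ b < N, ∀ b' < b, f b (P b') = 0) (v0 : Fin k → ℤ),
    ∃ c : ℕ → ℤ, ∀ b < N, 0 < f b (v0 + ∑ i ∈ Finset.range N, c i • P i) ∧
      f b (v0 + ∑ i ∈ Finset.range N, c i • P i) ≤ d b := by
  intro N
  induction N with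
  | zero => intro _ _ _ v0; exact ⟨0, fun b hb => absurd hb (by omega)⟩
  | succ N ih =>
    intro hd h1 h2 v0
    obtain ⟨t, ht⟩ := shift_pos (f N v0) (d N) (f N (P N)) (hd N (by omega)) (h1 N (by omega))
    obtain ⟨c, hc⟩ := ih (fun b hb => hd b (by omega)) (fun b hb => h1 b (by omega))
      (fun b hb => h2 b (by omega)) (v0 + t • P N)
    refine ⟨Function.update c N t, ?_⟩
    have e : v0 + ∑ i ∈ Finset.range (N+1), Function.update c N t i • P i =
        v0 + t • P N + ∑ i ∈ Finset.range N, c i • P i := by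
      rw [Finset.sum_range_succ, Function.update_self]
      have : ∑ i ∈ Finset.range N, Function.update c N t i • P i = ∑ i ∈ Finset.range N, c i • P i := by
        refine Finset.sum_congr rfl fun i hi => ?_
        rw [Function.update_of_ne (by simp at hi; omega)]
      rw [this]; abel
    rw [e]
    intro b hb
    rcases Nat.lt_succ_iff_lt_or_eq.mp hb with h | rfl
    · exact hc b h
    · have : f b (v0 + t • P b + ∑ i ∈ Finset.range b, c i • P i) = f b v0 + t * f b (P b) := by
        rw [map_add, map_add, map_sum, map_smul, Finset.sum_eq_zero, add_zero, smul_eq_mul]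
        intro i hi
        rw [map_smul, h2 b (by omega) i (by simpa using hi), smul_zero]
      rw [this]; exact ht

lemma ee_lin (L : List (Fin k → ℤ)) (hn : k ≤ L.length) (b : ℕ) (hb : b < k) :
    ∃ φ : (Fin k → ℤ) →ₗ[ℤ] ℤ, ∀ y, ee L y b = φ y := by
  apply D_lin
  simp; omega

lemma ee_last (hk : 1 ≤ k) (L : List (Fin k → ℤ)) (hn : k ≤ L.length) (v : Fin k → ℤ) :
    ee L v (k-1) = D (L.take (k-1) ++ [v]) := by
  unfold ee
  have : L.length - k + 1 + (k-1) = L.length := by omega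
  rw [this]; simp

lemma ee_zero (L : List (Fin k → ℤ)) (hn : k ≤ L.length) (b i : ℕ) (hb : b < k)
    (hi : i < b ∨ (L.length - k + 1 + b ≤ i ∧ i < L.length)) : ee L (L.getD i 0) b = 0 := by
  unfold ee
  apply D_mem
  · simp; omega
  · left
    rw [List.mem_append]
    have hil : i < L.length := by omega
    rw [List.getD_eq_getElem _ _ hil]
    rcases hi with hi | ⟨hi, _⟩
    · left
      rw [List.mem_take_iff_getElem]
      exact ⟨i, by omega, rfl⟩
    · right
      rw [List.mem_drop_iff_getElem]
      exact ⟨i - (L.length - k + 1 + b), by omega, by congr 1; omega⟩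

lemma ee_diag (L : List (Fin k → ℤ)) (hn : k ≤ L.length) (b : ℕ) (hb : b + 1 < k) :
    ee L (L.getD b 0) b = win L (L.length - k + 1 + b) ∨
    ee L (L.getD b 0) b = - win L (L.length - k + 1 + b) := by
  rw [win_mid L hn b hb]
  unfold ee
  have h := D_move (L.drop (L.length - k + 1 + b)) (L.take b) [] (L.getD b 0) (by simp; omega)
  have e : L.take (b+1) ++ L.drop (L.length - k + 1 + b) =
    L.take b ++ L.getD b 0 :: (L.drop (L.length - k + 1 + b) ++ []) := by
    rw [List.take_succ_eq_append_getElem (by omega), List.getD_eq_getElem _ _ (by omega)]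
    simp only [List.append_assoc, List.singleton_append, List.append_nil]
  rw [e, h]
  rcases neg_one_pow_eq_or ℤ (L.drop (L.length - k + 1 + b)).length with h | h <;> rw [h]
  · left; ring
  · right; ring

lemma win_last (hk : 2 ≤ k) (L : List (Fin k → ℤ)) (hn : k ≤ L.length) :
    win L (L.length - 1) = ee L (L.getD (L.length - 1) 0) (k-1) := by
  rw [ee_last (by omega) L hn]
  have := win_mid L hn (k-2) (by omega)
  have e : L.length - k + 1 + (k-2) = L.length - 1 := by omega
  rw [e] at this
  rw [this]
  have e2 : k - 2 + 1 = k - 1 := by omega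
  rw [e2]
  congr 2
  rw [List.getD_eq_getElem _ _ (by omega)]
  conv_lhs => rw [List.drop_eq_getElem_cons (by omega)]
  congr 1
  simp; omega

/-- finding the vector to append -/
lemma find_v (hk : 2 ≤ k) (L : List (Fin k → ℤ)) (hn : k ≤ L.length) (hL : Pos L) (M : ℤ)
    (hM : win L (L.length - 1) = M) (z : Fin k → ℤ) (hz : ¬ M ∣ ee L z (k-1)) :
    ∃ v, Prim v ∧ (∀ b < k, 0 < ee L v b) ∧ (∀ b, b + 1 < k → ee L v b ≤ win L (L.length - k + 1 + b)) ∧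
      ee L v (k-1) < M ∧ (ee L v (k-2) = M → M ∣ ee L z (k-2)) := by
  have hMpos : 0 < M := hM ▸ pos_win L hL hn _ (by omega)
  have : ∀ b, ∃ φ : (Fin k → ℤ) →ₗ[ℤ] ℤ, b < k → ∀ y, ee L y b = φ y := by
    intro b
    by_cases hb : b < k
    · obtain ⟨φ, h⟩ := ee_lin L hn b hb; exact ⟨φ, fun _ => h⟩
    · exact ⟨0, fun h => absurd h hb⟩
  choose f hf using this
  set P : ℕ → Fin k → ℤ := fun i => L.getD i 0 with hP
  set x := L.getD (L.length - 1) 0 with hx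
  have fx : f (k-1) x = M := by rw [← hf _ (by omega), ← hM, win_last hk L hn]
  obtain ⟨c0, hc0⟩ := shift_pos (ee L z (k-1)) M M hMpos (Or.inl rfl)
  have hc0' : ee L z (k-1) + c0 * M < M := by
    rcases lt_or_eq_of_le hc0.2 with h | h
    · exact h
    · exact absurd ⟨1 - c0, by linarith⟩ hz
  obtain ⟨c, hc⟩ := reduce f P (fun b => win L (L.length - k + 1 + b)) (k-1)
    (fun b hb => pos_win L hL hn _ (by omega))
    (fun b hb => by rw [← hf b (by omega)]; exact ee_diag L hn b (by omega))
    (fun b hb b' hb' => by rw [← hf b (by omega)]; exact ee_zero L hn b b' (by omega) (Or.inl hb'))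
    (z + c0 • x)
  set v := z + c0 • x + ∑ i ∈ Finset.range (k-1), c i • P i with hv
  have v1 : ee L v (k-1) = ee L z (k-1) + c0 * M := by
    rw [hf _ (by omega), hf _ (by omega), hv, map_add, map_add, map_smul, fx, map_sum,
      Finset.sum_eq_zero, add_zero, smul_eq_mul]
    intro i hi
    rw [map_smul, ← hf _ (by omega), ee_zero L hn _ _ (by omega) (Or.inl (by simpa using hi)), smul_zero]
  have v2 : ee L v (k-2) = M → M ∣ ee L z (k-2) := by
    intro h
    obtain ⟨K, rfl⟩ : ∃ K, k = K + 2 := ⟨k-2, by omega⟩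
    have e1 : K + 2 - 1 = K + 1 := rfl
    have e2 : K + 2 - 2 = K := rfl
    rw [e2] at h ⊢
    rw [hf _ (by omega), hv, map_add, map_add, map_smul, map_sum, e1, Finset.sum_range_succ,
      Finset.sum_eq_zero] at h
    · rw [← hf _ (by omega), ← hf _ (by omega), map_smul, ← hf _ (by omega)] at h
      rw [ee_zero L hn K (L.length - 1) (by omega) (Or.inr (by omega))] at h
      have h3 := ee_diag L hn K (by omega)
      have e : L.length - (K+2) + 1 + K = L.length - 1 := by omega
      rw [e, hM] at h3
      have : M ∣ ee L (P K) K := by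
        rcases h3 with h3 | h3
        · exact ⟨1, by rw [mul_one]; exact h3⟩
        · exact ⟨-1, by rw [mul_neg_one]; exact h3⟩
      obtain ⟨w, hw⟩ := this
      rw [hw] at h
      simp only [smul_eq_mul] at h
      exact ⟨1 - c K * w, by linarith⟩
    · intro i hi
      rw [map_smul, ← hf _ (by omega), ee_zero L hn _ _ (by omega) (Or.inl (by simpa using hi)), smul_zero]
  have vpos : ∀ b < k, 0 < ee L v b := by
    intro b hb
    rcases lt_or_eq_of_le (show b ≤ k-1 by omega) with h | rfl
    · rw [hf b hb]; exact (hc b h).1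
    · rw [v1]; exact hc0.1
  have hv0 : v ≠ 0 := by
    intro h
    have := vpos 0 (by omega)
    rw [hf _ (by omega), h, map_zero] at this
    exact lt_irrefl _ this
  obtain ⟨g, hg, v', hp, hvv⟩ := prim_part v hv0
  have eg : ∀ b < k, ee L v b = g * ee L v' b := by
    intro b hb; rw [hf b hb, hf b hb, hvv, map_smul, smul_eq_mul]
  have pos' : ∀ b < k, 0 < ee L v' b := by
    intro b hb
    have := vpos b hb
    rw [eg b hb] at this
    exact pos_of_mul_pos_right this (by omega)
  have le' : ∀ b < k, ee L v' b ≤ ee L v b := by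
    intro b hb
    have := pos' b hb
    rw [eg b hb]; nlinarith
  refine ⟨v', hp, pos', ?_, ?_, ?_⟩
  · intro b hb
    refine (le' b (by omega)).trans ?_
    rw [hf b (by omega)]
    exact (hc b (by omega)).2
  · have := le' (k-1) (by omega)
    rw [v1] at this
    omega
  · intro h
    apply v2
    have h1 := le' (k-2) (by omega)
    have h2 : ee L v (k-2) ≤ M := by
      rw [hf _ (by omega), ← hM]
      have := (hc (k-2) (by omega)).2
      have e : L.length - k + 1 + (k-2) = L.length - 1 := by omega
      rwa [e] at this
    omega

end Fz

namespace Fz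
variable {k : ℕ}

/-- the invariant -/
structure Inv (L : List (Fin k → ℤ)) (M : ℤ) : Prop where
  pos : Pos L
  len : k ≤ L.length
  prim : ∀ x ∈ L, Prim x
  bdd : Bdd L M

lemma inv_rot (hk : 1 ≤ k) {L : List (Fin k → ℤ)} {M : ℤ} (h : Inv L M) : Inv (rot L) M := by
  refine ⟨pos_rot hk L h.pos, by rw [rot_length]; exact h.len, ?_, bdd_rot hk L h.len M h.bdd⟩
  cases L with
  | nil => simp [rot]
  | cons a L =>
    intro x hx
    have := h.prim
    simp only [rot, List.mem_append, List.mem_singleton] at hx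
    rcases hx with hx | rfl
    · exact this x (by simp [hx])
    · exact prim_sg _ _ (this a (by simp))

lemma rot_iter_length (L : List (Fin k → ℤ)) (i : ℕ) : (rot^[i] L).length = L.length := by
  induction i with
  | zero => rfl
  | succ i ih => rw [Function.iterate_succ_apply', rot_length, ih]

lemma inv_rot_iter (hk : 1 ≤ k) {L : List (Fin k → ℤ)} {M : ℤ} (h : Inv L M) (i : ℕ) :
    Inv (rot^[i] L) M := by
  induction i with
  | zero => exact h
  | succ i ih => rw [Function.iterate_succ_apply']; exact inv_rot hk ih

lemma cnt_rot_iter (hk : 1 ≤ k) {L : List (Fin k → ℤ)} (h : k ≤ L.length) (M : ℤ) (i : ℕ) :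
    cnt (rot^[i] L) M = cnt L M := by
  induction i with
  | zero => rfl
  | succ i ih => rw [Function.iterate_succ_apply', cnt_rot hk _ (by rw [rot_iter_length]; exact h), ih]

lemma rot_iter_append (A : List (Fin k → ℤ)) : ∀ B : List (Fin k → ℤ),
    rot^[A.length] (A ++ B) = B ++ A.map (fun a => sg k • a) := by
  induction A with
  | nil => intro B; simp
  | cons a A ih =>
    intro B
    rw [List.length_cons, Function.iterate_succ_apply]
    have : rot (a :: A ++ B) = A ++ (B ++ [sg k • a]) := by simp [rot]
    rw [this, ih]
    simp

lemma rot_period (L : List (Fin k → ℤ)) : rot^[2 * L.length] L = L := by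
  have h := rot_iter_append L []
  simp only [List.append_nil, List.nil_append] at h
  rw [two_mul, Function.iterate_add_apply, h]
  have h2 := rot_iter_append (L.map (fun a => sg k • a)) []
  simp only [List.append_nil, List.nil_append, List.length_map] at h2
  rw [h2, List.map_map]
  have : ((fun a : Fin k → ℤ => sg k • a) ∘ fun a => sg k • a) = id := by
    funext a
    simp only [Function.comp_apply, id_eq]
    rw [smul_smul, sg_sq, one_smul]
  rw [this, List.map_id]

lemma rot_period_mul (L : List (Fin k → ℤ)) (m : ℕ) : rot^[m * (2 * L.length)] L = L := by
  induction m with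
  | zero => simp
  | succ m ih => rw [add_mul, one_mul, Function.iterate_add_apply, rot_period, ih]

/-- extension up to rotation -/
def Ext (L L' : List (Fin k → ℤ)) : Prop := ∃ i, (rot^[i] L).Sublist L'

lemma Ext.refl (L : List (Fin k → ℤ)) : Ext L L := ⟨0, List.Sublist.refl _⟩

lemma sub_rot {A B : List (Fin k → ℤ)} (h : A.Sublist B) : A.Sublist (rot B) ∨ (rot A).Sublist (rot B) := by
  cases h with
  | slnil => left; simp
  | cons a h => left; exact h.trans (List.sublist_append_left _ _)
  | cons_cons a h => right; exact h.append (List.Sublist.refl _)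

lemma Ext.rot {A B : List (Fin k → ℤ)} (h : Ext A B) : Ext A (rot B) := by
  obtain ⟨i, hi⟩ := h
  rcases sub_rot hi with h | h
  · exact ⟨i, h⟩
  · exact ⟨i+1, by rw [Function.iterate_succ_apply']; exact h⟩

lemma Ext.rot_iter {A B : List (Fin k → ℤ)} (h : Ext A B) (j : ℕ) : Ext A (Fz.rot^[j] B) := by
  induction j with
  | zero => exact h
  | succ j ih => rw [Function.iterate_succ_apply']; exact ih.rot

lemma Ext.sub {A B C : List (Fin k → ℤ)} (h : Ext A B) (hC : B.Sublist C) : Ext A C := by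
  obtain ⟨i, hi⟩ := h
  exact ⟨i, hi.trans hC⟩

lemma Ext.trans {A B C : List (Fin k → ℤ)} (h : Ext A B) (h2 : Ext B C) : Ext A C := by
  obtain ⟨j, hj⟩ := h2
  exact (h.rot_iter j).sub hj

/-- progress -/
def Good (L : List (Fin k → ℤ)) (M : ℤ) : Prop :=
  ∃ L', Ext L L' ∧ Inv L' M ∧ cnt L' M < cnt L M

lemma unrot_inv (hk : 1 ≤ k) {L : List (Fin k → ℤ)} {M : ℤ} (h : Inv (rot L) M) : Inv L M := by
  cases L with
  | nil => simpa [rot] using h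
  | cons a L =>
    have := inv_rot_iter hk h (2 * (a :: L).length - 1)
    rw [← Function.iterate_succ_apply, Nat.succ_eq_add_one, Nat.sub_add_cancel (by simp; omega),
      rot_period] at this
    exact this

lemma ee_append_inv (hk : 2 ≤ k) {L : List (Fin k → ℤ)} {M : ℤ} (h : Inv L M) (v : Fin k → ℤ)
    (hv : Prim v) (h1 : ∀ b < k, 0 < ee L v b)
    (h2 : ∀ b, b + 1 < k → ee L v b ≤ win L (L.length - k + 1 + b)) (h3 : ee L v (k-1) < M) :
    Inv (L ++ [v]) M := by
  refine ⟨pos_insert L h.pos h.len v h1, by have := h.len; simp; omega, ?_,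
    (append_step (by omega) L h.len v M h.bdd h2 h3).1⟩
  intro x hx
  simp only [List.mem_append, List.mem_singleton] at hx
  rcases hx with hx | rfl
  · exact h.prim x hx
  · exact hv

lemma state (hk : 2 ≤ k) (M : ℤ) : ∀ (m : ℕ) (L : List (Fin k → ℤ)) (_ : Inv L M)
    (_ : win L (L.length - 1) = M) (z : Fin k → ℤ) (α : ℤ) (a : ℕ → ℤ)
    (_ : M • z = α • L.getD (L.length - 1) 0 + ∑ i ∈ Finset.range (k-1), a i • L.getD i 0)
    (_ : ¬ M ∣ α) (t : ℕ) (_ : t + m + 2 = k) (_ : ¬ M ∣ a t), Good L M := by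
  intro m
  induction m with
  | zero =>
    intro L hI hM z α a hrel hα t ht hat
    have hn := hI.len
    have hMpos : 0 < M := hM ▸ pos_win L hI.pos hn _ (by omega)
    have e1 : ee L z (k-1) = α := by
      obtain ⟨φ, hφ⟩ := ee_lin L hn (k-1) (by omega)
      have := congrArg φ hrel
      rw [map_add, map_smul, map_smul, map_sum, Finset.sum_eq_zero, ← hφ, ← hφ, ← win_last hk L hn, hM,
        smul_eq_mul, smul_eq_mul, add_zero, mul_comm] at this
      · exact mul_right_cancel₀ hMpos.ne' this
      · intro i hi
        rw [map_smul, ← hφ, ee_zero L hn _ _ (by omega) (Or.inl (by simpa using hi)), smul_zero]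
    have e2 : ee L z (k-2) = a (k-2) ∨ ee L z (k-2) = - a (k-2) := by
      obtain ⟨φ, hφ⟩ := ee_lin L hn (k-2) (by omega)
      have := congrArg φ hrel
      have hr : Finset.range (k-1) = Finset.range (k-2+1) := congrArg _ (by omega)
      rw [map_add, map_smul, map_smul, map_sum, hr, Finset.sum_range_succ, Finset.sum_eq_zero, map_smul, ← hφ, ← hφ,
        ← hφ, ee_zero L hn _ (L.length - 1) (by omega) (Or.inr (by omega)), smul_zero, zero_add, zero_add] at this
      · have h3 := ee_diag L hn (k-2) (by omega)
        have e : L.length - k + 1 + (k-2) = L.length - 1 := by omega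
        rw [e, hM] at h3
        simp only [smul_eq_mul] at this
        rcases h3 with h3 | h3
        · left
          rw [h3, mul_comm] at this
          exact mul_right_cancel₀ hMpos.ne' this
        · right
          rw [h3] at this
          exact mul_right_cancel₀ hMpos.ne' (by linarith)
      · intro i hi
        rw [map_smul, ← hφ, ee_zero L hn _ _ (by omega) (Or.inl (by simpa using hi)), smul_zero]
    obtain ⟨v, hp, h1, h2, h3, h4⟩ := find_v hk L hn hI.pos M hM z (by rwa [e1])
    have e : L.length - k + 1 + (k-2) = L.length - 1 := by omega
    have h5 : ee L v (k-2) < M := by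
      have := h2 (k-2) (by omega)
      rw [e, hM] at this
      refine lt_of_le_of_ne this fun h => hat ?_
      have := h4 h
      have et : t = k-2 := by omega
      rw [et]
      rcases e2 with e2 | e2
      · rwa [e2] at this
      · rw [e2] at this; exact (dvd_neg.mp this)
    exact ⟨L ++ [v], (Ext.refl L).sub (List.sublist_append_left _ _), ee_append_inv hk hI v hp h1 h2 h3,
      (append_step (by omega) L hn v M hI.bdd h2 h3).2.2 ⟨k-2, by omega, by rw [e, hM], h5⟩⟩
  | succ m ih =>
    intro L hI hM z α a hrel hα t ht hat
    have hn := hI.len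
    have hMpos : 0 < M := hM ▸ pos_win L hI.pos hn _ (by omega)
    have e1 : ee L z (k-1) = α := by
      obtain ⟨φ, hφ⟩ := ee_lin L hn (k-1) (by omega)
      have := congrArg φ hrel
      rw [map_add, map_smul, map_smul, map_sum, Finset.sum_eq_zero, ← hφ, ← hφ, ← win_last hk L hn, hM,
        smul_eq_mul, smul_eq_mul, add_zero, mul_comm] at this
      · exact mul_right_cancel₀ hMpos.ne' this
      · intro i hi
        rw [map_smul, ← hφ, ee_zero L hn _ _ (by omega) (Or.inl (by simpa using hi)), smul_zero]
    have e2 : ee L z (k-2) = a (k-2) ∨ ee L z (k-2) = - a (k-2) := by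
      obtain ⟨φ, hφ⟩ := ee_lin L hn (k-2) (by omega)
      have := congrArg φ hrel
      have hr : Finset.range (k-1) = Finset.range (k-2+1) := congrArg _ (by omega)
      rw [map_add, map_smul, map_smul, map_sum, hr, Finset.sum_range_succ, Finset.sum_eq_zero, map_smul, ← hφ, ← hφ,
        ← hφ, ee_zero L hn _ (L.length - 1) (by omega) (Or.inr (by omega)), smul_zero, zero_add, zero_add] at this
      · have h3 := ee_diag L hn (k-2) (by omega)
        have e : L.length - k + 1 + (k-2) = L.length - 1 := by omega
        rw [e, hM] at h3
        simp only [smul_eq_mul] at this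
        rcases h3 with h3 | h3
        · left
          rw [h3, mul_comm] at this
          exact mul_right_cancel₀ hMpos.ne' this
        · right
          rw [h3] at this
          exact mul_right_cancel₀ hMpos.ne' (by linarith)
      · intro i hi
        rw [map_smul, ← hφ, ee_zero L hn _ _ (by omega) (Or.inl (by simpa using hi)), smul_zero]
    obtain ⟨v, hp, h1, h2, h3, h4⟩ := find_v hk L hn hI.pos M hM z (by rwa [e1])
    have e : L.length - k + 1 + (k-2) = L.length - 1 := by omega
    have hIn := ee_append_inv hk hI v hp h1 h2 h3
    have hst := append_step (by omega) L hn v M hI.bdd h2 h3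
    have h5 := h2 (k-2) (by omega)
    rw [e, hM] at h5
    rcases lt_or_eq_of_le h5 with h5 | h5
    · exact ⟨L ++ [v], (Ext.refl L).sub (List.sublist_append_left _ _), hIn,
        hst.2.2 ⟨k-2, by omega, by rw [e, hM], h5⟩⟩
    · have hd : M ∣ a (k-2) := by
        have := h4 h5
        rcases e2 with e2 | e2
        · rwa [e2] at this
        · rw [e2] at this; exact (dvd_neg.mp this)
      obtain ⟨q, hq⟩ := hd
      have hr : rot (sg k • v :: L) = L ++ [v] := by
        simp only [rot]
        rw [smul_smul, sg_sq, one_smul]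
      have hI' : Inv (sg k • v :: L) M := unrot_inv (by omega) (by rw [hr]; exact hIn)
      have hc : cnt (sg k • v :: L) M ≤ cnt L M := by
        rw [← cnt_rot (by omega) _ hI'.len, hr]; exact hst.2.1
      have hw : win (sg k • v :: L) ((sg k • v :: L).length - 1) = M := by
        rw [List.length_cons, Nat.add_sub_cancel]
        have h6 := win_rot (by omega) (sg k • v :: L) hI'.len (L.length - 1) (by simp; omega)
        rw [hr, Nat.sub_add_cancel (by omega)] at h6
        rw [← h6, ← h5, ← win_append_new L hn v (k-2) (by omega), e]
      have hrel2 : M • (z - q • L.getD (k-2) 0) =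
          α • (sg k • v :: L).getD ((sg k • v :: L).length - 1) 0 +
          ∑ i ∈ Finset.range (k-1), (fun i => if i = 0 then 0 else a (i-1)) i • (sg k • v :: L).getD i 0 := by
        have hr1 : Finset.range (k-1) = Finset.range (k-2+1) := congrArg _ (by omega)
        rw [hr1] at hrel ⊢
        rw [Finset.sum_range_succ] at hrel
        rw [Finset.sum_range_succ', smul_sub, hrel, hq, List.length_cons, Nat.add_sub_cancel]
        obtain ⟨N, hN⟩ : ∃ N, L.length = N + 1 := ⟨L.length - 1, by omega⟩
        rw [hN]
        simp only [Nat.add_sub_cancel, List.getD_cons_succ, mul_smul, if_true, zero_smul, add_zero,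
          Nat.succ_ne_zero, if_false]
        abel
      obtain ⟨L', x1, x2, x3⟩ := ih (sg k • v :: L) hI' hw (z - q • L.getD (k-2) 0) α
        (fun i => if i = 0 then 0 else a (i-1)) hrel2 hα (t+1) (by omega) (by simpa using hat)
      refine ⟨L', ?_, x2, x3.trans_le hc⟩
      exact ((Ext.refl L).sub (List.sublist_cons_self _ _)).trans x1

lemma take_set (hk : 1 ≤ k) (L : List (Fin k → ℤ)) (hn : k ≤ L.length) (x z : Fin k → ℤ) :
    (L.take (k-1) ++ [x]).set (k-1) z = L.take (k-1) ++ [z] := by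
  rw [List.set_append_right _ _ (by simp)]
  have : k - 1 - (L.take (k-1)).length = 0 := by simp; omega
  rw [this]; rfl

lemma cramer_L (hk : 2 ≤ k) (L : List (Fin k → ℤ)) (hn : k ≤ L.length) (M : ℤ)
    (hM : win L (L.length - 1) = M) (z : Fin k → ℤ) :
    M • z = ee L z (k-1) • L.getD (L.length - 1) 0 + ∑ i ∈ Finset.range (k-1),
      D ((L.take (k-1) ++ [L.getD (L.length - 1) 0]).set i z) • L.getD i 0 := by
  have h := D_cramer (L.take (k-1) ++ [L.getD (L.length - 1) 0]) (by simp; omega) z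
  rw [← ee_last (by omega) L hn, ← win_last hk L hn, hM] at h
  rw [h]
  have hr : Finset.range k = Finset.range (k-1+1) := congrArg _ (by omega)
  rw [hr, Finset.sum_range_succ, add_comm, take_set (by omega) L hn, ee_last (by omega) L hn]
  congr 1
  · congr 1
    rw [List.getD_append_right _ _ _ _ (by simp)]
    have : k - 1 - (L.take (k-1)).length = 0 := by simp; omega
    rw [this]; rfl
  · refine Finset.sum_congr rfl fun i hi => ?_
    congr 1
    have : i < k - 1 := by simpa using hi
    rw [List.getD_append _ _ _ _ (by simp; omega), List.getD_eq_getElem _ _ (by simp; omega), List.getD_eq_getElem _ _ (by omega)]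
    simp

lemma getD_mem {L : List (Fin k → ℤ)} {i : ℕ} (h : i < L.length) : L.getD i 0 ∈ L := by
  rw [List.getD_eq_getElem _ _ h]; exact List.getElem_mem h

lemma start0 (hk : 2 ≤ k) (M : ℤ) (L : List (Fin k → ℤ)) (hI : Inv L M)
    (hM : win L (L.length - 1) = M) (z : Fin k → ℤ) (hz : ¬ M ∣ ee L z (k-1)) : Good L M := by
  have hn := hI.len
  have h := cramer_L hk L hn M hM z
  by_cases hh : ∃ t < k-1, ¬ M ∣ D ((L.take (k-1) ++ [L.getD (L.length - 1) 0]).set t z)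
  · obtain ⟨t, ht, hd⟩ := hh
    exact state hk M (k-2-t) L hI hM z _ _ h hz t (by omega) hd
  · push Not at hh
    exfalso
    apply hz
    choose! w hw using hh
    refine prim_dvd (L.getD (L.length - 1) 0) (hI.prim _ (getD_mem (by omega))) M _
      (z - ∑ i ∈ Finset.range (k-1), w i • L.getD i 0) ?_
    rw [smul_sub, h, Finset.smul_sum, eq_sub_iff_add_eq]
    congr 1
    refine Finset.sum_congr rfl fun i hi => ?_
    rw [hw i (by simpa using hi), mul_smul]

lemma start1 (hk : 2 ≤ k) (M : ℤ) : ∀ (t : ℕ) (L : List (Fin k → ℤ)) (_ : Inv L M)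
    (_ : win L (L.length - 1) = M) (z : Fin k → ℤ) (α : ℤ) (a : ℕ → ℤ)
    (_ : M • z = α • L.getD (L.length - 1) 0 + ∑ i ∈ Finset.range (k-1), a i • L.getD i 0)
    (_ : t + 1 < k) (_ : ¬ M ∣ a t), Good L M := by
  intro t
  induction t with
  | zero => ?_
  | succ t ih => ?_
  all_goals
    intro L hI hM z α a hrel ht hat
    have hn := hI.len
    have hMpos : 0 < M := hM ▸ pos_win L hI.pos hn _ (by omega)
    by_cases hz : ∃ z, ¬ M ∣ ee L z (k-1)
    · obtain ⟨z, hz⟩ := hz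
      exact start0 hk M L hI hM z hz
    push Not at hz
    have hα : ee L z (k-1) = α := by
      obtain ⟨φ, hφ⟩ := ee_lin L hn (k-1) (by omega)
      have := congrArg φ hrel
      rw [map_add, map_smul, map_smul, map_sum, Finset.sum_eq_zero, ← hφ, ← hφ, ← win_last hk L hn, hM,
        smul_eq_mul, smul_eq_mul, add_zero, mul_comm] at this
      · exact mul_right_cancel₀ hMpos.ne' this
      · intro i hi
        rw [map_smul, ← hφ, ee_zero L hn _ _ (by omega) (Or.inl (by simpa using hi)), smul_zero]
    obtain ⟨q, hq⟩ := hz z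
    rw [hα] at hq
    have hI' := inv_rot (by omega) hI
    have hlen := rot_length L
    have hw : win (rot L) ((rot L).length - 1) = M := by
      rw [hlen, win_rot_last (by omega) L hn _ (by omega)]
      have e : win L 0 = ee L (L.getD (k-1) 0) (k-1) := by
        rw [ee_last (by omega) L hn]
        unfold win
        have e0 : 0 + k - L.length = 0 := by omega
        rw [e0, List.take_zero, List.nil_append, List.drop_zero]
        congr 1
        have : L.take k = L.take (k-1+1) := by congr 1; omega
        rw [this, List.take_succ_eq_append_getElem (by omega), List.getD_eq_getElem _ _ (by omega)]
      have h1 := hI.bdd 0 (by omega)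
      have h2 := pos_win L hI.pos hn 0 (by omega)
      have h3 := hz (L.getD (k-1) 0)
      rw [← e] at h3
      exact le_antisymm h1 (Int.le_of_dvd h2 h3)
    have hx : (rot L).getD ((rot L).length - 1) 0 = sg k • L.getD 0 0 := by
      rw [hlen]
      cases L with
      | nil => simp at hn; omega
      | cons b L => simp [rot]
    have hP : ∀ i, i + 1 < L.length → (rot L).getD i 0 = L.getD (i+1) 0 := by
      intro i hi
      cases L with
      | nil => simp at hn; omega
      | cons b L =>
        simp only [rot, List.getD_cons_succ]
        rw [List.getD_append _ _ _ _ (by simpa using hi)]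
    have hrel' : M • (z - q • L.getD (L.length - 1) 0) = (sg k * a 0) • (rot L).getD ((rot L).length - 1) 0 +
        ∑ i ∈ Finset.range (k-1), (if i + 2 < k then a (i+1) else 0) • (rot L).getD i 0 := by
      have hr1 : Finset.range (k-1) = Finset.range (k-2+1) := congrArg _ (by omega)
      rw [hr1] at hrel ⊢
      rw [Finset.sum_range_succ' ] at hrel
      rw [Finset.sum_range_succ, if_neg (by omega), zero_smul, add_zero, smul_sub, hrel, hq, hx,
        smul_smul (sg k * a 0), mul_right_comm, sg_sq, one_mul]
      have : ∑ i ∈ Finset.range (k-2), (if i + 2 < k then a (i+1) else 0) • (rot L).getD i 0 =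
          ∑ i ∈ Finset.range (k-2), a (i+1) • L.getD (i+1) 0 := by
        refine Finset.sum_congr rfl fun i hi => ?_
        have : i < k-2 := by simpa using hi
        rw [if_pos (by omega), hP i (by omega)]
      rw [this, smul_smul]
      abel
    have fin : Good (rot L) M := ?_
  · obtain ⟨L', x1, x2, x3⟩ := fin
    exact ⟨L', (Ext.refl L).rot.trans x1, x2, by rwa [cnt_rot (by omega) L hn] at x3⟩
  · refine start0 hk M _ hI' hw (z - q • L.getD (L.length - 1) 0) ?_
    have hα : ee (rot L) (z - q • L.getD (L.length - 1) 0) (k-1) = sg k * a 0 := by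
      obtain ⟨φ, hφ⟩ := ee_lin (rot L) hI'.len (k-1) (by omega)
      have := congrArg φ hrel'
      rw [map_add, map_smul, map_smul, map_sum, Finset.sum_eq_zero, ← hφ, ← hφ, ← win_last hk (rot L) hI'.len, hw,
        smul_eq_mul, smul_eq_mul, add_zero, mul_comm] at this
      · exact mul_right_cancel₀ hMpos.ne' this
      · intro i hi
        rw [map_smul, ← hφ, ee_zero (rot L) hI'.len _ _ (by omega) (Or.inl (by simpa using hi)), smul_zero]
    rw [hα]
    intro h
    apply hat
    have := h.mul_left (sg k)
    rwa [← mul_assoc, sg_sq, one_mul] at this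
  · obtain ⟨L', x1, x2, x3⟩ := fin
    exact ⟨L', (Ext.refl L).rot.trans x1, x2, by rwa [cnt_rot (by omega) L hn] at x3⟩
  · exact ih (rot L) hI' hw _ _ _ hrel' (by omega) (by rw [if_pos (by omega)]; exact hat)

lemma exists_ndvd (l : List (Fin k → ℤ)) (hl : l.length = k) (h1 : 1 < D l) :
    ∃ s < k, ∃ z, ¬ D l ∣ D (l.set s z) := by
  by_contra hc
  push Not at hc
  choose! w hw using hc
  have h : ∀ j : Fin k, (Pi.single j 1 : Fin k → ℤ) =
      ∑ s ∈ Finset.range k, w s (Pi.single j 1) • l.getD s 0 := by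
    intro j
    have := D_cramer l hl (Pi.single j 1)
    have e : ∑ s ∈ Finset.range k, D (l.set s (Pi.single j 1)) • l.getD s 0 =
        D l • ∑ s ∈ Finset.range k, w s (Pi.single j 1) • l.getD s 0 := by
      rw [Finset.smul_sum]
      refine Finset.sum_congr rfl fun s hs => ?_
      rw [hw s (by simpa using hs), mul_smul]
    rw [e] at this
    exact smul_right_injective _ (by omega : D l ≠ 0) this
  let C : Matrix (Fin k) (Fin k) ℤ := Matrix.of fun j s => w s (Pi.single j 1)
  let A : Matrix (Fin k) (Fin k) ℤ := Matrix.of fun s r => l.getD s 0 r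
  have hCA : C * A = 1 := by
    ext j r
    have := congrFun (h j) r
    rw [Matrix.mul_apply, Matrix.one_apply]
    rw [Finset.sum_apply, ← Fin.sum_univ_eq_sum_range (fun s => (w s (Pi.single j 1) • l.getD s 0) r)] at this
    simp only [C, A, Matrix.of_apply]
    simp only [Pi.smul_apply, smul_eq_mul] at this
    rw [← this, Pi.single_apply]
    simp [eq_comm]
  have hd := congrArg Matrix.det hCA
  rw [Matrix.det_mul, Matrix.det_one] at hd
  have hA : A.det = D l := rfl
  rw [hA] at hd
  have : D l ∣ 1 := ⟨C.det, by rw [← hd, mul_comm]⟩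
  have := Int.le_of_dvd one_pos this
  omega

lemma good_of_last (hk : 2 ≤ k) (M : ℤ) (hM1 : 1 < M) (L : List (Fin k → ℤ)) (hI : Inv L M)
    (hM : win L (L.length - 1) = M) : Good L M := by
  have hn := hI.len
  have hD : D (L.take (k-1) ++ [L.getD (L.length - 1) 0]) = M := by
    rw [← ee_last (by omega) L hn, ← win_last hk L hn, hM]
  obtain ⟨s, hs, z, hz⟩ := exists_ndvd (L.take (k-1) ++ [L.getD (L.length - 1) 0]) (by simp; omega)
    (by rw [hD]; exact hM1)
  rw [hD] at hz
  rcases lt_or_eq_of_le (show s ≤ k-1 by omega) with h | rfl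
  · exact start1 hk M s L hI hM z _ _ (cramer_L hk L hn M hM z) (by omega) hz
  · rw [take_set (by omega) L hn, ← ee_last (by omega) L hn] at hz
    exact start0 hk M L hI hM z hz

lemma win_rot_iter (hk : 1 ≤ k) (L : List (Fin k → ℤ)) (hn : k ≤ L.length) (i : ℕ) : ∀ j,
    i + j < L.length → win (rot^[i] L) j = win L (i + j) := by
  induction i with
  | zero => intro j hj; simp
  | succ i ih =>
    intro j hj
    rw [Function.iterate_succ_apply', win_rot hk _ (by rw [rot_iter_length]; exact hn) _
      (by rw [rot_iter_length]; omega), ih (j+1) (by omega)]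
    congr 1; omega

lemma good_of_cnt (hk : 2 ≤ k) (M : ℤ) (hM1 : 1 < M) (L : List (Fin k → ℤ)) (hI : Inv L M)
    (hc : cnt L M ≠ 0) : Good L M := by
  have hn := hI.len
  obtain ⟨i, hi, hw⟩ : ∃ i < L.length, win L i = M := by
    by_contra h
    push Not at h
    apply hc
    unfold cnt
    refine Finset.sum_eq_zero fun i hi => if_neg (h i (by simpa using hi))
  have hI' := inv_rot_iter (by omega) hI (i+1)
  have hl := rot_iter_length L (i+1)
  obtain ⟨L', x1, x2, x3⟩ := good_of_last hk M hM1 (rot^[i+1] L) hI' (by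
    rw [hl, Function.iterate_succ_apply', win_rot_last (by omega) _ (by rw [rot_iter_length]; exact hn) _
      (by rw [rot_iter_length]; omega), win_rot_iter (by omega) L hn i 0 (by omega)]
    exact hw)
  exact ⟨L', ((Ext.refl L).rot_iter _).trans x1, x2, by rwa [cnt_rot_iter (by omega) hn] at x3⟩

lemma complete_aux (hk : 2 ≤ k) (M : ℕ) : ∀ (c : ℕ) (L : List (Fin k → ℤ)), Inv L (M + 1) →
    cnt L (M+1) ≤ c → ∃ L', Ext L L' ∧ Inv L' 1 := by
  induction M with
  | zero => intro c L hI _; exact ⟨L, Ext.refl L, by simpa using hI⟩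
  | succ M ihM =>
    intro c
    induction c with
    | zero =>
      intro L hI hc
      refine ihM (cnt L (M+1)) L ⟨hI.pos, hI.len, hI.prim, ?_⟩ le_rfl
      intro i hi
      have h1 := hI.bdd i hi
      rcases lt_or_eq_of_le h1 with h | h
      · push_cast at h; omega
      · exfalso
        have : 0 < cnt L ((M+1 : ℕ) + 1) := by
          unfold cnt
          refine Finset.sum_pos' (fun _ _ => Nat.zero_le _) ⟨i, by simpa using hi, ?_⟩
          rw [if_pos h]; exact one_pos
        omega
    | succ c ihc =>
      intro L hI hc
      by_cases h0 : cnt L ((M+1 : ℕ)+1) = 0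
      · exact ihc L hI (by omega)
      obtain ⟨L', x1, x2, x3⟩ := good_of_cnt hk _ (by omega) L hI h0
      obtain ⟨L'', y1, y2⟩ := ihc L' x2 (by omega)
      exact ⟨L'', x1.trans y1, y2⟩

lemma sub_rot_step {A B : List (Fin k → ℤ)} (h : A.Sublist B) :
    ∃ j, (rot A).Sublist (rot^[j] B) := by
  cases A with
  | nil => exact ⟨0, by simp [rot]⟩
  | cons a R =>
    obtain ⟨r1, r2, rfl, ha, hR⟩ := List.cons_sublist_iff.mp h
    obtain ⟨C, E, rfl⟩ := List.append_of_mem ha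
    refine ⟨(C ++ [a]).length, ?_⟩
    have e : C ++ a :: E ++ r2 = (C ++ [a]) ++ (E ++ r2) := by simp
    rw [e, rot_iter_append]
    simp only [rot, List.map_append, List.map_cons, List.map_nil]
    refine (hR.trans (List.sublist_append_right _ _)).append (List.sublist_append_right _ _)

lemma sub_rot_iter {A B : List (Fin k → ℤ)} (h : A.Sublist B) (i : ℕ) :
    ∃ j, (rot^[i] A).Sublist (rot^[j] B) := by
  induction i with
  | zero => exact ⟨0, h⟩
  | succ i ih =>
    obtain ⟨j, hj⟩ := ih
    obtain ⟨j', hj'⟩ := sub_rot_step hj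
    exact ⟨j' + j, by rw [Function.iterate_succ_apply', Function.iterate_add_apply]; exact hj'⟩

lemma ext_to_sub {L L' : List (Fin k → ℤ)} (h : Ext L L') : ∃ j, L.Sublist (rot^[j] L') := by
  obtain ⟨i, hi⟩ := h
  cases L with
  | nil => exact ⟨0, by simp⟩
  | cons a L =>
    obtain ⟨j, hj⟩ := sub_rot_iter hi (i * (2 * (a :: L).length) - i)
    refine ⟨j, ?_⟩
    rw [← Function.iterate_add_apply, Nat.sub_add_cancel (by rw [List.length_cons]; nlinarith), rot_period_mul] at hj
    exact hj

/-- frieze completion -/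
theorem complete (hk : 1 ≤ k) (L : List (Fin k → ℤ)) (hL : Pos L) (hn : k ≤ L.length)
    (hp : ∀ x ∈ L, Prim x) : ∃ L', L.Sublist L' ∧ Pos L' ∧ ∀ i < L'.length, win L' i = 1 := by
  rcases Nat.lt_or_ge 1 k with h2 | h2
  · obtain ⟨M, hM⟩ : ∃ M : ℕ, Bdd L (M + 1) := by
      refine ⟨∑ i ∈ Finset.range L.length, (win L i).toNat, fun i hi => ?_⟩
      have : (win L i).toNat ≤ ∑ i ∈ Finset.range L.length, (win L i).toNat :=
        Finset.single_le_sum (f := fun i => (win L i).toNat) (fun _ _ => Nat.zero_le _) (by simpa using hi)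
      have h3 := Int.self_le_toNat (win L i)
      have h4 : ((win L i).toNat : ℤ) ≤ ((∑ i ∈ Finset.range L.length, (win L i).toNat : ℕ) : ℤ) := by
        exact_mod_cast this
      omega
    obtain ⟨L', x1, x2⟩ := complete_aux h2 M _ L ⟨hL, hn, hp, hM⟩ le_rfl
    obtain ⟨j, hj⟩ := ext_to_sub x1
    have hI := inv_rot_iter (by omega) x2 j
    refine ⟨_, hj, hI.pos, fun i hi => ?_⟩
    have := hI.bdd i hi
    have := pos_win _ hI.pos hI.len i hi
    omega
  · have h1 : k = 1 := by omega
    subst h1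
    refine ⟨L, List.Sublist.refl _, hL, fun i hi => ?_⟩
    have h3 := pos_win L hL hn i hi
    have e : win L i = L[i] 0 := by
      unfold win
      have : i + 1 - L.length = 0 := by omega
      rw [this, List.drop_eq_getElem_cons hi, List.take_zero, List.nil_append]
      unfold D
      refine (Matrix.det_fin_one (Matrix.of _)).trans ?_
      rfl
    rw [e] at h3 ⊢
    obtain ⟨c, hc⟩ := hp L[i] (List.getElem_mem hi)
    simp at hc
    rcases Int.isUnit_iff.mp (IsUnit.of_mul_eq_one_right _ hc) with h | h
    · exact h
    · omega

end Fz

namespace Fz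
variable {k : ℕ}

lemma colDet_eq (v : Fin k → (Fin k → ℤ)) : colDet v = D (List.ofFn v) := by
  unfold colDet
  rw [← Matrix.det_transpose]
  unfold D
  change _ = Matrix.det _
  congr 1
  funext s r
  simp [Matrix.transpose]

lemma sub_of_sm {α : Type*} {m n : ℕ} (x : Fin n → α) (f : Fin m → Fin n) (hf : StrictMono f) :
    (List.ofFn (fun s => x (f s))).Sublist (List.ofFn x) := by
  rw [List.sublist_iff_exists_fin_orderEmbedding_get_eq]
  refine ⟨OrderEmbedding.ofStrictMono (fun s => Fin.cast (by simp) (f (Fin.cast (by simp) s))) ?_, ?_⟩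
  · intro a b hab
    exact hf hab
  · intro s
    simp [OrderEmbedding.ofStrictMono]
    rfl

lemma sm_of_sub {α : Type*} {m n : ℕ} (x : Fin n → α) (l : List α) (h : l.Sublist (List.ofFn x))
    (hl : l.length = m) : ∃ f : Fin m → Fin n, StrictMono f ∧ l = List.ofFn (fun s => x (f s)) := by
  obtain ⟨f, hf⟩ := List.sublist_iff_exists_fin_orderEmbedding_get_eq.mp h
  subst hl
  refine ⟨fun s => Fin.cast (by simp) (f s), fun a b hab => f.strictMono hab, ?_⟩
  apply List.ext_getElem
  · simp
  · intro i h1 h2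
    have := hf ⟨i, h1⟩
    simp only [List.get_eq_getElem, List.getElem_ofFn] at this ⊢
    rw [this]
    rfl

lemma win_cyc (ℓ : ℕ) (L : List (Fin k → ℤ)) (hℓ : L.length = ℓ) (hk : k ≤ ℓ) (i : Fin ℓ) (g : Fin k → Fin ℓ)
    (hg : StrictMono g)
    (hr : Set.range g = {t : Fin ℓ | ∃ j : Fin k, (t : ℕ) = ((i : ℕ) + (j : ℕ)) % ℓ}) :
    colDet (fun s => L.get (Fin.cast hℓ.symm (g s))) = win L i := by
  subst hℓ
  have hi := i.2
  obtain ⟨b, hb⟩ : ∃ b, (i : ℕ) + k - L.length = b := ⟨_, rfl⟩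
  let g0 : Fin k → Fin L.length := fun s => ⟨if (s : ℕ) < b then s else i + (s - b), by
    have := s.2; split_ifs <;> omega⟩
  have h0 : StrictMono g0 := by
    intro s t hst
    have hst : (s : ℕ) < t := hst
    have := s.2
    have := t.2
    change (if (s : ℕ) < b then (s:ℕ) else i + (s - b)) < (if (t : ℕ) < b then (t:ℕ) else i + (t - b))
    split_ifs <;> omega
  have hr0 : Set.range g0 = {t : Fin L.length | ∃ j : Fin k, (t : ℕ) = ((i : ℕ) + (j : ℕ)) % L.length} := by
    ext t
    simp only [Set.mem_range, Set.mem_ofPred_eq]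
    constructor
    · rintro ⟨s, rfl⟩
      have := s.2
      by_cases h : (s : ℕ) < b
      · refine ⟨⟨L.length - i + s, by omega⟩, ?_⟩
        simp only [g0, if_pos h]
        have : (i : ℕ) + (L.length - i + s) = s + L.length := by omega
        rw [this, Nat.add_mod_right, Nat.mod_eq_of_lt (by omega)]
      · refine ⟨⟨s - b, by omega⟩, ?_⟩
        simp only [g0, if_neg h]
        rw [Nat.mod_eq_of_lt (by omega)]
    · rintro ⟨j, hj⟩
      have := j.2
      by_cases h : (i : ℕ) + j < L.length
      · rw [Nat.mod_eq_of_lt h] at hj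
        refine ⟨⟨j + b, by omega⟩, Fin.ext ?_⟩
        simp only [g0]
        rw [if_neg (by omega)]; omega
      · have e : (i : ℕ) + j = (i + j - L.length) + L.length := by omega
        rw [e, Nat.add_mod_right, Nat.mod_eq_of_lt (by omega)] at hj
        refine ⟨⟨i + j - L.length, by omega⟩, Fin.ext ?_⟩
        simp only [g0]
        rw [if_pos (by omega)]; omega
  have hgg : g = g0 := (StrictMono.range_inj hg h0).mp (hr.trans hr0.symm)
  subst hgg
  rw [colDet_eq]
  unfold win
  rw [hb]
  congr 1
  apply List.ext_getElem
  · simp; omega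
  · intro s h1 h2
    simp only [List.length_ofFn] at h1
    rw [List.getElem_ofFn, List.getElem_append]
    simp only [List.length_take, List.getElem_take, List.getElem_drop, List.get_eq_getElem, g0]
    by_cases h3 : s < b
    · have h4 : s < min b L.length := by omega
      simp only [h3, h4, Fin.cast_mk, if_true, dif_pos]
    · have h4 : ¬ s < min b L.length := by omega
      have e1 : (if s < b then s else (i : ℕ) + (s - b)) = i + (s - min b L.length) := by
        rw [if_neg h3]; omega
      simp only [h4, Fin.cast_mk, e1, dif_neg, not_false_iff]

theorem frieze_fin (hk : 1 ≤ k) {n : ℕ} (hn : k ≤ n) (x : Fin n → Fin k → ℤ)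
    (hpos : ∀ f : Fin k → Fin n, StrictMono f → 0 < colDet (fun s => x (f s)))
    (hp : ∀ i, Prim (x i)) :
    ∃ ℓ : ℕ, n ≤ ℓ ∧
      ∃ (y : Fin ℓ → (Fin k → ℤ)) (idx : Fin n → Fin ℓ),
        StrictMono idx ∧
        (∀ g : Fin k → Fin ℓ, StrictMono g → 0 < colDet (fun s => y (g s))) ∧
        (∀ i : Fin ℓ, ∀ g : Fin k → Fin ℓ, StrictMono g →
          (Set.range g = {t : Fin ℓ | ∃ j : Fin k, (t : ℕ) = ((i : ℕ) + (j : ℕ)) % ℓ}) →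
          colDet (fun s => y (g s)) = 1) ∧
        (∀ i, x i = y (idx i)) := by
  obtain ⟨L', h1, h2, h3⟩ := complete hk (List.ofFn x) (by
    intro l hl hlen
    obtain ⟨f, hf, rfl⟩ := sm_of_sub x l hl hlen
    rw [← colDet_eq]
    exact hpos f hf) (by simpa using hn) (by
    intro v hv
    obtain ⟨i, rfl⟩ := List.mem_ofFn.mp hv
    exact hp i)
  have hlen : n ≤ L'.length := by simpa using h1.length_le
  have e : List.ofFn L'.get = L' := List.ofFn_get L'
  obtain ⟨idx, hidx, hx⟩ := sm_of_sub (m := n) L'.get (List.ofFn x) (by rw [e]; exact h1) (by simp)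
  refine ⟨L'.length, hlen, L'.get, idx, hidx, ?_, ?_, ?_⟩
  · intro g hg
    rw [colDet_eq]
    apply h2
    · have := sub_of_sm L'.get g hg
      rwa [e] at this
    · simp
  · intro i g hg hr
    have := win_cyc L'.length L' rfl (hn.trans hlen) i g hg hr
    rw [h3 i i.2] at this
    exact this
  · intro i
    exact congrFun (List.ofFn_injective hx) i

end Fz

namespace Fz
variable {k : ℕ}

lemma dvd_of_span (S : Set ℤ) (e : ℤ) (he : e ∈ Ideal.span S) (d c : ℤ) (h : ∀ s ∈ S, d ∣ c * s) :
    d ∣ c * e := by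
  induction he using Submodule.span_induction with
  | mem x hx => exact h x hx
  | zero => simp
  | add x y _ _ hx hy => rw [mul_add]; exact dvd_add hx hy
  | smul a x _ hx => rw [smul_eq_mul, mul_left_comm]; exact hx.mul_left a

/-- colDet as an alternating map -/
lemma colDet_alt (v : Fin k → (Fin k → ℤ)) : colDet v = Matrix.detRowAlternating (R := ℤ) v := by
  unfold colDet
  rw [← Matrix.det_transpose]
  rfl

lemma colDet_mulVec (B : Matrix (Fin k) (Fin k) ℤ) (v : Fin k → (Fin k → ℤ)) :
    colDet (fun s => B.mulVec (v s)) = B.det * colDet v := by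
  unfold colDet
  rw [← Matrix.det_mul]
  congr 1

lemma colDet_perm (v : Fin k → (Fin k → ℤ)) (σ : Equiv.Perm (Fin k)) :
    colDet (fun s => v (σ s)) = (Equiv.Perm.sign σ : ℤ) • colDet v := by
  rw [colDet_alt, colDet_alt]
  have := AlternatingMap.map_perm (Matrix.detRowAlternating (R := ℤ) (n := Fin k)) v σ
  rw [Units.smul_def] at this
  exact this

lemma colDet_noninj {α : Type*} (x : α → (Fin k → ℤ)) (f : Fin k → α) (hf : ¬ Function.Injective f) :
    colDet (fun s => x (f s)) = 0 := by
  rw [colDet_alt]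
  simp only [Function.Injective, not_forall] at hf
  obtain ⟨a, b, hab, hne⟩ := hf
  exact AlternatingMap.map_eq_zero_of_eq _ _ (congrArg x hab) hne

lemma exists_sort {n : ℕ} (f : Fin k → Fin n) (hf : Function.Injective f) :
    ∃ σ : Equiv.Perm (Fin k), StrictMono (f ∘ σ) :=
  ⟨Tuple.sort f, (Tuple.monotone_sort f).strictMono_of_injective (hf.comp (Equiv.injective _))⟩

lemma alt_mem {n : ℕ} (F : (Fin k → Fin n) → ℤ)
    (h1 : ∀ (f : Fin k → Fin n) (σ : Equiv.Perm (Fin k)), F (f ∘ σ) = (Equiv.Perm.sign σ : ℤ) • F f)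
    (h2 : ∀ f, ¬ Function.Injective f → F f = 0) (I : Ideal ℤ) (f : Fin k → Fin n)
    (hI : ∀ σ : Equiv.Perm (Fin k), StrictMono (f ∘ σ) → F (f ∘ σ) ∈ I) : F f ∈ I := by
  by_cases hf : Function.Injective f
  · obtain ⟨σ, hσ⟩ := exists_sort f hf
    have h := hI σ hσ
    rw [h1] at h
    have h' := I.mul_mem_left (Equiv.Perm.sign σ : ℤ) h
    rw [smul_eq_mul, ← mul_assoc] at h'
    have : (Equiv.Perm.sign σ : ℤ) * (Equiv.Perm.sign σ : ℤ) = 1 := by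
      rcases Int.units_eq_one_or (Equiv.Perm.sign σ) with h | h <;> simp [h]
    rwa [this, one_mul] at h'
  · rw [h2 f hf]; exact I.zero_mem

lemma minors_span {n : ℕ} (x : Fin n → (Fin k → ℤ)) (hx : Submodule.span ℤ (Set.range x) = ⊤) :
    (1 : ℤ) ∈ Ideal.span {d : ℤ | ∃ f : Fin k → Fin n, StrictMono f ∧ d = colDet (fun s => x (f s))} := by
  have hc : ∀ s : Fin k, ∃ c : Fin n → ℤ, ∑ i, c i • x i = Pi.single s 1 := by
    intro s
    have : (Pi.single s 1 : Fin k → ℤ) ∈ Submodule.span ℤ (Set.range x) := by rw [hx]; trivial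
    exact (Submodule.mem_span_range_iff_exists_fun ℤ).mp this
  choose c hc using hc
  have h1 : (1 : ℤ) = Matrix.detRowAlternating (R := ℤ) (fun s : Fin k => ∑ i, c s i • x i) := by
    have : (fun s : Fin k => ∑ i, c s i • x i) = (1 : Matrix (Fin k) (Fin k) ℤ) := by
      funext s r
      rw [hc, Matrix.one_apply, Pi.single_apply]
      simp [eq_comm]
    rw [this]
    exact Matrix.det_one.symm
  rw [h1]
  have h2 := MultilinearMap.map_sum (Matrix.detRowAlternating (R := ℤ) (n := Fin k)).toMultilinearMap
    (fun s i => c s i • x i)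
  simp only [AlternatingMap.coe_multilinearMap] at h2
  rw [h2]
  refine Ideal.sum_mem _ fun r _ => ?_
  have h3 := MultilinearMap.map_smul_univ (Matrix.detRowAlternating (R := ℤ) (n := Fin k)).toMultilinearMap
    (fun s => c s (r s)) (fun s => x (r s))
  simp only [AlternatingMap.coe_multilinearMap] at h3
  rw [h3, smul_eq_mul]
  refine Ideal.mul_mem_left _ _ ?_
  rw [← colDet_alt]
  exact alt_mem (fun f => colDet (fun s => x (f s))) (fun f σ => colDet_perm (fun s => x (f s)) σ)
    (fun f hf => colDet_noninj x f hf) _ r (fun σ hσ => Ideal.subset_span ⟨_, hσ, rfl⟩)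

lemma span_lemma (hk : 1 ≤ k) {n : ℕ} (X : Fin n → (Fin k → ℤ)) (f0 : Fin k → Fin n)
    (h0 : colDet (fun s => X (f0 s)) ≠ 0) :
    ∃ (B : Matrix (Fin k) (Fin k) ℤ) (x : Fin n → (Fin k → ℤ)), 0 < B.det ∧
      (∀ i, X i = B.mulVec (x i)) ∧ Submodule.span ℤ (Set.range x) = ⊤ := by
  obtain ⟨B, x, hB, hs⟩ : ∃ (B : Matrix (Fin k) (Fin k) ℤ) (x : Fin n → (Fin k → ℤ)),
      (∀ i, X i = B.mulVec (x i)) ∧ Submodule.span ℤ (Set.range x) = ⊤ := by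
    set N := Submodule.span ℤ (Set.range X) with hN
    have hm : ∀ i, X i ∈ N := fun i => Submodule.subset_span ⟨i, rfl⟩
    have hli : LinearIndependent ℤ (fun s => (⟨X (f0 s), hm _⟩ : N)) := by
      have : LinearIndependent ℤ (fun s => X (f0 s)) := by
        apply Matrix.linearIndependent_rows_of_det_ne_zero (A := Matrix.of fun s => X (f0 s))
        rw [colDet_alt] at h0
        exact h0
      exact LinearIndependent.of_comp N.subtype this
    have hr : Module.finrank ℤ N = k := by
      apply le_antisymm
      · simpa using Submodule.finrank_le N
      · simpa using hli.fintype_card_le_finrank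
    let b := Module.finBasisOfFinrankEq ℤ N hr
    refine ⟨Matrix.of fun r s => (b s : Fin k → ℤ) r, fun i => b.repr ⟨X i, hm i⟩, ?_, ?_⟩
    · intro i
      have := congrArg Subtype.val (b.sum_repr ⟨X i, hm i⟩)
      simp only [AddSubmonoidClass.coe_finsetSum, SetLike.val_smul] at this
      conv_lhs => rw [← this]
      funext r
      simp [Matrix.mulVec, dotProduct, mul_comm]
    · have hT : Submodule.span ℤ (Set.range (fun i => (⟨X i, hm i⟩ : N))) = ⊤ := by
        rw [eq_top_iff]
        rintro ⟨v, hv⟩ _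
        obtain ⟨c, rfl⟩ := (Submodule.mem_span_range_iff_exists_fun ℤ).mp hv
        refine (Submodule.mem_span_range_iff_exists_fun ℤ).mpr ⟨c, Subtype.ext ?_⟩
        simp
      have e : Set.range (fun i => (b.repr ⟨X i, hm i⟩ : Fin k → ℤ)) =
          b.equivFun.toLinearMap '' (Set.range (fun i => (⟨X i, hm i⟩ : N))) := by
        rw [← Set.range_comp]; rfl
      rw [e, ← Submodule.map_span, hT, Submodule.map_top, LinearMap.range_eq_top]
      exact b.equivFun.surjective
  have hd : B.det ≠ 0 := by
    intro h
    apply h0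
    have : (fun s => X (f0 s)) = fun s => B.mulVec (x (f0 s)) := funext fun s => hB _
    rw [this, colDet_mulVec, h, zero_mul]
  rcases lt_or_gt_of_ne hd with h | h
  · let T : Matrix (Fin k) (Fin k) ℤ := Matrix.diagonal (Function.update 1 ⟨0, hk⟩ (-1))
    have hT : T * T = 1 := by
      rw [Matrix.diagonal_mul_diagonal, ← Matrix.diagonal_one]
      congr 1
      funext i
      by_cases hi : i = ⟨0, hk⟩
      · subst hi; simp
      · simp [Function.update_of_ne hi]
    have hTd : T.det = -1 := by
      rw [Matrix.det_diagonal, Finset.prod_update_of_mem (Finset.mem_univ _)]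
      simp
    refine ⟨B * T, fun i => T.mulVec (x i), ?_, ?_, ?_⟩
    · rw [Matrix.det_mul, hTd]; linarith
    · intro i
      rw [Matrix.mulVec_mulVec, mul_assoc, hT, mul_one, hB]
    · have e : Set.range (fun i => T.mulVec (x i)) = (Matrix.mulVecLin T) '' (Set.range x) := by
        rw [← Set.range_comp]; rfl
      rw [e, ← Submodule.map_span, hs, Submodule.map_top, LinearMap.range_eq_top]
      intro v
      refine ⟨T.mulVec v, ?_⟩
      rw [Matrix.mulVecLin_apply, Matrix.mulVec_mulVec, hT, Matrix.one_mulVec]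
  · exact ⟨B, x, h, hB, hs⟩

end Fz

namespace Fz

lemma plu_last {K n : ℕ} (p : (Fin (K+1) → Fin n) → ℤ) (hp : IsSpecialization (K+1) n p)
    (f g : Fin (K+1) → Fin n) :
    p g * p f = ∑ r, p (Function.update g r (f (Fin.last K))) * p (Function.update f (Fin.last K) (g r)) := by
  obtain ⟨h1, h2, h3⟩ := hp
  have h := h3 (fun s => f (Fin.castSucc s)) (Fin.cons (f (Fin.last K)) g)
  have hpt : ∀ y, pluTuple (k := K+1) (fun s => f (Fin.castSucc s)) y = Function.update f (Fin.last K) y := by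
    intro y
    funext s
    unfold pluTuple
    by_cases hs : s = Fin.last K
    · subst hs
      rw [dif_neg (by simp), Function.update_self]
    · rw [Function.update_of_ne hs]
      have : (s : ℕ) < K := by
        have := s.2
        have : (s : ℕ) ≠ K := fun e => hs (Fin.ext e)
        omega
      rw [dif_pos (by simpa using this)]
      rfl
  rw [Fin.sum_univ_succ] at h
  have e0 : (Fin.cons (f (Fin.last K)) g : Fin (K+1+1) → Fin n) ∘ (0 : Fin (K+1+1)).succAbove = g := by
    funext m; simp
  have er : ∀ r : Fin (K+1), p ((Fin.cons (f (Fin.last K)) g : Fin (K+1+1) → Fin n) ∘ (r.succ).succAbove) =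
      (-1) ^ (r : ℕ) * p (Function.update g r (f (Fin.last K))) := by
    intro r
    have : (Fin.cons (f (Fin.last K)) g : Fin (K+1+1) → Fin n) ∘ (r.succ).succAbove =
        (Function.update g r (f (Fin.last K))) ∘ (Fin.cycleRange r).symm := by
      funext m
      refine Fin.cases ?_ (fun m => ?_) m
      · simp
      · simp only [Function.comp_apply, Fin.cycleRange_symm_succ, Fin.succ_succAbove_succ, Fin.cons_succ]
        rw [Function.update_of_ne (Fin.succAbove_ne r m)]
    rw [this, h1, Equiv.Perm.sign_symm, Fin.sign_cycleRange]
    simp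
  rw [e0, Fin.cons_zero, hpt, Function.update_eq_self] at h
  simp only [Fin.cons_succ, er, hpt, Fin.val_zero, pow_zero, one_mul, Fin.val_succ] at h
  have h4 : ∑ r, p (Function.update g r (f (Fin.last K))) * p (Function.update f (Fin.last K) (g r)) =
      - ∑ x : Fin (K+1), (-1) ^ ((x : ℕ) + 1) * p (Function.update f (Fin.last K) (g x)) *
        ((-1) ^ (x : ℕ) * p (Function.update g x (f (Fin.last K)))) := by
    rw [← Finset.sum_neg_distrib]
    refine Finset.sum_congr rfl fun r _ => ?_
    have : ((-1 : ℤ) ^ (r : ℕ)) * (-1) ^ (r : ℕ) = 1 := by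
      rw [← pow_add, ← two_mul, pow_mul]; simp
    rw [pow_succ]
    linear_combination (- p (Function.update g r (f (Fin.last K))) * p (Function.update f (Fin.last K) (g r))) * this
  rw [h4]
  linarith

lemma plu {K n : ℕ} (p : (Fin (K+1) → Fin n) → ℤ) (hp : IsSpecialization (K+1) n p)
    (f g : Fin (K+1) → Fin n) (s : Fin (K+1)) :
    p g * p f = ∑ r, p (Function.update g r (f s)) * p (Function.update f s (g r)) := by
  have h := plu_last p hp (f ∘ Equiv.swap s (Fin.last K)) g
  have e : ∀ y, Function.update (f ∘ Equiv.swap s (Fin.last K)) (Fin.last K) y =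
      Function.update f s y ∘ Equiv.swap s (Fin.last K) := by
    intro y
    rw [Function.update_comp_equiv]
    simp
  simp only [e, hp.1, Function.comp_apply, Equiv.swap_apply_right, smul_eq_mul] at h
  have hs : (Equiv.Perm.sign (Equiv.swap s (Fin.last K)) : ℤ) ≠ 0 := by simp
  apply mul_left_cancel₀ hs
  rw [Finset.mul_sum]
  rw [mul_left_comm] at h
  rw [h]
  refine Finset.sum_congr rfl fun r _ => ?_
  ring

lemma rep {K n : ℕ} (p : (Fin (K+1) → Fin n) → ℤ) (hp : IsSpecialization (K+1) n p)
    (f0 : Fin (K+1) → Fin n) (h0 : p f0 ≠ 0) (f : Fin (K+1) → Fin n) :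
    colDet (fun s r => p (Function.update f0 r (f s))) = p f0 ^ K * p f := by
  set X : Fin n → Fin (K+1) → ℤ := fun i r => p (Function.update f0 r i) with hX
  have hinj : Function.Injective f0 := by
    by_contra h; exact h0 (hp.2.1 _ h)
  have hX0 : ∀ r, X (f0 r) = Pi.single r (p f0) := by
    intro r
    funext r'
    by_cases h : r' = r
    · subst h; simp [hX]
    · rw [Pi.single_eq_of_ne h]
      apply hp.2.1
      intro hi
      apply h
      apply hi
      rw [Function.update_self, Function.update_of_ne (Ne.symm h)]
  change colDet (fun s => X (f s)) = _
  suffices H : ∀ T : Finset (Fin (K+1)), ∀ f : Fin (K+1) → Fin n, (∀ s ∉ T, f s ∈ Set.range f0) →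
      colDet (fun s => X (f s)) = p f0 ^ K * p f by
    exact H Finset.univ f (fun s hs => absurd (Finset.mem_univ s) hs)
  intro T
  induction T using Finset.induction with
  | empty =>
    intro f hf
    have : ∀ s, ∃ t, f0 t = f s := fun s => hf s (by simp)
    choose τ hτ using this
    have hfe : f = f0 ∘ τ := funext fun s => (hτ s).symm
    by_cases hi : Function.Injective τ
    · let σ : Equiv.Perm (Fin (K+1)) := Equiv.ofBijective τ (Finite.injective_iff_bijective.mp hi)
      have hσ : f = f0 ∘ σ := hfe
      rw [hσ, hp.1]
      have h1 := colDet_perm (fun s => X (f0 s)) σ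
      rw [show (fun s => X ((f0 ∘ σ) s)) = fun s => (fun s => X (f0 s)) (σ s) from rfl, h1]
      have h2 : colDet (fun s => X (f0 s)) = p f0 ^ (K+1) := by
        have : (fun s => X (f0 s)) = Matrix.diagonal (fun _ : Fin (K+1) => p f0) := by
          funext s r
          rw [hX0, Matrix.diagonal_apply, Pi.single_apply]
          simp [eq_comm]
        rw [colDet_alt, this]
        refine (Matrix.det_diagonal).trans ?_
        simp
      rw [h2, smul_eq_mul, smul_eq_mul]; ring
    · have : ¬ Function.Injective f := by
        rw [hfe]; intro h; exact hi (h.of_comp)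
      rw [hp.2.1 f this, colDet_noninj X f this, mul_zero]
  | insert s T hs ih =>
    intro f hf
    apply mul_left_cancel₀ h0
    have e1 := plu p hp f f0 s
    have hupd : ∀ r, colDet (fun t => X (Function.update f s (f0 r) t)) =
        p f0 ^ K * p (Function.update f s (f0 r)) := by
      intro r
      apply ih
      intro t ht
      by_cases h : t = s
      · subst h; simp
      · rw [Function.update_of_ne h]
        exact hf t (by simp [h, ht])
    have e2 : p f0 * colDet (fun t => X (f t)) = ∑ r, p (Function.update f0 r (f s)) *
        colDet (fun t => X (Function.update f s (f0 r) t)) := by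
      let φ := (Matrix.detRowAlternating (R := ℤ) (n := Fin (K+1))).toMultilinearMap.toLinearMap
        (fun t => X (f t)) s
      have hφ : ∀ y, φ y = colDet (Function.update (fun t => X (f t)) s y) := by
        intro y; rw [colDet_alt]; rfl
      have h1 : colDet (fun t => X (f t)) = φ (X (f s)) := by
        rw [hφ]; congr 1; rw [Function.update_eq_self_iff.mpr rfl]
      have h2 : ∀ r, colDet (fun t => X (Function.update f s (f0 r) t)) = φ (X (f0 r)) := by
        intro r
        rw [hφ]; congr 1; funext t
        by_cases h : t = s
        · subst h; simp
        · simp [Function.update_of_ne h]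
      rw [h1]
      simp only [h2]
      have h3 : p f0 • X (f s) = ∑ r, p (Function.update f0 r (f s)) • X (f0 r) := by
        funext t
        simp only [hX0, Finset.sum_apply, Pi.smul_apply, smul_eq_mul, Pi.single_apply, mul_ite, mul_zero]
        simp [hX, mul_comm]
      rw [← smul_eq_mul, ← map_smul, h3, map_sum]
      simp only [map_smul, smul_eq_mul]
    rw [e2, mul_left_comm, e1, Finset.mul_sum]
    refine Finset.sum_congr rfl fun r _ => ?_
    rw [hupd]; ring

/-- representation of a specialization by a spanning family -/
theorem rep_span (k n : ℕ) (hk : 1 ≤ k) (hkn : k ≤ n)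
    (p : (Fin k → Fin n) → ℤ) (hspec : IsSpecialization k n p)
    (hpos : ∀ f : Fin k → Fin n, StrictMono f → 0 < p f)
    (ε : ℤ) (hεpos : 0 < ε)
    (hε : Ideal.span {x : ℤ | ∃ f : Fin k → Fin n, StrictMono f ∧ x = p f} =
      Ideal.span ({ε} : Set ℤ)) :
    ∃ x : Fin n → (Fin k → ℤ), Submodule.span ℤ (Set.range x) = ⊤ ∧
      ∀ f, p f = ε * colDet (fun s => x (f s)) := by
  obtain ⟨K, rfl⟩ : ∃ K, k = K + 1 := ⟨k-1, by omega⟩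
  let f0 : Fin (K+1) → Fin n := Fin.castLE hkn
  have hf0 : 0 < p f0 := hpos f0 (Fin.strictMono_castLE hkn)
  have hr := rep p hspec f0 hf0.ne'
  obtain ⟨B, x, hB, hx, hs⟩ := span_lemma hk (fun i r => p (Function.update f0 r i)) f0 (by
    rw [hr f0]; positivity)
  have hm : ∀ f, p f0 ^ K * p f = B.det * colDet (fun s => x (f s)) := by
    intro f
    rw [← hr, ← colDet_mulVec]
    congr 1
    funext s
    exact hx (f s)
  have hc : 0 < p f0 ^ K := by positivity
  have d1 : B.det ∣ p f0 ^ K * ε := by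
    apply dvd_of_span _ _ (hε ▸ Ideal.mem_span_singleton_self ε : ε ∈ Ideal.span {x : ℤ | ∃ f : Fin (K+1) → Fin n, StrictMono f ∧ x = p f})
    rintro _ ⟨f, _, rfl⟩
    exact ⟨_, hm f⟩
  have hdiv : ∀ f, StrictMono f → ε ∣ p f := by
    intro f hf
    rw [← Ideal.mem_span_singleton, ← hε]
    exact Ideal.subset_span ⟨f, hf, rfl⟩
  have d2 : p f0 ^ K * ε ∣ B.det := by
    have := dvd_of_span _ _ (minors_span x hs) (p f0 ^ K * ε) B.det (by
      rintro _ ⟨f, hf, rfl⟩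
      rw [← hm]
      exact mul_dvd_mul_left _ (hdiv f hf))
    simpa using this
  have e : B.det = p f0 ^ K * ε := Int.dvd_antisymm hB.le (by positivity) d1 d2
  refine ⟨x, hs, fun f => mul_left_cancel₀ hc.ne' ?_⟩
  rw [hm, e]; ring

end Fz

namespace Fz
variable {k : ℕ}

lemma cramer (v : Fin k → (Fin k → ℤ)) (b : Fin k → ℤ) :
    colDet v • b = ∑ r, colDet (Function.update v r b) • v r := by
  have h := Matrix.mulVec_cramer (Matrix.of fun r s => v s r) b
  have h2 : ∀ r, colDet (Function.update v r b) = Matrix.cramer (Matrix.of fun r s => v s r) b r := by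
    intro r
    rw [Matrix.cramer_apply]
    unfold colDet
    congr 1
    ext a c
    by_cases hc : c = r
    · subst hc; simp
    · simp [hc]
  simp only [h2]
  unfold colDet
  rw [← h]
  funext t
  simp [Matrix.mulVec, dotProduct, mul_comm]

lemma lin_slot (v : Fin k → (Fin k → ℤ)) (s : Fin k) :
    ∃ c : Fin k → ℤ, ∀ y, colDet (Function.update v s y) = ∑ i, c i * y i := by
  let φ := (Matrix.detRowAlternating (R := ℤ) (n := Fin k)).toMultilinearMap.toLinearMap v s
  refine ⟨fun i => φ (Pi.single i 1), fun y => ?_⟩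
  have h1 : colDet (Function.update v s y) = φ y := by rw [colDet_alt]; rfl
  rw [h1]
  have h2 : y = ∑ i, y i • (Pi.single i 1 : Fin k → ℤ) := by
    funext t
    simp [Finset.sum_apply, Pi.single_apply]
  conv_lhs => rw [h2]
  rw [map_sum]
  refine Finset.sum_congr rfl fun i _ => ?_
  rw [map_smul, smul_eq_mul, mul_comm]

lemma lin_slot' (v : Fin k → (Fin k → ℤ)) (s : Fin k) :
    ∃ c : Fin k → ℤ, colDet v = ∑ i, c i * v s i := by
  obtain ⟨c, hc⟩ := lin_slot v s
  refine ⟨c, ?_⟩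
  rw [← hc, Function.update_eq_self]

lemma prim_of_span (x : Fin k → ℤ) (S : Set ℤ) (h1 : (1 : ℤ) ∈ Ideal.span S)
    (hS : ∀ s ∈ S, ∃ c : Fin k → ℤ, s = ∑ i, c i * x i) : Prim x := by
  have : ∀ e ∈ Ideal.span S, ∃ c : Fin k → ℤ, e = ∑ i, c i * x i := by
    intro e he
    induction he using Submodule.span_induction with
    | mem x hx => exact hS x hx
    | zero => exact ⟨0, by simp⟩
    | add a b _ _ ha hb =>
      obtain ⟨c, rfl⟩ := ha
      obtain ⟨d, rfl⟩ := hb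
      exact ⟨c + d, by simp [add_mul, Finset.sum_add_distrib]⟩
    | smul a b _ hb =>
      obtain ⟨c, rfl⟩ := hb
      exact ⟨a • c, by simp [Finset.mul_sum, mul_assoc]⟩
  obtain ⟨c, hc⟩ := this 1 h1
  exact ⟨c, hc.symm⟩

lemma mem_minors {n : ℕ} (x : Fin n → (Fin k → ℤ)) (i : Fin n) (hx : Prim (x i)) (f : Fin k → Fin n) :
    colDet (fun s => x (f s)) ∈ Ideal.span {d : ℤ | ∃ f : Fin k → Fin n, StrictMono f ∧ (∃ r, f r = i) ∧
      d = colDet (fun s => x (f s))} := by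
  obtain ⟨c, hc⟩ := hx
  have h := cramer (fun s => x (f s)) (x i)
  have h2 : colDet (fun s => x (f s)) =
      ∑ r, (∑ t, c t * x (f r) t) * colDet (fun s => x (Function.update f r i s)) := by
    have e1 : colDet (fun s => x (f s)) = ∑ t, c t * (colDet (fun s => x (f s)) • x i) t := by
      calc colDet (fun s => x (f s)) = colDet (fun s => x (f s)) * ∑ t, c t * x i t := by rw [hc, mul_one]
        _ = _ := by
          rw [Finset.mul_sum]
          refine Finset.sum_congr rfl fun t _ => ?_
          simp; ring
    rw [e1, h]
    simp only [Finset.sum_apply, Finset.mul_sum, Finset.sum_mul]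
    rw [Finset.sum_comm]
    refine Finset.sum_congr rfl fun r _ => Finset.sum_congr rfl fun t _ => ?_
    have : (fun s => x (Function.update f r i s)) = Function.update (fun s => x (f s)) r (x i) := by
      funext s
      by_cases hs : s = r
      · subst hs; simp
      · simp [Function.update_of_ne hs]
    rw [this]
    simp; ring
  rw [h2]
  refine Ideal.sum_mem _ fun r _ => Ideal.mul_mem_left _ _ ?_
  refine alt_mem (fun f => colDet (fun s => x (f s))) ?_ ?_ _ _ ?_
  · intro f σ
    exact colDet_perm (fun s => x (f s)) σ
  · intro f hf
    exact colDet_noninj x f hf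
  · intro σ hσ
    exact Ideal.subset_span ⟨_, hσ, ⟨σ.symm r, by simp⟩, rfl⟩

lemma val_iff (q : ℕ) (hq : q.Prime) (e d : ℤ) (he : e ≠ 0) (hd : d ≠ 0) :
    padicValInt q (e * d) ≠ padicValInt q e ↔ (q : ℤ) ∣ d := by
  have := Fact.mk hq
  rw [padicValInt.mul he hd]
  constructor
  · intro h
    by_contra h2
    exact h (by rw [padicValInt.eq_zero_of_not_dvd h2, add_zero])
  · intro h
    have : 1 ≤ padicValInt q d := by
      have := (padicValInt_dvd_iff (p := q) 1 d).mp (by simpa using h)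
      tauto
    omega

/-- reduction mod q -/
def red (q : ℕ) (v : Fin k → ℤ) : Fin k → ZMod q := fun i => (v i : ZMod q)

lemma red_apply (q : ℕ) (v : Fin k → ℤ) (i) : red q v i = (v i : ZMod q) := rfl

lemma red_colDet (q : ℕ) (v : Fin k → (Fin k → ℤ)) :
    ((colDet v : ℤ) : ZMod q) = Matrix.det (fun s => red q (v s) : Matrix (Fin k) (Fin k) (ZMod q)) := by
  unfold colDet
  rw [← Matrix.det_transpose, Int.cast_det]
  rfl

lemma red_mulVec (q : ℕ) (B : Matrix (Fin k) (Fin k) ℤ) (v : Fin k → ℤ) :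
    red q (B.mulVec v) = (B.map (Int.cast : ℤ → ZMod q)).mulVec (red q v) := by
  funext i
  simp [red, Matrix.mulVec, dotProduct]

lemma prop_dvd {n : ℕ} (q : ℕ) (x : Fin n → (Fin k → ℤ)) (f : Fin k → Fin n) (a b : Fin k) (hab : a ≠ b)
    (c : ZMod q) (h : red q (x (f a)) = c • red q (x (f b))) : (q : ℤ) ∣ colDet (fun s => x (f s)) := by
  rw [← ZMod.intCast_zmod_eq_zero_iff_dvd]
  rw [red_colDet]
  set M : Matrix (Fin k) (Fin k) (ZMod q) := fun s => red q (x (f s)) with hM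
  have : M = Matrix.updateRow M a (c • M b) := by
    rw [← h]
    exact (Function.update_eq_self a M).symm
  rw [this, Matrix.det_updateRow_smul, Matrix.det_updateRow_eq_zero hab.symm, mul_zero]

lemma card_proj (q : ℕ) [Fact q.Prime] :
    Nat.card (Projectivization (ZMod q) (Fin k → ZMod q)) = (q ^ k - 1) / (q - 1) := by
  rw [Projectivization.card'']
  simp [Nat.card_fun]

lemma pigeon {n : ℕ} (q : ℕ) [Fact q.Prime] (z : Fin n → (Fin k → ZMod q)) (w : Fin k → ZMod q) (hw : w ≠ 0)
    (h : ∀ i (c : ZMod q), z i ≠ c • w) (S : Finset (Fin n)) (hS : S.card = (q ^ k - 1) / (q - 1)) :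
    ∃ i ∈ S, ∃ j ∈ S, i ≠ j ∧ ∃ c : ZMod q, z i = c • z j := by
  classical
  have hz : ∀ i, z i ≠ 0 := fun i e => h i 0 (by simp [e])
  haveI : Finite (Projectivization (ZMod q) (Fin k → ZMod q)) := inferInstance
  letI := Fintype.ofFinite (Projectivization (ZMod q) (Fin k → ZMod q))
  let P : Fin n → Projectivization (ZMod q) (Fin k → ZMod q) := fun i => Projectivization.mk _ (z i) (hz i)
  let W : Projectivization (ZMod q) (Fin k → ZMod q) := Projectivization.mk _ w hw
  have hc : (Finset.univ.erase W).card < S.card := by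
    rw [hS, ← card_proj q, Nat.card_eq_fintype_card]
    exact Finset.card_erase_lt_of_mem (Finset.mem_univ W)
  obtain ⟨i, hi, j, hj, hij, e⟩ := Finset.exists_ne_map_eq_of_card_lt_of_maps_to hc (f := P) (by
    intro i _
    simp only [Finset.coe_erase, Finset.coe_univ, Set.mem_diff, Set.mem_univ, true_and, Set.mem_singleton_iff]
    intro e
    obtain ⟨a, ha⟩ := (Projectivization.mk_eq_mk_iff' _ _ _ _ _).mp e
    exact h i a ha.symm)
  obtain ⟨a, ha⟩ := (Projectivization.mk_eq_mk_iff' _ _ _ _ _).mp e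
  exact ⟨i, hi, j, hj, hij, a, ha.symm⟩

end Fz

namespace Fz
variable {k : ℕ}

lemma window_exists {k ℓ : ℕ} (hkl : k ≤ ℓ) (i : Fin ℓ) : ∃ g : Fin k → Fin ℓ, StrictMono g ∧
    Set.range g = {t : Fin ℓ | ∃ j : Fin k, (t : ℕ) = ((i : ℕ) + (j : ℕ)) % ℓ} := by
  have hl : 0 < ℓ := i.pos
  let h : Fin k → Fin ℓ := fun j => ⟨((i : ℕ) + (j : ℕ)) % ℓ, Nat.mod_lt _ hl⟩
  have hinj : Function.Injective h := by
    intro a b hab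
    have h1 : ((i : ℕ) + (a : ℕ)) % ℓ = ((i : ℕ) + (b : ℕ)) % ℓ := congrArg Fin.val hab
    have h2 : (a : ℕ) % ℓ = (b : ℕ) % ℓ := Nat.ModEq.add_left_cancel' _ h1
    rw [Nat.mod_eq_of_lt (by omega), Nat.mod_eq_of_lt (by omega)] at h2
    exact Fin.ext h2
  obtain ⟨σ, hσ⟩ := exists_sort h hinj
  refine ⟨h ∘ σ, hσ, ?_⟩
  ext t
  constructor
  · rintro ⟨s, rfl⟩
    exact ⟨σ s, rfl⟩
  · rintro ⟨j, hj⟩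
    exact ⟨σ.symm j, by simp only [Function.comp_apply, Equiv.apply_symm_apply]; exact Fin.ext hj.symm⟩

lemma forward (k n : ℕ) (hk : 1 ≤ k) (hkn : k ≤ n)
    (p : (Fin k → Fin n) → ℤ)
    (hpos : ∀ f : Fin k → Fin n, StrictMono f → 0 < p f)
    (ε : ℤ) (hεpos : 0 < ε)
    (hε : Ideal.span {x : ℤ | ∃ f : Fin k → Fin n, StrictMono f ∧ x = p f} =
      Ideal.span ({ε} : Set ℤ)) (x : Fin n → Fin k → ℤ) (hx : ∀ i, Prim (x i))
    (hp : ∀ f : Fin k → Fin n, StrictMono f → p f = colDet (fun s => x (f s))) :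
    ((∀ i : Fin n,
        Ideal.span {x : ℤ | ∃ f : Fin k → Fin n, StrictMono f ∧ (∃ r, f r = i) ∧ x = p f} =
          Ideal.span ({ε} : Set ℤ)) ∧
     (∀ q : ℕ, q.Prime → (q : ℤ) ∣ ε →
        ∀ S : Finset (Fin n), S.card = (q ^ k - 1) / (q - 1) →
          ∃ i ∈ S, ∃ j ∈ S, i ≠ j ∧
            ∀ f : Fin k → Fin n, StrictMono f → (∃ r, f r = i) → (∃ s, f s = j) →
              padicValInt q (p f) ≠ padicValInt q ε)) := by
  constructor
  · intro i
    apply le_antisymm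
    · rw [← hε]
      apply Ideal.span_mono
      rintro _ ⟨f, hf, _, rfl⟩
      exact ⟨f, hf, rfl⟩
    · rw [← hε, Ideal.span_le]
      rintro _ ⟨f, hf, rfl⟩
      have := mem_minors x i (hx i) f
      rw [← hp f hf] at this
      refine Ideal.span_mono ?_ this
      rintro _ ⟨f, hf, hr, rfl⟩
      exact ⟨f, hf, hr, (hp f hf).symm⟩
  · intro q hq hqe S hS
    have := Fact.mk hq
    let f0 : Fin k → Fin n := Fin.castLE hkn
    have hf0 : 0 < p f0 := hpos f0 (Fin.strictMono_castLE hkn)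
    obtain ⟨B, x', hB, hx', hs⟩ := span_lemma hk x f0 (by
      rw [← hp f0 (Fin.strictMono_castLE hkn)]; exact hf0.ne')
    have hm : ∀ f, StrictMono f → p f = B.det * colDet (fun s => x' (f s)) := by
      intro f hf
      rw [hp f hf, ← colDet_mulVec]
      congr 1
      funext s
      exact hx' (f s)
    have d1 : B.det ∣ ε := by
      have := dvd_of_span _ _ (hε ▸ Ideal.mem_span_singleton_self ε : ε ∈ Ideal.span {x : ℤ | ∃ f : Fin k → Fin n, StrictMono f ∧ x = p f}) B.det 1 (by
        rintro _ ⟨f, hf, rfl⟩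
        rw [one_mul]
        exact ⟨_, hm f hf⟩)
      simpa using this
    have hdiv : ∀ f, StrictMono f → ε ∣ p f := by
      intro f hf
      rw [← Ideal.mem_span_singleton, ← hε]
      exact Ideal.subset_span ⟨f, hf, rfl⟩
    have d2 : ε ∣ B.det := by
      have := dvd_of_span _ _ (minors_span x' hs) ε B.det (by
        rintro _ ⟨f, hf, rfl⟩
        rw [← hm f hf]
        exact hdiv f hf)
      simpa using this
    have e : B.det = ε := Int.dvd_antisymm hB.le hεpos.le d1 d2
    have hdet : (B.map (Int.cast : ℤ → ZMod q)).det = 0 := by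
      rw [← Int.cast_det, e]
      exact (ZMod.intCast_zmod_eq_zero_iff_dvd _ _).mpr hqe
    obtain ⟨w, hw, hBw⟩ := Matrix.exists_mulVec_eq_zero_iff.mpr hdet
    obtain ⟨i, hi, j, hj, hij, c, hc⟩ := pigeon q (fun i => red q (x' i)) w hw (by
      intro i c h
      have h1 : red q (x i) = 0 := by
        rw [hx' i, red_mulVec, h, Matrix.mulVec_smul, hBw, smul_zero]
      obtain ⟨c, hc⟩ := hx i
      have h2 : ((∑ t, c t * x i t : ℤ) : ZMod q) = 0 := by
        push_cast
        refine Finset.sum_eq_zero fun t _ => ?_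
        have := congrFun h1 t
        rw [red_apply] at this
        rw [this]; simp
      rw [hc] at h2
      simp at h2) S hS
    refine ⟨i, hi, j, hj, hij, ?_⟩
    rintro f hf ⟨a, ha⟩ ⟨b, hb⟩
    have hd := prop_dvd q x' f a b (by rintro rfl; exact hij (ha.symm.trans hb)) c (by rw [ha, hb]; exact hc)
    have hpf := hpos f hf
    rw [hm f hf, e] at hpf ⊢
    rw [val_iff q hq _ _ hεpos.ne' (by rintro h0; rw [h0] at hpf; simp at hpf)]
    exact hd

end Fz

namespace Fz
variable {k : ℕ}

lemma red_ne_of_prim (x : Fin k → ℤ) (hx : Prim x) (q : ℕ) (hq : q.Prime) : red q x ≠ 0 := by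
  have := Fact.mk hq
  intro h1
  obtain ⟨c, hc⟩ := hx
  have h2 : ((∑ t, c t * x t : ℤ) : ZMod q) = 0 := by
    push_cast
    refine Finset.sum_eq_zero fun t _ => ?_
    have := congrFun h1 t
    rw [red_apply] at this
    rw [this]; simp
  rw [hc] at h2
  simp at h2

lemma prim_of_red (x : Fin k → ℤ) (h : ∀ q : ℕ, q.Prime → red q x ≠ 0) : Prim x := by
  have hx : x ≠ 0 := by
    rintro rfl
    exact h 2 Nat.prime_two (by funext i; simp [red])
  obtain ⟨g, hg, v, hv, e⟩ := prim_part x hx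
  by_cases h1 : g = 1
  · rw [e, h1, one_smul]; exact hv
  · exfalso
    obtain ⟨l, hl, hd⟩ := Nat.exists_prime_and_dvd (n := g.natAbs) (by omega)
    refine h l hl ?_
    have : (l : ℤ) ∣ g := Int.natCast_dvd.mpr hd
    have : (g : ZMod l) = 0 := (ZMod.intCast_zmod_eq_zero_iff_dvd _ _).mpr this
    funext i
    rw [e, red_apply]
    simp [this]

/-- the direction `w` avoids every vector of the family -/
def Unc {n : ℕ} (q : ℕ) (x : Fin n → (Fin k → ℤ)) : Prop :=
  ∃ w : Fin k → ZMod q, w ≠ 0 ∧ ∀ i (c : ZMod q), red q (x i) ≠ c • w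

lemma step {n : ℕ} (q : ℕ) (hq : q.Prime) (x : Fin n → (Fin k → ℤ)) (hx : ∀ i, Prim (x i))
    (hu : Unc q x) : ∃ A : Matrix (Fin k) (Fin k) ℤ, A.det = q ∧ (∀ i, Prim (A.mulVec (x i))) ∧
      ∀ l : ℕ, l.Prime → Unc l x → Unc l (fun i => A.mulVec (x i)) := by
  have := Fact.mk hq
  obtain ⟨w, hw, hwx⟩ := hu
  obtain ⟨j, hj⟩ : ∃ j, w j ≠ 0 := by
    by_contra h
    push Not at h
    exact hw (funext h)
  let b : Fin k → ℤ := fun r => if r = j then (q : ℤ) else - ((((w j)⁻¹ * w r).val : ℕ) : ℤ)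
  let A : Matrix (Fin k) (Fin k) ℤ := Matrix.updateCol 1 j b
  have hdet : A.det = q := by
    have : A.det = Matrix.cramer (1 : Matrix (Fin k) (Fin k) ℤ) b j := (Matrix.cramer_apply _ _ _).symm
    rw [this, Matrix.cramer_one]
    simp [b]
  have hA : ∀ v : Fin k → ℤ, ∀ r, A.mulVec v r = v r + (b r - if r = j then 1 else 0) * v j := by
    intro v r
    have e : A = 1 + Matrix.vecMulVec (fun r => b r - if r = j then 1 else 0) (Pi.single j 1) := by
      ext r s
      by_cases hs : s = j
      · subst hs
        simp [A, Matrix.vecMulVec_apply, Matrix.one_apply]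
      · simp [A, Matrix.vecMulVec_apply, hs]
    rw [e, Matrix.add_mulVec, Matrix.one_mulVec]
    simp [Matrix.vecMulVec, Matrix.mulVec, dotProduct, Pi.single_apply]
  have hAq : ∀ v : Fin k → ℤ, ∀ r, red q (A.mulVec v) r = red q v r - red q v j * ((w j)⁻¹ * w r) := by
    intro v r
    rw [red_apply, hA]
    by_cases hr : r = j
    · subst hr
      simp [b, red_apply, hj]
    · simp [b, red_apply, hr]; ring
  have hinj : ∀ l : ℕ, l.Prime → l ≠ q → ∀ v : Fin k → ZMod l,
      (A.map (Int.cast : ℤ → ZMod l)).mulVec v = 0 → v = 0 := by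
    intro l hl hne v hv
    have := Fact.mk hl
    by_contra h0
    have hd := Matrix.exists_mulVec_eq_zero_iff.mp ⟨v, h0, hv⟩
    rw [← Int.cast_det, hdet, Int.cast_natCast, ZMod.natCast_eq_zero_iff] at hd
    exact hne ((Nat.prime_dvd_prime_iff_eq hl hq).mp hd)
  have hprim : ∀ i, Prim (A.mulVec (x i)) := by
    intro i
    apply prim_of_red
    intro l hl h0
    by_cases hlq : l = q
    · subst hlq
      apply hwx i (red l (x i) j * (w j)⁻¹)
      funext r
      have := hAq (x i) r
      rw [h0] at this
      simp only [Pi.zero_apply] at this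
      simp only [Pi.smul_apply, smul_eq_mul]
      linear_combination -this
    · rw [red_mulVec] at h0
      exact red_ne_of_prim _ (hx i) l hl (hinj l hl hlq _ h0)
  refine ⟨A, hdet, hprim, ?_⟩
  intro l hl hu
  have := Fact.mk hl
  by_cases hlq : l = q
  · subst hlq
    refine ⟨Pi.single j 1, by simp, ?_⟩
    intro i c h
    apply red_ne_of_prim _ (hprim i) l hl
    have h1 := congrFun h j
    rw [hAq] at h1
    simp [hj] at h1
    change red l (A.mulVec (x i)) = _ at h
    rw [h, ← h1, zero_smul]
  · obtain ⟨w', hw', hwx'⟩ := hu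
    refine ⟨(A.map (Int.cast : ℤ → ZMod l)).mulVec w', fun h => hw' (hinj l hl hlq _ h), ?_⟩
    intro i c h
    apply hwx' i c
    rw [red_mulVec, ← Matrix.mulVec_smul, ← sub_eq_zero, ← Matrix.mulVec_sub] at h
    exact sub_eq_zero.mp (hinj l hl hlq _ h)

lemma descend {n : ℕ} (N : ℕ) : N ≠ 0 → ∀ x : Fin n → (Fin k → ℤ), (∀ i, Prim (x i)) →
    (∀ q : ℕ, q.Prime → q ∣ N → Unc q x) →
    ∃ A : Matrix (Fin k) (Fin k) ℤ, A.det = N ∧ ∀ i, Prim (A.mulVec (x i)) := by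
  induction N using induction_on_primes with
  | zero => intro h; exact absurd rfl h
  | one => intro _ x hx _; exact ⟨1, by simp, by simpa using hx⟩
  | prime_mul q a hq ih =>
    intro h0 x hx hu
    obtain ⟨A, hA, hp, hl⟩ := step q hq x hx (hu q hq (dvd_mul_right _ _))
    obtain ⟨A', hA', hp'⟩ := ih (right_ne_zero_of_mul h0) _ hp (fun l hl1 hl2 => hl l hl1 (hu l hl1 (hl2.mul_left _)))
    refine ⟨A' * A, by rw [Matrix.det_mul, hA, hA']; push_cast; ring, fun i => ?_⟩
    rw [← Matrix.mulVec_mulVec]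
    exact hp' i

lemma span_red {n : ℕ} (q : ℕ) (x : Fin n → (Fin k → ℤ)) (hx : Submodule.span ℤ (Set.range x) = ⊤) :
    Submodule.span (ZMod q) (Set.range fun i => red q (x i)) = ⊤ := by
  rw [eq_top_iff]
  intro v _
  choose u hu using fun t => ZMod.intCast_surjective (v t)
  have h1 : u ∈ Submodule.span ℤ (Set.range x) := by rw [hx]; trivial
  obtain ⟨c, hc⟩ := (Submodule.mem_span_range_iff_exists_fun ℤ).mp h1
  refine (Submodule.mem_span_range_iff_exists_fun (ZMod q)).mpr ⟨fun i => (c i : ZMod q), ?_⟩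
  funext t
  rw [← hu t, ← hc]
  simp [red, Finset.sum_apply]

lemma extend {n : ℕ} (q : ℕ) (hq : q.Prime) (x : Fin n → (Fin k → ℤ))
    (hx : Submodule.span ℤ (Set.range x) = ⊤) (i j : Fin n) (hij : i ≠ j)
    (hi : red q (x i) ≠ 0) (h : ∀ c : ZMod q, c • red q (x i) ≠ red q (x j)) :
    ∃ f : Fin k → Fin n, StrictMono f ∧ (∃ r, f r = i) ∧ (∃ s, f s = j) ∧
      ¬ (q : ℤ) ∣ colDet (fun s => x (f s)) := by
  have := Fact.mk hq
  classical
  set z : Fin n → Fin k → ZMod q := fun i => red q (x i) with hz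
  have h1 : LinearIndepOn (ZMod q) z {i, j} := (linearIndepOn_pair_iff z hij hi).mpr h
  obtain ⟨b, -, hb1, hb2, hb3⟩ := exists_linearIndepOn_extension h1 (Set.subset_univ _)
  have hsp : Submodule.span (ZMod q) (z '' b) = ⊤ := by
    rw [eq_top_iff, ← span_red q x hx, Submodule.span_le, ← Set.image_univ]
    exact hb2
  have hcard : b.toFinset.card = k := by
    let B := Module.Basis.mk (v := fun a : b => z a) hb3 (by
      rw [← hsp]; apply Submodule.span_mono
      rintro _ ⟨a, ha, rfl⟩; exact ⟨⟨a, ha⟩, rfl⟩)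
    have := Module.finrank_eq_card_basis B
    rw [Module.finrank_fin_fun] at this
    rw [Set.toFinset_card, ← this]
  let f := b.toFinset.orderEmbOfFin hcard
  have hf : ∀ t ∈ b, ∃ r, f r = t := by
    intro t ht
    have : t ∈ Set.range f := by
      rw [Finset.range_orderEmbOfFin]; simpa using ht
    exact this
  have hfb : ∀ r, f r ∈ b := fun r => by
    exact Set.mem_toFinset.mp (Finset.orderEmbOfFin_mem b.toFinset hcard r)
  refine ⟨f, f.strictMono, hf i (hb1 (by simp)), hf j (hb1 (by simp)), ?_⟩
  rw [← ZMod.intCast_zmod_eq_zero_iff_dvd, red_colDet]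
  have hli : LinearIndependent (ZMod q) (fun s => z (f s)) := by
    have := hb3.comp (fun s : Fin k => (⟨f s, hfb s⟩ : b)) (by
      intro s t hst
      have hst' : f s = f t := by simpa using hst
      exact f.injective hst')
    exact this
  have hu := (Matrix.linearIndependent_rows_iff_isUnit (A := (fun s => z (f s) : Matrix (Fin k) (Fin k) (ZMod q)))).mp hli
  exact ((Matrix.isUnit_iff_isUnit_det _).mp hu).ne_zero

lemma unc_of {n : ℕ} (q : ℕ) (hq : q.Prime) (x : Fin n → (Fin k → ℤ))
    (hx : Submodule.span ℤ (Set.range x) = ⊤) (hp : ∀ i, Prim (x i))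
    (h : ∀ S : Finset (Fin n), S.card = (q ^ k - 1) / (q - 1) →
          ∃ i ∈ S, ∃ j ∈ S, i ≠ j ∧
            ∀ f : Fin k → Fin n, StrictMono f → (∃ r, f r = i) → (∃ s, f s = j) →
              (q : ℤ) ∣ colDet (fun s => x (f s))) : Unc q x := by
  classical
  have := Fact.mk hq
  by_contra hu
  unfold Unc at hu
  push Not at hu
  have hr : ∀ i, red q (x i) ≠ 0 := fun i => red_ne_of_prim _ (hp i) q hq
  have hP : ∀ P : Projectivization (ZMod q) (Fin k → ZMod q), ∃ i, Projectivization.mk (ZMod q) (red q (x i)) (hr i) = P := by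
    intro P
    obtain ⟨i, c, hc⟩ := hu P.rep P.rep_nonzero
    refine ⟨i, ?_⟩
    rw [← P.mk_rep, Projectivization.mk_eq_mk_iff']
    exact ⟨c, hc.symm⟩
  choose I hI using hP
  have hinj : Function.Injective I := by
    intro P Q h
    rw [← hI P, ← hI Q]
    simp only [h]
  let _ := Fintype.ofFinite (Projectivization (ZMod q) (Fin k → ZMod q))
  obtain ⟨i, hi, j, hj, hij, hd⟩ := h (Finset.univ.image I) (by
    rw [Finset.card_image_of_injective _ hinj, ← card_proj q, Nat.card_eq_fintype_card]; rfl)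
  obtain ⟨P, -, rfl⟩ := Finset.mem_image.mp hi
  obtain ⟨Q, -, rfl⟩ := Finset.mem_image.mp hj
  obtain ⟨f, hf, h1, h2, h3⟩ := extend q hq x hx _ _ hij (hr _) (by
    intro c hc
    apply hij
    congr 1
    rw [← hI P, ← hI Q]
    exact ((Projectivization.mk_eq_mk_iff' _ _ _ _ _).mpr ⟨c, hc⟩).symm)
  exact h3 (hd f hf h1 h2)

lemma backward (k n : ℕ) (hk : 1 ≤ k) (hkn : k ≤ n)
    (p : (Fin k → Fin n) → ℤ) (hspec : IsSpecialization k n p)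
    (hpos : ∀ f : Fin k → Fin n, StrictMono f → 0 < p f)
    (ε : ℤ) (hεpos : 0 < ε)
    (hε : Ideal.span {x : ℤ | ∃ f : Fin k → Fin n, StrictMono f ∧ x = p f} =
      Ideal.span ({ε} : Set ℤ))
    (c1 : ∀ i : Fin n,
        Ideal.span {x : ℤ | ∃ f : Fin k → Fin n, StrictMono f ∧ (∃ r, f r = i) ∧ x = p f} =
          Ideal.span ({ε} : Set ℤ))
    (c2 : ∀ q : ℕ, q.Prime → (q : ℤ) ∣ ε →
        ∀ S : Finset (Fin n), S.card = (q ^ k - 1) / (q - 1) →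
          ∃ i ∈ S, ∃ j ∈ S, i ≠ j ∧
            ∀ f : Fin k → Fin n, StrictMono f → (∃ r, f r = i) → (∃ s, f s = j) →
              padicValInt q (p f) ≠ padicValInt q ε) :
    ∃ x : Fin n → Fin k → ℤ, (∀ i, Prim (x i)) ∧ ∀ f, p f = colDet (fun s => x (f s)) := by
  obtain ⟨x, hs, hx⟩ := rep_span k n hk hkn p hspec hpos ε hεpos hε
  have hp : ∀ i, Prim (x i) := by
    intro i
    apply prim_of_span (x i) {d : ℤ | ∃ f : Fin k → Fin n, StrictMono f ∧ (∃ r, f r = i) ∧ d = colDet (fun s => x (f s))}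
    · have h1 : ε ∈ Ideal.span {x : ℤ | ∃ f : Fin k → Fin n, StrictMono f ∧ (∃ r, f r = i) ∧ x = p f} := by
        rw [c1 i]; exact Ideal.mem_span_singleton_self ε
      obtain ⟨g, hg⟩ := (IsPrincipalIdealRing.principal (Ideal.span {d : ℤ | ∃ f : Fin k → Fin n, StrictMono f ∧ (∃ r, f r = i) ∧ d = colDet (fun s => x (f s))})).principal
      change _ = Ideal.span {g} at hg
      rw [hg, Ideal.mem_span_singleton]
      have h2 := dvd_of_span _ _ h1 (ε * g) 1 (by
        rintro _ ⟨f, hf, hr, rfl⟩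
        rw [one_mul, hx]
        apply mul_dvd_mul_left
        rw [← Ideal.mem_span_singleton, ← hg]
        exact Ideal.subset_span ⟨f, hf, hr, rfl⟩)
      rw [one_mul] at h2
      exact (mul_dvd_mul_iff_left hεpos.ne').mp (by simpa using h2)
    · rintro _ ⟨f, _, ⟨r, rfl⟩, rfl⟩
      exact lin_slot' (fun s => x (f s)) r
  obtain ⟨A, hA, hAp⟩ := descend ε.natAbs (by omega) x hp (by
    intro q hq hqe
    have hqe' : (q : ℤ) ∣ ε := Int.natCast_dvd.mpr hqe
    apply unc_of q hq x hs hp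
    intro S hS
    obtain ⟨i, hi, j, hj, hij, hf⟩ := c2 q hq hqe' S hS
    refine ⟨i, hi, j, hj, hij, fun f hm h1 h2 => ?_⟩
    have := hf f hm h1 h2
    have hpf := hpos f hm
    rw [hx] at this hpf
    exact (val_iff q hq _ _ hεpos.ne' (by rintro h0; rw [h0] at hpf; simp at hpf)).mp this)
  refine ⟨_, hAp, fun f => ?_⟩
  rw [colDet_mulVec A (fun s => x (f s)), hA, hx]
  congr 1
  omega

end Fz


/-- characterization of subpolygons of `SL_k`-frieze patterns. Let `p` be a
positive integral specialization of `A_{k,n}` and `ε` the gcd of its values. Then `p`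
appears as a subpolygon of an `SL_k`-frieze pattern (condition (I)) if and only if both
the gcd condition (1) and the valuation condition (2) on subsets of cardinality
`(q^k − 1)/(q − 1)` hold. -/
theorem stmt7 (k n : ℕ) (hk : 1 ≤ k) (hkn : k ≤ n)
    (p : (Fin k → Fin n) → ℤ) (hspec : IsSpecialization k n p)
    (hpos : ∀ f : Fin k → Fin n, StrictMono f → 0 < p f)
    (ε : ℤ) (hεpos : 0 < ε)
    (hε : Ideal.span {x : ℤ | ∃ f : Fin k → Fin n, StrictMono f ∧ x = p f} =
      Ideal.span ({ε} : Set ℤ)) :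
    (∃ ℓ : ℕ, n ≤ ℓ ∧
      ∃ (y : Fin ℓ → (Fin k → ℤ)) (idx : Fin n → Fin ℓ),
        StrictMono idx ∧
        (∀ g : Fin k → Fin ℓ, StrictMono g → 0 < colDet (fun s => y (g s))) ∧
        (∀ i : Fin ℓ, ∀ g : Fin k → Fin ℓ, StrictMono g →
          (Set.range g = {t : Fin ℓ | ∃ j : Fin k, (t : ℕ) = ((i : ℕ) + (j : ℕ)) % ℓ}) →
          colDet (fun s => y (g s)) = 1) ∧
        (∀ f : Fin k → Fin n, StrictMono f → p f = colDet (fun s => y (idx (f s)))))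
    ↔
    ((∀ i : Fin n,
        Ideal.span {x : ℤ | ∃ f : Fin k → Fin n, StrictMono f ∧ (∃ r, f r = i) ∧ x = p f} =
          Ideal.span ({ε} : Set ℤ)) ∧
     (∀ q : ℕ, q.Prime → (q : ℤ) ∣ ε →
        ∀ S : Finset (Fin n), S.card = (q ^ k - 1) / (q - 1) →
          ∃ i ∈ S, ∃ j ∈ S, i ≠ j ∧
            ∀ f : Fin k → Fin n, StrictMono f → (∃ r, f r = i) → (∃ s, f s = j) →
              padicValInt q (p f) ≠ padicValInt q ε)) := by
  constructor
  · rintro ⟨ℓ, hnl, y, idx, hidx, hy, hwin, hp⟩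
    refine Fz.forward k n hk hkn p hpos ε hεpos hε (fun i => y (idx i)) ?_ hp
    intro i
    obtain ⟨g, hg, hr⟩ := Fz.window_exists (hkn.trans hnl) (idx i)
    have h1 := hwin (idx i) g hg hr
    have h2 : idx i ∈ Set.range g := by
      rw [hr]
      exact ⟨⟨0, hk⟩, by simp [Nat.mod_eq_of_lt (idx i).2]⟩
    obtain ⟨s, hs⟩ := h2
    obtain ⟨c, hc⟩ := Fz.lin_slot' (fun s => y (g s)) s
    rw [h1] at hc
    refine ⟨c, ?_⟩
    change ∑ t, c t * y (idx i) t = 1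
    rw [← hs]
    exact hc.symm
  · rintro ⟨c1, c2⟩
    obtain ⟨x, hx, hp⟩ := Fz.backward k n hk hkn p hspec hpos ε hεpos hε c1 c2
    obtain ⟨ℓ, hl, y, idx, h1, h2, h3, h4⟩ := Fz.frieze_fin hk hkn x (fun f hf => by
      rw [← hp f]; exact hpos f hf) hx
    refine ⟨ℓ, hl, y, idx, h1, h2, h3, fun f _ => ?_⟩
    rw [hp f]
    simp only [h4]
end

section
/- A triple (a,b,c) of positive integers appears as the labels of a triangle in some Conway–Coxeter frieze — i.e. there exist m ≥ 3, vectors x_1,…,x_m ∈ ℤ² with det(x_i, x_j) > 0 for all 1 ≤ i < j ≤ m, det(x_i, x_{i+1}) = 1 for 1 ≤ i < m, det(x_1, x_m) = 1, and indices 1 ≤ i < j < l ≤ m with a = det(x_i, x_j), b = det(x_j, x_l), c = det(x_i, x_l) — if and only if the following two conditions are satisfied: (1) gcd(a,b) = gcd(b,c) = gcd(a,c); (2) either ν₂(a) = ν₂(b) = ν₂(c) = 0, or the set {ν₂(a), ν₂(b), ν₂(c)} contains more than one element, where ν₂ denotes the 2-adic valuation. -/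
/-- The determinant of the `2 × 2` matrix with columns `u` and `v`. -/
def det2 (u v : Fin 2 → ℤ) : ℤ := u 0 * v 1 - u 1 * v 0

def HP (u : Fin 2 → ℤ) : Prop := 0 < u 1 ∨ (u 1 = 0 ∧ 0 < u 0)

def St (u v : Fin 2 → ℤ) : Prop := HP u ∧ HP v ∧ det2 u v = 1

theorem det2_trans (u v w : Fin 2 → ℤ) (hu : HP u) (hv : HP v) (hw : HP w)
    (h1 : 0 < det2 u v) (h2 : 0 < det2 v w) : 0 < det2 u w := by
  have key : ∀ p q : Fin 2 → ℤ, HP p → HP q → 0 < det2 p q → 0 < q 1 := by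
    intro p q hp hq h
    rcases hq with hq | ⟨hq, hq'⟩
    · exact hq
    · unfold det2 at h
      rw [hq] at h
      have : 0 ≤ p 1 := by rcases hp with hp | hp <;> omega
      nlinarith
  have hv1 := key u v hu hv h1
  have hw1 := key v w hv hw h2
  have hu1 : 0 ≤ u 1 := by rcases hu with hp | hp <;> omega
  have e : v 1 * det2 u w = w 1 * det2 u v + u 1 * det2 v w := by unfold det2; ring
  have : 0 < v 1 * det2 u w := by
    rw [e]
    have := mul_pos hw1 h1
    have := mul_nonneg hu1 h2.le
    linarith
  exact (mul_pos_iff_of_pos_left hv1).1 this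

theorem path_aux (n : ℕ) : ∀ p q : Fin 2 → ℤ, HP p → HP q → IsCoprime (p 0) (p 1) →
    IsCoprime (q 0) (q 1) → 0 < det2 p q → (det2 p q).toNat ≤ n → Relation.TransGen St p q := by
  induction n with
  | zero => intro p q _ _ _ _ h h'; omega
  | succ n ih =>
    intro p q hp hq cp cq h h'
    by_cases h1 : det2 p q = 1
    · exact Relation.TransGen.single ⟨hp, hq, h1⟩
    obtain ⟨α, β, hαβ⟩ := cp
    obtain ⟨γ, δ, hγδ⟩ := cq
    set N := det2 p q with hN
    set s0 : Fin 2 → ℤ := ![-β, α] with hs0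
    set k := (det2 s0 q) / N with hk
    set s : Fin 2 → ℤ := ![-β - k * p 0, α - k * p 1] with hs
    have hps : det2 p s = 1 := by
      simp only [det2, hs, Matrix.cons_val_zero, Matrix.cons_val_one]
      linear_combination hαβ
    have hsq : det2 s q = det2 s0 q % N := by
      have := Int.emod_add_mul_ediv (det2 s0 q) N
      rw [← hk] at this
      have e : det2 s q = det2 s0 q - k * N := by
        simp only [det2, hs, hs0, hN, Matrix.cons_val_zero, Matrix.cons_val_one]
        ring
      linarith
    have hlt : det2 s q < N := by rw [hsq]; exact Int.emod_lt_of_pos _ h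
    have hge : 0 ≤ det2 s q := by rw [hsq]; exact Int.emod_nonneg _ h.ne'
    have hne : det2 s q ≠ 0 := by
      intro h0
      have e0 : N * s 0 = q 0 := by
        have : N * s 0 = det2 s q * p 0 + det2 p s * q 0 := by rw [hN]; unfold det2; ring
        rw [this, h0, hps]; ring
      have e1 : N * s 1 = q 1 := by
        have : N * s 1 = det2 s q * p 1 + det2 p s * q 1 := by rw [hN]; unfold det2; ring
        rw [this, h0, hps]; ring
      have : N ∣ 1 := ⟨γ * s 0 + δ * s 1, by rw [← hγδ, ← e0, ← e1]; ring⟩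
      have := Int.le_of_dvd one_pos this
      omega
    have hpos : 0 < det2 s q := lt_of_le_of_ne hge (Ne.symm hne)
    have hsH : HP s := by
      left
      have hq1 : 0 < q 1 := by
        rcases hq with hq | ⟨hq, hq'⟩
        · exact hq
        · exfalso
          rw [hN] at h
          unfold det2 at h
          rw [hq] at h
          have : 0 ≤ p 1 := by rcases hp with hp | hp <;> omega
          nlinarith
      have hp1 : 0 ≤ p 1 := by rcases hp with hp | hp <;> omega
      have e1 : N * s 1 = det2 s q * p 1 + det2 p s * q 1 := by rw [hN]; unfold det2; ring
      have : 0 < N * s 1 := by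
        rw [e1, hps]
        have := mul_nonneg hge hp1
        linarith
      exact (mul_pos_iff_of_pos_left h).1 this
    refine Relation.TransGen.head ⟨hp, hsH, hps⟩ (ih s q hsH hq ?_ ⟨γ, δ, hγδ⟩ hpos (by omega))
    refine ⟨-p 1, p 0, ?_⟩
    rw [← hps]; unfold det2; ring

theorem path (p q : Fin 2 → ℤ) (hp : HP p) (hq : HP q) (cp : IsCoprime (p 0) (p 1))
    (cq : IsCoprime (q 0) (q 1)) (h : 0 < det2 p q) : Relation.TransGen St p q :=
  path_aux _ p q hp hq cp cq h le_rfl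

theorem seq_of_transGen {α : Type*} {R : α → α → Prop} {p q : α} (h : Relation.TransGen R p q) :
    ∃ (n : ℕ) (f : ℕ → α), 0 < n ∧ f 0 = p ∧ f n = q ∧ ∀ i < n, R (f i) (f (i + 1)) := by
  induction h with
  | @single b hb =>
    refine ⟨1, fun i => if i = 0 then p else b, one_pos, by simp, by simp, ?_⟩
    intro i hi
    obtain rfl : i = 0 := by omega
    simpa using hb
  | @tail b c _ hbc ih =>
    obtain ⟨n, f, hn, h0, h1, h2⟩ := ih
    refine ⟨n + 1, fun i => if i ≤ n then f i else c, by omega, by simp [h0], by simp, ?_⟩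
    intro i hi
    rcases Nat.lt_or_ge i n with h | h
    · have h3 : i ≤ n := by omega
      have h4 : i + 1 ≤ n := by omega
      simpa [h3, h4] using h2 i h
    · obtain rfl : i = n := by omega
      simpa [h1] using hbc

theorem seq_concat {α : Type*} {R : α → α → Prop} (n k : ℕ) (f g : ℕ → α) (hfg : f n = g 0)
    (hf : ∀ i < n, R (f i) (f (i + 1))) (hg : ∀ i < k, R (g i) (g (i + 1))) :
    ∃ e : ℕ → α, (∀ i ≤ n, e i = f i) ∧ (∀ i, e (n + i) = g i) ∧
      ∀ i < n + k, R (e i) (e (i + 1)) := by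
  have A : ∀ i ≤ n, (fun i => if i ≤ n then f i else g (i - n)) i = f i := by
    intro i hi; simp [hi]
  have B : ∀ i, (fun i => if i ≤ n then f i else g (i - n)) (n + i) = g i := by
    intro i
    rcases Nat.eq_zero_or_pos i with rfl | hi
    · simp [hfg]
    · have : ¬ (n + i ≤ n) := by omega
      simp; intro h; omega
  refine ⟨_, A, B, ?_⟩
  intro i hi
  rcases Nat.lt_or_ge i n with h | h
  · have h1 := A i h.le
    have h2 := A (i + 1) h
    dsimp only at h1 h2 ⊢
    rw [h1, h2]; exact hf i h
  · obtain ⟨j, rfl⟩ := Nat.exists_eq_add_of_le h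
    have h1 := B j
    have h2 := B (j + 1)
    dsimp only at h1 h2 ⊢
    rw [add_assoc n j 1, h1, h2]; exact hg j (by omega)

theorem avoid (P : ℤ → ℤ) (hP : ∀ (s t q : ℤ), q ∣ s - t → q ∣ P s → q ∣ P t) (S : Finset ℕ)
    (hS : ∀ q ∈ S, q.Prime) (h : ∀ q ∈ S, ∃ t : ℤ, ¬ (q : ℤ) ∣ P t) :
    ∃ t : ℤ, ∀ q ∈ S, ¬ (q : ℤ) ∣ P t := by
  induction S using Finset.induction_on with
  | empty => exact ⟨0, by simp⟩
  | insert q S hq ih =>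
    obtain ⟨t1, ht1⟩ := ih (fun r hr => hS r (Finset.mem_insert_of_mem hr))
      (fun r hr => h r (Finset.mem_insert_of_mem hr))
    obtain ⟨t2, ht2⟩ := h q (Finset.mem_insert_self _ _)
    have hc : Nat.Coprime (∏ r ∈ S, r) q := by
      apply Nat.Coprime.prod_left
      intro r hr
      refine (Nat.coprime_primes (hS r (Finset.mem_insert_of_mem hr))
        (hS q (Finset.mem_insert_self _ _))).2 ?_
      rintro rfl; exact hq hr
    obtain ⟨x, y, hxy⟩ := Nat.isCoprime_iff_coprime.2 hc
    refine ⟨t1 + (t2 - t1) * (x * (∏ r ∈ S, r : ℕ)), ?_⟩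
    intro r hr hd
    rcases Finset.mem_insert.1 hr with rfl | hr'
    · refine ht2 (hP _ _ _ ⟨-(t2 - t1) * y, ?_⟩ hd)
      linear_combination (t2 - t1) * hxy
    · refine ht1 r hr' (hP _ _ _ ?_ hd)
      have : (r : ℤ) ∣ (∏ r ∈ S, r : ℕ) := Int.natCast_dvd_natCast.2 (Finset.dvd_prod_of_mem _ hr')
      have e : t1 + (t2 - t1) * (x * (∏ r ∈ S, r : ℕ)) - t1 = (t2 - t1) * x * (∏ r ∈ S, r : ℕ) := by
        ring
      rw [e]
      exact this.mul_left _

theorem coprime_of_primes (p d : ℤ) (h : ∀ q : ℕ, q.Prime → (q : ℤ) ∣ d → ¬ (q : ℤ) ∣ p) :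
    IsCoprime p d := by
  rw [Int.isCoprime_iff_gcd_eq_one]
  by_contra hne
  obtain ⟨q, hq, hqd⟩ := Nat.exists_prime_and_dvd hne
  have := Int.natCast_dvd_natCast.2 hqd
  exact h q hq (this.trans (Int.gcd_dvd_right ..)) (this.trans (Int.gcd_dvd_left ..))

theorem local_t (q : ℕ) (hq : q.Prime) (a b c p r : ℤ) (hab : IsCoprime a b)
    (hbc : IsCoprime b c) (hac : IsCoprime a c) (e : p * c - r * a = b)
    (h2 : q = 2 → (2 ∣ a ∨ 2 ∣ b ∨ 2 ∣ c)) :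
    ∃ t : ℤ, ¬ (q : ℤ) ∣ (p + t * a) * (r + t * c) := by
  have hqp : Prime (q : ℤ) := Nat.prime_iff_prime_int.1 hq
  have hu : ¬ (q : ℤ) ∣ 1 := fun h => hqp.not_isUnit (isUnit_of_dvd_one h)
  have cop : ∀ x y : ℤ, IsCoprime x y → (q : ℤ) ∣ x → (q : ℤ) ∣ y → False := by
    rintro x y ⟨s, t, h⟩ hx hy
    exact hu (h ▸ dvd_add (hx.mul_left _) (hy.mul_left _))
  by_contra hcon
  push Not at hcon
  have H : ∀ t : ℤ, (q : ℤ) ∣ p + t * a ∨ (q : ℤ) ∣ r + t * c := fun t => hqp.dvd_or_dvd (hcon t)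
  -- both at once forces q | b; two different values t,t+1 force q | a
  have E : ∀ t : ℤ, (p + t * a) * c - (r + t * c) * a = b := by intro t; linear_combination e
  have A : ∀ s t : ℤ, (q : ℤ) ∣ p + s * a → (q : ℤ) ∣ p + t * a → ¬ (q : ℤ) ∣ s - t → False := by
    intro s t h1 h2 h3
    have h4 : (q : ℤ) ∣ (s - t) * a := by
      have := dvd_sub h1 h2
      have e : (s - t) * a = p + s * a - (p + t * a) := by ring
      rwa [e]
    have ha := (hqp.dvd_or_dvd h4).resolve_left h3
    have hp : (q : ℤ) ∣ p := by
      have := dvd_sub h1 (ha.mul_left s)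
      simpa using this
    exact cop a b hab ha (e ▸ dvd_sub (hp.mul_right c) (ha.mul_left r))
  have C : ∀ s t : ℤ, (q : ℤ) ∣ r + s * c → (q : ℤ) ∣ r + t * c → ¬ (q : ℤ) ∣ s - t → False := by
    intro s t h1 h2 h3
    have h4 : (q : ℤ) ∣ (s - t) * c := by
      have := dvd_sub h1 h2
      have e : (s - t) * c = r + s * c - (r + t * c) := by ring
      rwa [e]
    have ha := (hqp.dvd_or_dvd h4).resolve_left h3
    have hp : (q : ℤ) ∣ r := by
      have := dvd_sub h1 (ha.mul_left s)
      simpa using this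
    exact cop b c hbc (e ▸ dvd_sub (ha.mul_left p) (hp.mul_right a)) ha
  by_cases hq2 : q = 2
  · have h2' := h2 hq2
    subst hq2
    push_cast at *
    have d10 : ¬ (2 : ℤ) ∣ 1 - 0 := by norm_num
    have d01 : ¬ (2 : ℤ) ∣ 0 - 1 := by norm_num
    have cab := cop a b hab
    have cbc := cop b c hbc
    have cac := cop a c hac
    have E0 : (2:ℤ) ∣ p + 0 * a → (2:ℤ) ∣ r + 1 * c → 2 ∣ b → False := by
      intro h1 h2 h3
      have hpc : (2:ℤ) ∣ p := by simpa using h1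
      have : (2:ℤ) ∣ r * a := by
        have : r * a = p * c - b := by linear_combination -e
        rw [this]; exact dvd_sub (hpc.mul_right c) h3
      have hr := (hqp.dvd_or_dvd this).resolve_right (fun h => cab h h3)
      have : (2:ℤ) ∣ c := by simpa using dvd_sub h2 hr
      exact cbc h3 this
    have E1 : (2:ℤ) ∣ p + 1 * a → (2:ℤ) ∣ r + 0 * c → 2 ∣ b → False := by
      intro h1 h2 h3
      have hrr : (2:ℤ) ∣ r := by simpa using h2
      have : (2:ℤ) ∣ p * c := by
        have : p * c = r * a + b := by linear_combination e
        rw [this]; exact dvd_add (hrr.mul_right a) h3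
      have hr := (hqp.dvd_or_dvd this).resolve_right (fun h => cbc h3 h)
      have : (2:ℤ) ∣ a := by
        have := dvd_sub h1 hr
        simpa using this
      exact cab this h3
    have F : ∀ t : ℤ, (2:ℤ) ∣ a → (2:ℤ) ∣ p + t * a → False := by
      intro t h1 h2
      have hp : (2:ℤ) ∣ p := by simpa using dvd_sub h2 (h1.mul_left t)
      exact cab h1 (e ▸ dvd_sub (hp.mul_right c) (h1.mul_left r))
    have G : ∀ t : ℤ, (2:ℤ) ∣ c → (2:ℤ) ∣ r + t * c → False := by
      intro t h1 h2
      have hp : (2:ℤ) ∣ r := by simpa using dvd_sub h2 (h1.mul_left t)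
      exact cbc (e ▸ dvd_sub (h1.mul_left p) (hp.mul_right a)) h1
    rcases H 0 with k0 | k0 <;> rcases H 1 with k1 | k1
    · exact A 0 1 k0 k1 d01
    · rcases h2' with k | k | k
      · exact F 0 k k0
      · exact E0 k0 k1 k
      · exact G 1 k k1
    · rcases h2' with k | k | k
      · exact F 1 k k1
      · exact E1 k1 k0 k
      · exact G 0 k k0
    · exact C 0 1 k0 k1 d01
  · have hn2 : ¬ (q : ℤ) ∣ 2 := by
      intro h
      have := Int.natCast_dvd_natCast.1 (by exact_mod_cast h : (q : ℤ) ∣ ((2 : ℕ) : ℤ))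
      exact hq2 ((Nat.prime_dvd_prime_iff_eq hq Nat.prime_two).1 this)
    have d1 : ¬ (q : ℤ) ∣ 1 - 0 := by simpa using hu
    have d2 : ¬ (q : ℤ) ∣ 2 - 0 := by simpa using hn2
    have d3 : ¬ (q : ℤ) ∣ 2 - 1 := by norm_num; simpa using hu
    rcases H 0 with k0 | k0 <;> rcases H 1 with k1 | k1 <;> rcases H 2 with k2 | k2 <;>
    first
    | exact A 1 0 k1 k0 d1
    | exact A 2 0 k2 k0 d2
    | exact A 2 1 k2 k1 d3
    | exact C 1 0 k1 k0 d1
    | exact C 2 0 k2 k0 d2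
    | exact C 2 1 k2 k1 d3

theorem exists_pr (d a b c : ℤ) (hd : d ≠ 0) (hab : IsCoprime a b) (hbc : IsCoprime b c)
    (hac : IsCoprime a c) (h2 : 2 ∣ d → (2 ∣ a ∨ 2 ∣ b ∨ 2 ∣ c)) :
    ∃ p r : ℤ, p * c - r * a = b ∧ IsCoprime p (d * a) ∧ IsCoprime r (d * c) := by
  obtain ⟨x, y, hxy⟩ := id hac
  have e0 : (b * y) * c - (-b * x) * a = b := by linear_combination b * hxy
  obtain ⟨t, ht⟩ := avoid (fun t => (b * y + t * a) * (-b * x + t * c)) (by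
      rintro s t q ⟨k, hk⟩ h
      have e : (b * y + t * a) * (-b * x + t * c) = (b * y + s * a) * (-b * x + s * c)
        - q * (k * (a * (-b * x + t * c) + c * (b * y + s * a))) := by
        obtain rfl : s = t + q * k := by linarith
        ring
      rw [e]
      exact dvd_sub h (dvd_mul_right _ _)) d.natAbs.primeFactors
      (fun q hq => Nat.prime_of_mem_primeFactors hq)
      (fun q hq => local_t q (Nat.prime_of_mem_primeFactors hq) a b c _ _ hab hbc hac e0 (by
        rintro rfl
        exact h2 (by exact_mod_cast Int.natCast_dvd.2 (Nat.dvd_of_mem_primeFactors hq))))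
  have ht' : ∀ q : ℕ, q.Prime → (q : ℤ) ∣ d →
      ¬ (q : ℤ) ∣ (b * y + t * a) * (-b * x + t * c) := by
    intro q hq hqd
    exact ht q (Nat.mem_primeFactors.2 ⟨hq, Int.natCast_dvd.1 hqd, by simpa using hd⟩)
  have e1 : (b * y + t * a) * c - (-b * x + t * c) * a = b := by linear_combination e0
  refine ⟨_, _, e1, IsCoprime.mul_right ?_ ?_, IsCoprime.mul_right ?_ ?_⟩
  · exact coprime_of_primes _ _ fun q hq hqd h => ht' q hq hqd (h.mul_right _)
  · obtain ⟨m, n, hmn⟩ := hab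
    exact ⟨n * c, m - n * (-b * x + t * c), by linear_combination hmn + n * e1⟩
  · exact coprime_of_primes _ _ fun q hq hqd h => ht' q hq hqd (h.mul_left _)
  · obtain ⟨m, n, hmn⟩ := hbc
    exact ⟨-m * a, n + m * (b * y + t * a), by linear_combination hmn + m * e1⟩

theorem gcd_dvd_aux (u v w : Fin 2 → ℤ) (hv : IsCoprime (v 0) (v 1)) (a b c : ℤ)
    (h : ∀ i, a * w i + b * u i = c * v i) : ((Int.gcd a b : ℕ) : ℤ) ∣ c := by
  obtain ⟨s, t, hst⟩ := hv
  have : c = a * (s * w 0 + t * w 1) + b * (s * u 0 + t * u 1) := by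
    linear_combination (-c) * hst - s * h 0 - t * h 1
  rw [this]
  exact dvd_add ((Int.gcd_dvd_left ..).mul_right _) ((Int.gcd_dvd_right ..).mul_right _)

theorem zmod2 : ∀ u0 u1 v0 v1 : ZMod 2, ¬ (u0 = 0 ∧ u1 = 0) → ¬ (v0 = 0 ∧ v1 = 0) →
    u0 * v1 - u1 * v0 = 0 → u0 = v0 ∧ u1 = v1 := by
  decide

theorem prim_zmod (u : Fin 2 → ℤ) (hu : IsCoprime (u 0) (u 1)) :
    ¬ (((u 0 : ℤ) : ZMod 2) = 0 ∧ ((u 1 : ℤ) : ZMod 2) = 0) := by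
  obtain ⟨s, t, h⟩ := hu
  rintro ⟨h0, h1⟩
  have := congrArg (Int.cast : ℤ → ZMod 2) h
  push_cast at this
  rw [h0, h1] at this
  simp at this

theorem odd_part (a : ℤ) (ha : 0 < a) : ∃ a', a = 2 ^ padicValInt 2 a * a' ∧ (a' : ZMod 2) = 1 := by
  obtain ⟨a', h⟩ := padicValInt_dvd (p := 2) a
  refine ⟨a', by exact_mod_cast h, ?_⟩
  have hn : ¬ (2 : ℤ) ∣ a' := by
    rintro ⟨k, rfl⟩
    have h3 : ((2 : ℕ) : ℤ) ^ (padicValInt 2 a + 1) ∣ a :=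
      ⟨k, by rw [pow_succ, mul_assoc]; exact_mod_cast h⟩
    have := (padicValInt_dvd_iff (p := 2) _ a).1 h3
    omega
  have h4 : (a' : ZMod 2) ≠ 0 := by
    intro h; exact hn (by exact_mod_cast (ZMod.intCast_zmod_eq_zero_iff_dvd a' 2).1 h)
  generalize (a' : ZMod 2) = z at h4
  revert z; decide

theorem necessity (u v w : Fin 2 → ℤ) (hu : IsCoprime (u 0) (u 1)) (hv : IsCoprime (v 0) (v 1))
    (hw : IsCoprime (w 0) (w 1)) (a b c : ℤ) (ha : 0 < a) (hb : 0 < b) (hc : 0 < c)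
    (ea : a = det2 u v) (eb : b = det2 v w) (ec : c = det2 u w) :
    ((Int.gcd a b = Int.gcd b c ∧ Int.gcd b c = Int.gcd a c) ∧
     ((padicValInt 2 a = 0 ∧ padicValInt 2 b = 0 ∧ padicValInt 2 c = 0) ∨
      1 < ({padicValInt 2 a, padicValInt 2 b, padicValInt 2 c} : Finset ℕ).card)) := by
  have e : ∀ i, a * w i + b * u i = c * v i := by
    intro i; rw [ea, eb, ec]; unfold det2; fin_cases i <;> simp <;> ring
  have d1 := gcd_dvd_aux u v w hv a b c e
  have d2 : ((Int.gcd b c : ℕ) : ℤ) ∣ a := by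
    have := gcd_dvd_aux u w v hw c (-b) a (fun i => by linear_combination -(e i))
    rw [Int.gcd_comm] at this; simpa using this
  have d3 : ((Int.gcd a c : ℕ) : ℤ) ∣ b := by
    have := gcd_dvd_aux w u v hu c (-a) b (fun i => by linear_combination -(e i))
    rw [Int.gcd_comm] at this; simpa using this
  refine ⟨⟨?_, ?_⟩, ?_⟩
  · apply Nat.dvd_antisymm
    · exact Int.dvd_gcd (Int.gcd_dvd_right ..) d1
    · exact Int.dvd_gcd d2 (Int.gcd_dvd_left ..)
  · apply Nat.dvd_antisymm
    · exact Int.dvd_gcd d2 (Int.gcd_dvd_right ..)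
    · exact Int.dvd_gcd d3 (Int.gcd_dvd_right ..)
  · by_contra hcon
    push Not at hcon
    obtain ⟨hcon1, hcon2⟩ := hcon
    rw [Finset.card_le_one] at hcon2
    have h1 := hcon2 _ (by simp) _ (by simp : padicValInt 2 b ∈ _) |> fun (h : padicValInt 2 a = _) => h
    have h2 := hcon2 _ (by simp) _ (by simp : padicValInt 2 c ∈ _) |> fun (h : padicValInt 2 a = _) => h
    obtain ⟨a', ha', ha2⟩ := odd_part a ha
    obtain ⟨b', hb', hb2⟩ := odd_part b hb
    obtain ⟨c', hc', hc2⟩ := odd_part c hc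
    rw [← h1] at hb'
    rw [← h2] at hc'
    have hk : padicValInt 2 a ≠ 0 := by
      intro h; exact hcon1 h (by omega) (by omega)
    generalize padicValInt 2 a = k at *
    have e' : ∀ i, ((w i : ℤ) : ZMod 2) + (u i : ℤ) = (v i : ℤ) := by
      intro i
      have := e i
      rw [ha', hb', hc'] at this
      have : a' * w i + b' * u i = c' * v i := by
        apply mul_left_cancel₀ (pow_ne_zero k (two_ne_zero : (2:ℤ) ≠ 0))
        linear_combination this
      have := congrArg (Int.cast : ℤ → ZMod 2) this
      push_cast at this
      rw [ha2, hb2, hc2] at this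
      simpa using this
    have z : (2 : ZMod 2) = 0 := by decide
    have za : (a : ZMod 2) = 0 := by rw [ha']; push_cast; rw [z, zero_pow hk, zero_mul]
    rw [ea] at za
    unfold det2 at za
    push_cast at za
    have z1 := zmod2 _ _ _ _ (prim_zmod u hu) (prim_zmod v hv) za
    refine prim_zmod w hw ⟨?_, ?_⟩
    · have := e' 0
      rw [z1.1] at this
      simpa using this
    · have := e' 1
      rw [z1.2] at this
      simpa using this

theorem val_aux (d a : ℤ) (hd : d ≠ 0) (ha : ¬ 2 ∣ a) : padicValInt 2 (d * a) = padicValInt 2 d := by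
  have ha0 : a ≠ 0 := by rintro rfl; simp at ha
  rw [padicValInt.mul hd ha0, padicValInt.eq_zero_of_not_dvd (z := a) (by exact_mod_cast ha), add_zero]

theorem sufficiency (a b c : ℤ) (ha : 0 < a) (hb : 0 < b) (hc : 0 < c)
    (h1 : Int.gcd a b = Int.gcd b c) (h2 : Int.gcd b c = Int.gcd a c)
    (h3 : (padicValInt 2 a = 0 ∧ padicValInt 2 b = 0 ∧ padicValInt 2 c = 0) ∨
      1 < ({padicValInt 2 a, padicValInt 2 b, padicValInt 2 c} : Finset ℕ).card) :
    ∃ p r : ℤ, p * c - r * a = b ∧ IsCoprime p a ∧ IsCoprime r c := by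
  have hd : ((Int.gcd a b : ℕ) : ℤ) ≠ 0 := by
    have := Int.gcd_pos_of_ne_zero_left b ha.ne'
    omega
  have cop : ∀ x y : ℤ, Int.gcd ((Int.gcd a b : ℕ) * x) ((Int.gcd a b : ℕ) * y) = Int.gcd a b →
      IsCoprime x y := by
    intro x y h
    rw [Int.gcd_mul_left, Int.natAbs_natCast] at h
    rw [Int.isCoprime_iff_gcd_eq_one]
    exact Nat.eq_of_mul_eq_mul_left (by omega : 0 < Int.gcd a b) (by omega)
  obtain ⟨a', ha'⟩ : ((Int.gcd a b : ℕ) : ℤ) ∣ a := Int.gcd_dvd_left ..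
  obtain ⟨b', hb'⟩ : ((Int.gcd a b : ℕ) : ℤ) ∣ b := Int.gcd_dvd_right ..
  obtain ⟨c', hc'⟩ : ((Int.gcd a b : ℕ) : ℤ) ∣ c := by rw [h1]; exact Int.gcd_dvd_right ..
  have cab := cop a' b' (by rw [← ha', ← hb'])
  have cbc := cop b' c' (by rw [← hb', ← hc', h1])
  have cac := cop a' c' (by rw [← ha', ← hc', h1, h2])
  generalize ((Int.gcd a b : ℕ) : ℤ) = d at *
  obtain ⟨p, r, e, hp, hr⟩ := exists_pr d a' b' c' hd cab cbc cac (by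
    intro hd2
    by_contra hcon
    push Not at hcon
    obtain ⟨na, nb, nc⟩ := hcon
    have va := val_aux d a' hd na
    have vb := val_aux d b' hd nb
    have vc := val_aux d c' hd nc
    rw [← ha'] at va
    rw [← hb'] at vb
    rw [← hc'] at vc
    rw [va, vb, vc] at h3
    have : padicValInt 2 d ≠ 0 := by
      intro h
      have := (padicValInt_dvd_iff (p := 2) 1 d).1 (by simpa using hd2)
      omega
    rcases h3 with h | h
    · exact this h.1
    · simp at h)
  refine ⟨p, r, ?_, by rwa [ha'], by rwa [hc']⟩
  rw [ha', hb', hc']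
  linear_combination d * e

/-- a triple `(a,b,c)` of positive integers appears as the labels of a
triangle in some Conway–Coxeter frieze if and only if
(1) `gcd(a,b) = gcd(b,c) = gcd(a,c)` and
(2) `ν₂(a) = ν₂(b) = ν₂(c) = 0` or `|{ν₂(a), ν₂(b), ν₂(c)}| > 1`. -/
theorem stmt8 (a b c : ℤ) (ha : 0 < a) (hb : 0 < b) (hc : 0 < c) :
    (∃ (m : ℕ) (hm : 3 ≤ m) (x : Fin m → (Fin 2 → ℤ)),
      (∀ i j : Fin m, i < j → 0 < det2 (x i) (x j)) ∧
      (∀ i : ℕ, ∀ h : i + 1 < m, det2 (x ⟨i, by omega⟩) (x ⟨i + 1, h⟩) = 1) ∧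
      det2 (x ⟨0, by omega⟩) (x ⟨m - 1, by omega⟩) = 1 ∧
      ∃ i j l : Fin m, i < j ∧ j < l ∧
        a = det2 (x i) (x j) ∧ b = det2 (x j) (x l) ∧ c = det2 (x i) (x l))
    ↔
    ((Int.gcd a b = Int.gcd b c ∧ Int.gcd b c = Int.gcd a c) ∧
     ((padicValInt 2 a = 0 ∧ padicValInt 2 b = 0 ∧ padicValInt 2 c = 0) ∨
      1 < ({padicValInt 2 a, padicValInt 2 b, padicValInt 2 c} : Finset ℕ).card)) := by
  constructor
  · rintro ⟨m, hm, x, -, hx1, -, i, j, l, -, -, ea, eb, ec⟩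
    have prim : ∀ i : Fin m, IsCoprime (x i 0) (x i 1) := by
      rintro ⟨i, hi⟩
      by_cases h : i + 1 < m
      · have := hx1 i h
        unfold det2 at this
        exact ⟨x ⟨i + 1, h⟩ 1, -x ⟨i + 1, h⟩ 0, by linear_combination this⟩
      · obtain ⟨k, rfl⟩ : ∃ k, i = k + 1 := ⟨i - 1, by omega⟩
        have := hx1 k hi
        unfold det2 at this
        exact ⟨-x ⟨k, by omega⟩ 1, x ⟨k, by omega⟩ 0, by linear_combination this⟩
    exact necessity _ _ _ (prim i) (prim j) (prim l) a b c ha hb hc ea eb ec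
  · rintro ⟨⟨h1, h2⟩, h3⟩
    obtain ⟨p, r, e, hp, hr⟩ := sufficiency a b c ha hb hc h1 h2 h3
    have Hu : HP ![1, 0] := Or.inr (by simp)
    have Hv : HP ![p, a] := Or.inl (by simpa using ha)
    have Hw : HP ![r, c] := Or.inl (by simpa using hc)
    have Hz : HP ![-(|r| + 1), 1] := Or.inl (by simp)
    have cu : IsCoprime ((![1, 0] : Fin 2 → ℤ) 0) ((![1, 0] : Fin 2 → ℤ) 1) := by
      simpa using isCoprime_one_left
    have cz : IsCoprime ((![-(|r| + 1), 1] : Fin 2 → ℤ) 0) ((![-(|r| + 1), 1] : Fin 2 → ℤ) 1) := by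
      simpa using isCoprime_one_right
    have duv : det2 ![1, 0] ![p, a] = a := by simp [det2]
    have duw : det2 ![1, 0] ![r, c] = c := by simp [det2]
    have dvw : det2 ![p, a] ![r, c] = b := by simp [det2]; linear_combination e
    have dwz : 0 < det2 ![r, c] ![-(|r| + 1), 1] := by
      simp [det2]
      have := neg_abs_le r
      nlinarith [abs_nonneg r]
    obtain ⟨n1, f1, hn1, f10, f11, hf1⟩ := seq_of_transGen (path _ _ Hu Hv cu (by simpa using hp)
      (by rw [duv]; exact ha))
    obtain ⟨n2, f2, hn2, f20, f21, hf2⟩ := seq_of_transGen (path _ _ Hv Hw (by simpa using hp)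
      (by simpa using hr) (by rw [dvw]; exact hb))
    obtain ⟨n3, f3, hn3, f30, f31, hf3⟩ := seq_of_transGen (path _ _ Hw Hz (by simpa using hr)
      cz dwz)
    obtain ⟨g, g1, g2, hg⟩ := seq_concat n2 n3 f2 f3 (by rw [f21, f30]) hf2 hf3
    obtain ⟨f, fe1, fe2, hf⟩ := seq_concat n1 (n2 + n3) f1 g
      (by rw [f11, g1 0 (by omega), f20]) hf1 hg
    have f0 : f 0 = ![1, 0] := by rw [fe1 0 (by omega), f10]
    have fv : f n1 = ![p, a] := by rw [fe1 n1 le_rfl, f11]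
    have fw : f (n1 + n2) = ![r, c] := by rw [fe2, g1 n2 le_rfl, f21]
    have fz : f (n1 + (n2 + n3)) = ![-(|r| + 1), 1] := by rw [fe2, g2, f31]
    have pos : ∀ k i, i + k + 1 ≤ n1 + (n2 + n3) → 0 < det2 (f i) (f (i + k + 1)) := by
      intro k
      induction k with
      | zero => intro i hi; rw [add_zero, (hf i (by omega)).2.2]; exact one_pos
      | succ k ih =>
        intro i hi
        have s := hf (i + k + 1) (by omega)
        refine det2_trans _ (f (i + k + 1)) _ (hf i (by omega)).1 s.1 s.2.1 (ih i (by omega)) ?_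
        have := s.2.2
        rw [show i + (k + 1) + 1 = i + k + 1 + 1 by omega, this]
        exact one_pos
    refine ⟨n1 + (n2 + n3) + 1, by omega, fun i => f i, ?_, ?_, ?_,
      ⟨0, by omega⟩, ⟨n1, by omega⟩, ⟨n1 + n2, by omega⟩, ?_, ?_, ?_, ?_, ?_⟩
    · rintro ⟨i, hi⟩ ⟨j, hj⟩ hij
      have hij' : i < j := hij
      obtain ⟨k, rfl⟩ : ∃ k, j = i + k + 1 := ⟨j - i - 1, by omega⟩
      exact pos k i (by omega)
    · intro i h
      exact (hf i (by omega)).2.2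
    · simp only [Nat.add_sub_cancel]
      rw [f0, fz]; simp [det2]
    · exact Fin.mk_lt_mk.2 hn1
    · exact Fin.mk_lt_mk.2 (by omega)
    · simp only [f0, fv, duv]
    · simp only [fv, fw, dvw]
    · simp only [f0, fw, duw]
end

section
/- Let n ≥ 3 and let C be a frieze with coefficients on an n-gon over the positive integers, i.e. a map assigning to each pair 1 ≤ i < j ≤ n a positive integer C(i,j) satisfying the Ptolemy relations C(i,k)·C(j,l) = C(i,j)·C(k,l) + C(i,l)·C(j,k) for all 1 ≤ i < j < k < l ≤ n. Then C appears as a subpolygon of some Conway–Coxeter frieze — i.e. there exist m ≥ n, vectors x_1,…,x_m ∈ ℤ² with det(x_i, x_j) > 0 for all 1 ≤ i < j ≤ m, det(x_i, x_{i+1}) = 1 for 1 ≤ i < m, det(x_1, x_m) = 1, and indices 1 ≤ i_1 < … < i_n ≤ m with C(r,s) = det(x_{i_r}, x_{i_s}) for all 1 ≤ r < s ≤ n — if and only if the following two conditions hold: (1) for all 1 ≤ i < j < l ≤ n, gcd(C(i,j), C(j,l)) = gcd(C(j,l), C(i,l)) = gcd(C(i,j), C(i,l)); (2) for every prime number p <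 n and every subset S ⊆ {1,…,n} with |S| = p + 1, either p divides none of the values C(i,j) with i < j both in S, or the values C(i,j) with i < j both in S do not all have the same p-adic valuation ν_p. -/
/-- primitive -/
def Prim (u : Fin 2 → ℤ) : Prop := ∃ z, det2 u z = 1

lemma prim_dvd {u : Fin 2 → ℤ} (hu : Prim u) (a b : Fin 2 → ℤ) (d : ℤ)
    (h1 : d ∣ det2 a u) (h2 : d ∣ det2 u b) : d ∣ det2 a b := by
  obtain ⟨z, hz⟩ := hu
  have : det2 a b = det2 a u * det2 z b * (-1) + det2 u b * det2 a z := by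
    have : det2 a b = det2 u z * det2 a b := by rw [hz, one_mul]
    rw [this]; unfold det2; ring
  rw [this]
  exact dvd_add (Dvd.dvd.mul_right (Dvd.dvd.mul_right h1 _) _) (Dvd.dvd.mul_right h2 _)

lemma det2_swap (u v : Fin 2 → ℤ) : det2 u v = - det2 v u := by unfold det2; ring

lemma gcd_eq_of (a b c : ℤ) (h1 : ∀ d : ℤ, d ∣ a → d ∣ b → d ∣ c)
    (h2 : ∀ d : ℤ, d ∣ b → d ∣ c → d ∣ a) (h3 : ∀ d : ℤ, d ∣ a → d ∣ c → d ∣ b) :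
    Int.gcd a b = Int.gcd b c ∧ Int.gcd b c = Int.gcd a c := by
  have key : ∀ a b c d : ℤ, (∀ e : ℤ, e ∣ a → e ∣ b → e ∣ c ∧ e ∣ d) → Int.gcd a b ∣ Int.gcd c d := by
    intro a b c d h
    have := h (Int.gcd a b) (Int.gcd_dvd_left ..) (Int.gcd_dvd_right ..)
    have := Int.dvd_coe_gcd this.1 this.2
    exact_mod_cast this
  constructor <;> apply Nat.dvd_antisymm <;> apply key <;> intro e ha hb
  · exact ⟨hb, h1 e ha hb⟩
  · exact ⟨h2 e ha hb, ha⟩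
  · exact ⟨h2 e ha hb, hb⟩
  · exact ⟨h3 e ha hb, hb⟩

lemma forward (n : ℕ) (C : Fin n → Fin n → ℤ)
    (hCpos : ∀ i j : Fin n, i < j → 0 < C i j)
    (y : Fin n → Fin 2 → ℤ) (hy : ∀ i, Prim (y i))
    (hC : ∀ r s : Fin n, r < s → C r s = det2 (y r) (y s)) :
    ((∀ i j l : Fin n, i < j → j < l →
        Int.gcd (C i j) (C j l) = Int.gcd (C j l) (C i l) ∧
        Int.gcd (C j l) (C i l) = Int.gcd (C i j) (C i l)) ∧
     (∀ p : ℕ, p.Prime → p < n →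
        ∀ S : Finset (Fin n), S.card = p + 1 →
          (∀ i ∈ S, ∀ j ∈ S, i < j → ¬ ((p : ℤ) ∣ C i j)) ∨
          ¬ (∃ v : ℕ, ∀ i ∈ S, ∀ j ∈ S, i < j → padicValInt p (C i j) = v))) := by
  constructor
  · intro i j l hij hjl
    rw [hC i j hij, hC j l hjl, hC i l (hij.trans hjl)]
    apply gcd_eq_of
    · intro d; exact prim_dvd (hy j) _ _ d
    · intro d h1 h2
      exact prim_dvd (hy l) _ _ d h2 (by rw [det2_swap]; exact (dvd_neg.2 h1))
    · intro d h1 h2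
      exact prim_dvd (hy i) _ _ d (by rw [det2_swap]; exact (dvd_neg.2 h1)) h2
  · intro p hp hpn S hS
    have : Fact p.Prime := ⟨hp⟩
    by_contra hcon
    push Not at hcon
    obtain ⟨⟨i0, hi0, j0, hj0, hij0, hpd⟩, v, hv⟩ := hcon
    have hv1 : 1 ≤ v := by
      rw [← hv i0 hi0 j0 hj0 hij0]
      have := (padicValInt_dvd_iff (p := p) 1 (C i0 j0)).1 (by simpa using hpd)
      rcases this with h | h
      · have := hCpos _ _ hij0; omega
      · exact h
    have hdv : ∀ i ∈ S, ∀ j ∈ S, i < j → (p:ℤ)^v ∣ C i j := by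
      intro i hi j hj hij
      rw [padicValInt_dvd_iff]; right; rw [hv i hi j hj hij]
    have hndv : ∀ i ∈ S, ∀ j ∈ S, i < j → ¬ (p:ℤ)^(v+1) ∣ C i j := by
      intro i hi j hj hij h
      rw [padicValInt_dvd_iff, hv i hi j hj hij] at h
      have := hCpos _ _ hij; omega
    have hdv2 : ∀ i ∈ S, ∀ j ∈ S, (p:ℤ)^v ∣ det2 (y i) (y j) := by
      intro i hi j hj
      rcases lt_trichotomy i j with h | h | h
      · rw [← hC _ _ h]; exact hdv i hi j hj h
      · subst h; simp [det2, mul_comm]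
      · rw [det2_swap, ← hC _ _ h]; exact dvd_neg.2 (hdv j hj i hi h)
    have hndv2 : ∀ i ∈ S, ∀ j ∈ S, i ≠ j → ¬ (p:ℤ)^(v+1) ∣ det2 (y i) (y j) := by
      intro i hi j hj hij hd
      rcases lt_or_gt_of_ne hij with h | h
      · rw [← hC _ _ h] at hd; exact hndv i hi j hj h hd
      · rw [det2_swap, ← hC _ _ h] at hd; exact hndv j hj i hi h (dvd_neg.1 hd)
    obtain ⟨z, hz⟩ := hy i0
    have hb : ∀ k, ∃ b : ℤ, k ∈ S → det2 (y i0) (y k) = (p:ℤ)^v * b := by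
      intro k
      by_cases hk : k ∈ S
      · obtain ⟨b, hb⟩ := hdv2 i0 hi0 k hk
        exact ⟨b, fun _ => hb⟩
      · exact ⟨0, fun h => absurd h hk⟩
    choose b hb using hb
    have hal : ∀ k ∈ S, ((det2 (y k) z : ℤ) : ZMod p) ≠ 0 := by
      intro k hk h
      rw [ZMod.intCast_zmod_eq_zero_iff_dvd] at h
      have h1 : (p:ℤ) ∣ det2 (y i0) (y k) := (dvd_pow_self _ (by omega)).trans (hdv2 i0 hi0 k hk)
      have := prim_dvd (hy k) _ _ _ h1 h
      rw [hz] at this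
      have := Int.eq_one_of_dvd_one (by positivity) this
      have := hp.one_lt; omega
    obtain ⟨k, hk, l, hl, hkl, hf⟩ := Finset.exists_ne_map_eq_of_card_lt_of_maps_to
      (s := S) (t := (Finset.univ : Finset (ZMod p))) (by rw [hS, Finset.card_univ, ZMod.card]; omega)
      (f := fun k => (b k : ZMod p) / ((det2 (y k) z : ℤ) : ZMod p)) (fun _ _ => Finset.mem_coe.2 (Finset.mem_univ _))
    apply hndv2 k hk l hl hkl
    rw [div_eq_div_iff (hal k hk) (hal l hl)] at hf
    have hd : (p:ℤ) ∣ det2 (y k) z * b l - det2 (y l) z * b k := by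
      rw [← ZMod.intCast_zmod_eq_zero_iff_dvd]
      push_cast
      rw [sub_eq_zero, mul_comm, ← hf, mul_comm]
    have : det2 (y k) (y l) = (p:ℤ)^v * (det2 (y k) z * b l - det2 (y l) z * b k) := by
      have e1 : det2 (y k) (y l) = det2 (y i0) z * det2 (y k) (y l) := by rw [hz, one_mul]
      have : det2 (y i0) z * det2 (y k) (y l) = det2 (y k) z * det2 (y i0) (y l) - det2 (y l) z * det2 (y i0) (y k) := by
        unfold det2; ring
      rw [e1, this, hb k hk, hb l hl]; ring
    rw [this, pow_succ]
    exact mul_dvd_mul_left _ hd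

/-! ### extension -/

lemma seg (h : Fin 2 → ℤ) : ∀ (N : ℕ) (u v : Fin 2 → ℤ), Prim u → Prim v → 0 < det2 u v →
    det2 u v ≤ N → 0 ≤ det2 h u → 0 ≤ det2 h v → 0 < det2 h u + det2 h v →
    ∃ M : List (Fin 2 → ℤ), List.IsChain (fun a b => det2 a b = 1) (u :: (M ++ [v])) ∧
      ∀ w ∈ M, 0 < det2 h w := by
  intro N
  induction N with
  | zero => intro u v _ _ h1 h2; exfalso; push_cast at h2; omega
  | succ N ih =>
    intro u v hu hv hpos hle h1 h2 h3
    by_cases hd : det2 u v = 1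
    · exact ⟨[], by simp [hd], by simp⟩
    obtain ⟨z, hz⟩ := hu
    set d := det2 u v with hdd
    let t := - (det2 z v / d)
    let w : Fin 2 → ℤ := fun i => z i + t * u i
    have hw1 : det2 u w = 1 := by rw [← hz]; simp only [det2, w]; ring
    have hw2 : det2 w v = det2 z v % d := by
      rw [Int.emod_def]; simp only [w, t, det2, hdd]; ring
    have hw3 : 0 ≤ det2 w v := hw2 ▸ Int.emod_nonneg _ hpos.ne'
    have hw4 : det2 w v < d := hw2 ▸ Int.emod_lt_of_pos _ hpos
    have hw5 : det2 w v ≠ 0 := by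
      intro h0
      have hwp : Prim w := ⟨fun i => - u i, by rw [← hw1]; simp only [det2]; ring⟩
      obtain ⟨z', hz'⟩ := hv
      have hdvd : d ∣ det2 w v := by rw [h0]; exact dvd_zero _
      have h6 : d ∣ det2 u w * det2 v z' := by
        have : det2 u w * det2 v z' = det2 u v * det2 w z' - det2 w v * det2 u z' := by
          unfold det2; ring
        rw [this, h0, zero_mul, sub_zero]
        exact Dvd.intro _ rfl
      rw [hw1, hz', one_mul] at h6
      exact hd (Int.eq_one_of_dvd_one hpos.le h6)
    have hw6 : 0 < det2 w v := lt_of_le_of_ne hw3 (Ne.symm hw5)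
    have hhw : 0 < det2 h w := by
      have : d * det2 h w = det2 w v * det2 h u + det2 u w * det2 h v := by
        rw [hdd]; unfold det2; ring
      rw [hw1] at this
      have : 0 < d * det2 h w := by
        rw [this]
        rcases h1.lt_or_eq with h | h
        · have := mul_pos hw6 h; omega
        · rw [← h] at h3 ⊢; omega
      exact pos_of_mul_pos_right this hpos.le
    obtain ⟨M, hM1, hM2⟩ := ih w v ⟨fun i => - u i, by rw [← hw1]; simp only [det2]; ring⟩ hv hw6
      (by push_cast at hle; omega) hhw.le h2 (by omega)
    refine ⟨w :: M, ?_, ?_⟩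
    · rw [List.cons_append, List.isChain_cons_cons]; exact ⟨hw1, hM1⟩
    · intro a ha
      rcases List.mem_cons.1 ha with rfl | ha
      · exact hhw
      · exact hM2 a ha

lemma refine_list (h z : Fin 2 → ℤ) (hz : Prim z) (hhz : 0 ≤ det2 h z) :
    ∀ (l : List (Fin 2 → ℤ)) (u : Fin 2 → ℤ),
    (∀ w ∈ l, Prim w) → Prim u → List.IsChain (fun a b => 0 < det2 a b) (u :: (l ++ [z])) →
    (∀ w ∈ l, 0 < det2 h w) → 0 < det2 h u →
    ∃ L : List (Fin 2 → ℤ), List.IsChain (fun a b => det2 a b = 1) (u :: (L ++ [z])) ∧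
      l.Sublist L ∧ ∀ w ∈ L, 0 < det2 h w := by
  intro l
  induction l with
  | nil =>
    intro u _ hu hc _ hhu
    have hc' : 0 < det2 u z := by simpa using hc
    obtain ⟨M, h1, h2⟩ := seg h (det2 u z).toNat u z hu hz hc' (by omega) hhu.le hhz (by omega)
    exact ⟨M, h1, List.nil_sublist _, h2⟩
  | cons v l ih =>
    intro u hl hu hc hhl hhu
    rw [List.cons_append, List.isChain_cons_cons] at hc
    have hhv := hhl v (by simp)
    obtain ⟨M, h1, h2⟩ := seg h (det2 u v).toNat u v hu (hl v (by simp)) hc.1 (by omega) hhu.le hhv.le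
      (by omega)
    obtain ⟨L, h3, h4, h5⟩ := ih v (fun w hw => hl w (by simp [hw])) (hl v (by simp)) hc.2
      (fun w hw => hhl w (by simp [hw])) hhv
    refine ⟨M ++ v :: L, ?_, ?_, ?_⟩
    · have : u :: ((M ++ v :: L) ++ [z]) = (u :: M) ++ v :: (L ++ [z]) := by simp
      rw [this, List.isChain_split]
      exact ⟨by simpa using h1, h3⟩
    · exact (List.Sublist.cons_cons v h4).trans (List.sublist_append_right _ _)
    · intro w hw
      rcases List.mem_append.1 hw with hw | hw
      · exact h2 w hw
      · rcases List.mem_cons.1 hw with rfl | hw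
        · exact hhv
        · exact h5 w hw

lemma extend_list (h u : Fin 2 → ℤ) (l : List (Fin 2 → ℤ)) (hp : ∀ w ∈ h :: u :: l, Prim w)
    (hpw : (h :: u :: l).Pairwise (fun a b => 0 < det2 a b)) :
    ∃ L : List (Fin 2 → ℤ), (h :: u :: l).Sublist (h :: L) ∧
      (h :: L).Pairwise (fun a b => 0 < det2 a b) ∧
      List.IsChain (fun a b => det2 a b = 1) (h :: (L ++ [fun i => - h i])) := by
  have hz : Prim (fun i => - h i) := by
    obtain ⟨z, hz⟩ := hp h (by simp)
    exact ⟨fun i => - z i, by rw [← hz]; simp only [det2]; ring⟩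
  have hzero : det2 h (fun i => - h i) = 0 := by simp only [det2]; ring
  have hh : ∀ w ∈ u :: l, 0 < det2 h w := (List.pairwise_cons.1 hpw).1
  obtain ⟨M, h1, h2⟩ := seg h (det2 h u).toNat h u (hp h (by simp)) (hp u (by simp)) (hh u (by simp))
    (by have := hh u (by simp); omega) (by simp [det2, mul_comm]) (hh u (by simp)).le
    (by have := hh u (by simp); have : det2 h h = 0 := by simp [det2, mul_comm]
        omega)
  obtain ⟨L, h3, h4, h5⟩ := refine_list h _ hz hzero.ge l u (fun w hw => hp w (by simp [hw]))
    (hp u (by simp)) (by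
      have := (List.pairwise_cons.1 hpw).2
      have : (u :: l ++ [fun i => - h i]).Pairwise (fun a b => 0 < det2 a b) := by
        rw [List.pairwise_append]
        refine ⟨this, by simp, ?_⟩
        intro a ha b hb
        rw [List.mem_singleton] at hb
        subst hb
        have := hh a ha
        have e : det2 a (fun i => - h i) = det2 h a := by simp only [det2]; ring
        omega
      exact this.isChain) (fun w hw => hh w (by simp [hw])) (hh u (by simp))
  have hall : ∀ w ∈ M ++ u :: L, 0 < det2 h w := by
    intro w hw
    rcases List.mem_append.1 hw with hw | hw
    · exact h2 w hw
    · rcases List.mem_cons.1 hw with rfl | hw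
      · exact hh _ (by simp)
      · exact h5 w hw
  have hchain : List.IsChain (fun a b => det2 a b = 1) (h :: ((M ++ u :: L) ++ [fun i => - h i])) := by
    have : h :: ((M ++ u :: L) ++ [fun i => - h i]) = (h :: M) ++ u :: (L ++ [fun i => - h i]) := by simp
    rw [this, List.isChain_split]
    exact ⟨by simpa using h1, h3⟩
  refine ⟨M ++ u :: L, ?_, ?_, hchain⟩
  · exact List.Sublist.cons_cons h ((List.Sublist.cons_cons u h4).trans (List.sublist_append_right _ _))
  · rw [List.pairwise_cons]
    refine ⟨hall, ?_⟩
    have hc2 : List.IsChain (fun a b => det2 a b = 1) (M ++ u :: L) := by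
      have := List.IsChain.tail hchain
      exact (List.isChain_append.1 this).1
    let R : (Fin 2 → ℤ) → (Fin 2 → ℤ) → Prop := fun a b => 0 < det2 h a ∧ 0 < det2 h b ∧ 0 < det2 a b
    have : IsTrans _ R := ⟨by
      rintro a b c ⟨h1, h2, h3⟩ ⟨h4, h5, h6⟩
      refine ⟨h1, h5, ?_⟩
      have : det2 h b * det2 a c = det2 h a * det2 b c + det2 h c * det2 a b := by unfold det2; ring
      have : 0 < det2 h b * det2 a c := by rw [this]; positivity
      exact pos_of_mul_pos_right this h2.le⟩
    have hR : List.IsChain R (M ++ u :: L) := by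
      refine List.IsChain.imp_of_mem_imp ?_ hc2
      intro a b ha hb hab
      exact ⟨hall a ha, hall b hb, by omega⟩
    exact (List.isChain_iff_pairwise.1 hR).imp (fun h => h.2.2)

lemma extend_fin (n : ℕ) (hn : 3 ≤ n) (C : Fin n → Fin n → ℤ)
    (hCpos : ∀ i j : Fin n, i < j → 0 < C i j)
    (y : Fin n → Fin 2 → ℤ) (hy : ∀ i, Prim (y i))
    (hC : ∀ r s : Fin n, r < s → C r s = det2 (y r) (y s)) :
    (∃ (m : ℕ) (_ : n ≤ m) (x : Fin m → (Fin 2 → ℤ)),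
      (∀ i j : Fin m, i < j → 0 < det2 (x i) (x j)) ∧
      (∀ i j : Fin m, i.1 + 1 = j.1 → det2 (x i) (x j) = 1) ∧
      (∀ i j : Fin m, i.1 = 0 → j.1 = m - 1 → det2 (x i) (x j) = 1) ∧
      ∃ idx : Fin n → Fin m, StrictMono idx ∧
        ∀ r s : Fin n, r < s → C r s = det2 (x (idx r)) (x (idx s))) := by
  have hpw : (List.ofFn y).Pairwise (fun a b => 0 < det2 a b) := by
    rw [List.pairwise_ofFn]
    intro i j hij
    rw [← hC i j hij]; exact hCpos i j hij
  have hprim : ∀ w ∈ List.ofFn y, Prim w := by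
    intro w hw
    obtain ⟨i, rfl⟩ := (List.mem_ofFn' y w).1 hw
    exact hy i
  obtain ⟨h, u, l, hl⟩ : ∃ h u l, List.ofFn y = h :: u :: l := by
    have hlen : (List.ofFn y).length = n := List.length_ofFn
    match List.ofFn y, hlen with
    | [], hlen => simp at hlen; omega
    | [_], hlen => simp at hlen; omega
    | h :: u :: l, _ => exact ⟨h, u, l, rfl⟩
  obtain ⟨L, h1, h2, h3⟩ := extend_list h u l (hl ▸ hprim) (hl ▸ hpw)
  rw [← hl] at h1
  have hlenn : n ≤ (h :: L).length := by simpa using h1.length_le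
  obtain ⟨f, hf⟩ := List.sublist_iff_exists_fin_orderEmbedding_get_eq.1 h1
  refine ⟨(h :: L).length, hlenn, (h :: L).get, ?_, ?_, ?_, fun i => f (Fin.cast (by simp) i), ?_, ?_⟩
  · exact List.pairwise_iff_get.1 h2
  · rintro ⟨i, hi'⟩ ⟨j, hi⟩ hij
    simp only at hij
    subst hij
    have := List.isChain_iff_getElem.1 ((List.isChain_append (l₁ := h :: L)).1 h3).1 i hi
    simpa using this
  · rintro ⟨i, hi⟩ ⟨j, hj⟩ hi0 hj0
    simp only at hi0 hj0
    subst hi0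
    subst hj0
    have := ((List.isChain_append (l₁ := h :: L)).1 h3).2.2
    have h4 := this ((h::L).getLast (by simp)) (by simp [List.getLast?_eq_some_getLast]) (fun i => - h i) (by simp)
    have h5 : (h :: L).get ⟨(h :: L).length - 1, by simp⟩ = (h :: L).getLast (by simp) := by
      simp [List.getLast_eq_getElem]
    rw [h5, ← h4]
    simp only [det2, List.get_eq_getElem, List.getElem_cons_zero]; ring
  · intro i j hij
    exact f.strictMono (by simpa using hij)
  · intro r s hrs
    rw [← hf, ← hf, hC r s hrs]; simp
lemma local_sol {ι : Type*} [Fintype ι] [DecidableEq ι] (D : ι → ι → ℤ) (o e1 : ι)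
    (he1 : e1 ≠ o)
    (hanti : ∀ i j, D i j = - D j i)
    (hpl : ∀ j k l, D o k * D j l = D o j * D k l + D o l * D j k)
    (htr : ∀ (d : ℤ) i j l, d ∣ D i j → d ∣ D j l → d ∣ D i l)
    (hne : ∀ k, k ≠ o → D o k ≠ 0)
    (p : ℕ) (hp : p.Prime)
    (h2 : ∀ (S : Finset ι), S.card = p + 1 → ∀ w : ℕ, 1 ≤ w →
      ¬ (∀ i ∈ S, ∀ j ∈ S, i ≠ j → (p:ℤ)^w ∣ D i j ∧ ¬ (p:ℤ)^(w+1) ∣ D i j))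
    (e : ℕ) (he : (p:ℤ)^e ∣ D o e1) (he' : ¬ (p:ℤ)^(e+1) ∣ D o e1) :
    ∃ a : ℤ, ∀ k, (p:ℤ)^e ∣ a * D o k - D e1 k ∧
      ((p:ℤ) ∣ D o k → ¬ (p:ℤ)^(e+1) ∣ a * D o k - D e1 k) := by
  have : Fact p.Prime := ⟨hp⟩
  have hpZ : Prime (p:ℤ) := Nat.prime_iff_prime_int.1 hp
  have hD0 : ∀ i, D i i = 0 := fun i => by have := hanti i i; omega
  -- the minimal valuation
  have hw : ∃ w : ℕ, (∀ k, (p:ℤ)^w ∣ D o k) ∧ ¬ ∀ k, (p:ℤ)^(w+1) ∣ D o k := by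
    have hex : ∃ w : ℕ, ¬ ∀ k, (p:ℤ)^w ∣ D o k := ⟨e+1, fun h => he' (h e1)⟩
    classical
    have hs := Nat.find_spec hex
    have hm := fun m => Nat.find_min hex (m := m)
    rcases hN : Nat.find hex with _ | w
    · rw [hN] at hs; simp at hs
    · rw [hN] at hs
      refine ⟨w, ?_, hs⟩
      have := hm w (by omega)
      push Not at this; exact this
  obtain ⟨w, hw1, hw2⟩ := hw
  push Not at hw2
  obtain ⟨j, hj⟩ := hw2
  have hall : ∀ i k, (p:ℤ)^w ∣ D i k := fun i k =>
    htr _ i o k (by rw [hanti]; exact dvd_neg.2 (hw1 i)) (hw1 k)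
  choose E hE using hall
  have hpw : (p:ℤ)^w ≠ 0 := pow_ne_zero _ hpZ.ne_zero
  have hdvd : ∀ i k, (p:ℤ)^(w+1) ∣ D i k ↔ (p:ℤ) ∣ E i k := by
    intro i k; rw [hE i k, pow_succ]; exact mul_dvd_mul_iff_left hpw
  have hEj : ¬ (p:ℤ) ∣ E o j := by rwa [← hdvd]
  have hEpl : ∀ j k l, E o k * E j l = E o j * E k l + E o l * E j k := by
    intro j k l
    have := hpl j k l
    rw [hE o k, hE j l, hE o j, hE k l, hE o l, hE j k] at this
    apply mul_left_cancel₀ (mul_ne_zero hpw hpw)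
    linear_combination this
  have hEtr : ∀ i j l, (p:ℤ) ∣ E i j → (p:ℤ) ∣ E j l → (p:ℤ) ∣ E i l := by
    intro i j l; rw [← hdvd, ← hdvd, ← hdvd]; exact htr _ i j l
  have hEanti : ∀ i j, E i j = - E j i := by
    intro i j
    have := hanti i j
    rw [hE i j, hE j i] at this
    apply mul_left_cancel₀ hpw
    linear_combination this
  -- choose s
  have hs : ∃ s : ℤ, ∀ k, k ≠ o → (p:ℤ) ∣ D o k → ¬ (p:ℤ) ∣ s * E o k - E j k := by
    have hcase1 : ∀ k, (p:ℤ) ∣ E o k → ∀ s : ℤ, ¬ (p:ℤ) ∣ s * E o k - E j k := by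
      intro k hk s hd
      have h3 : (p:ℤ) ∣ E j k := (dvd_sub_right (Dvd.dvd.mul_left hk s)).1 hd
      apply hEj
      exact hEtr o k j hk (by rw [hEanti]; exact dvd_neg.2 h3)
    rcases Nat.eq_zero_or_pos w with hw0 | hw0
    · refine ⟨0, fun k _ hk => hcase1 k ?_ 0⟩
      rw [← hdvd, hw0]; simpa using hk
    · by_contra hcon
      push Not at hcon
      have hk : ∀ s : ZMod p, ∃ k, ¬ (p:ℤ) ∣ E o k ∧ s * (E o k : ZMod p) = (E j k : ZMod p) := by
        intro s
        obtain ⟨k, _, _, hk⟩ := hcon (s.val : ℤ)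
        refine ⟨k, fun h => hcase1 k h _ hk, ?_⟩
        rw [← ZMod.intCast_zmod_eq_zero_iff_dvd] at hk
        push_cast at hk
        rw [ZMod.natCast_zmod_val] at hk
        exact sub_eq_zero.1 hk
      choose κ hκ1 hκ2 using hk
      have hκ1' : ∀ s, ((E o (κ s) : ℤ) : ZMod p) ≠ 0 := by
        intro s; rw [Ne, ZMod.intCast_zmod_eq_zero_iff_dvd]; exact hκ1 s
      have hpair : ∀ s r, s ≠ r → ¬ (p:ℤ) ∣ E (κ s) (κ r) := by
        intro s r hsr hd
        have h1 := hEpl (κ s) j (κ r)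
        have h1' : ((E o j * E (κ s) (κ r) : ℤ) : ZMod p) = ((E o (κ s) * E j (κ r) + E o (κ r) * E (κ s) j : ℤ) : ZMod p) := by
          rw [h1]
        rw [hEanti (κ s) j] at h1'
        push_cast at h1'
        rw [(ZMod.intCast_zmod_eq_zero_iff_dvd (E (κ s) (κ r)) p).2 hd, ← hκ2, ← hκ2] at h1'
        have h4 : (E o (κ s) : ZMod p) * (E o (κ r) : ZMod p) * (r - s) = 0 := by
          linear_combination - h1'
        rcases mul_eq_zero.1 h4 with h5 | h5
        · exact mul_ne_zero (hκ1' s) (hκ1' r) h5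
        · exact hsr (sub_eq_zero.1 h5).symm
      have hE0 : ∀ i, (p:ℤ) ∣ E i i := by
        intro i; rw [← hdvd, hD0]; exact dvd_zero _
      have hinj : Function.Injective κ := by
        intro s r hsr
        by_contra hne
        exact hpair s r hne (hsr ▸ hE0 _)
      have hnotin : o ∉ Finset.univ.image κ := by
        intro h
        obtain ⟨s, _, hs⟩ := Finset.mem_image.1 h
        apply hκ1 s; rw [hs]; exact hE0 o
      refine h2 (insert o (Finset.univ.image κ)) ?_ w hw0 ?_
      · rw [Finset.card_insert_of_notMem hnotin, Finset.card_image_of_injective _ hinj,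
          Finset.card_univ, ZMod.card]
      · intro i hi k hk hik
        refine ⟨Dvd.intro _ (hE i k).symm, ?_⟩
        rw [hdvd]
        rcases Finset.mem_insert.1 hi with hi' | hi' <;> rcases Finset.mem_insert.1 hk with hk' | hk'
        · exact absurd (hi'.trans hk'.symm) hik
        · obtain ⟨s, _, rfl⟩ := Finset.mem_image.1 hk'
          rw [hi']
          exact hκ1 s
        · obtain ⟨s, _, rfl⟩ := Finset.mem_image.1 hi'
          rw [hk', hEanti, dvd_neg]; exact hκ1 s
        · obtain ⟨s, _, rfl⟩ := Finset.mem_image.1 hi'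
          obtain ⟨r, _, rfl⟩ := Finset.mem_image.1 hk'
          exact hpair s r (fun h => hik (by rw [h]))
  obtain ⟨s, hs⟩ := hs
  -- choose a
  have hcop : IsCoprime (E o j) ((p:ℤ)^(e+1)) := by
    apply IsCoprime.pow_right
    exact ((Prime.coprime_iff_not_dvd hpZ).2 hEj).symm
  have ha : ∃ a : ℤ, (p:ℤ)^(e+1) ∣ a * E o j - (E e1 j + E o e1 * s) := by
    obtain ⟨α, β, hαβ⟩ := hcop
    refine ⟨(E e1 j + E o e1 * s) * α, -(E e1 j + E o e1 * s) * β, ?_⟩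
    linear_combination (E e1 j + E o e1 * s) * hαβ
  obtain ⟨a, q, ha⟩ := ha
  refine ⟨a, fun k => ?_⟩
  have key : E o j * (a * D o k - D e1 k) = (p:ℤ)^(e+1) * (q * D o k) + D o e1 * (s * E o k - E j k) := by
    have := hEpl e1 j k
    rw [hE o k, hE e1 k, hE o e1]
    linear_combination (p:ℤ)^w * (E o k) * ha - (p:ℤ)^w * this
  have hpe : (p:ℤ)^e ∣ (p:ℤ)^(e+1) := pow_dvd_pow _ (by omega)
  by_cases hko : k = o
  · subst hko
    rw [hD0, hanti e1 k]
    simp only [mul_zero, zero_sub, neg_neg]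
    exact ⟨he, fun _ => he'⟩
  constructor
  · have : (p:ℤ)^e ∣ E o j * (a * D o k - D e1 k) := by
      rw [key]
      exact dvd_add (Dvd.dvd.mul_right hpe _) (Dvd.dvd.mul_right he _)
    exact (hcop.symm.of_isCoprime_of_dvd_left hpe).dvd_of_dvd_mul_left this
  · intro hk hd
    have h1 : (p:ℤ)^(e+1) ∣ D o e1 * (s * E o k - E j k) := by
      have := Dvd.dvd.mul_left hd (E o j)
      rw [key] at this
      exact (dvd_add_right (Dvd.intro _ rfl)).1 this
    have hc : IsCoprime ((p:ℤ)^(e+1)) (s * E o k - E j k) :=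
      IsCoprime.pow_left ((Prime.coprime_iff_not_dvd hpZ).2 (hs k hko hk))
    exact he' (hc.dvd_of_dvd_mul_right h1)

lemma crt_int (P : Finset ℕ) (hP : ∀ p ∈ P, p.Prime) (e : ℕ → ℕ) (b : ℕ → ℤ) :
    ∃ a : ℤ, ∀ p ∈ P, (p:ℤ)^(e p) ∣ a - b p := by
  induction P using Finset.induction_on with
  | empty => exact ⟨0, by simp⟩
  | insert q P hq ih =>
    obtain ⟨a, ha⟩ := ih (fun p hp => hP p (Finset.mem_insert_of_mem hp))
    have hc : IsCoprime ((q:ℤ)^(e q)) (∏ p ∈ P, (p:ℤ)^(e p)) := by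
      apply IsCoprime.prod_right
      intro p hp
      apply IsCoprime.pow
      rw [Nat.isCoprime_iff_coprime, Nat.coprime_primes (hP q (by simp)) (hP p (by simp [hp]))]
      rintro rfl; exact hq hp
    obtain ⟨u, v, huv⟩ := hc
    refine ⟨a + (b q - a) * (v * ∏ p ∈ P, (p:ℤ)^(e p)), ?_⟩
    intro p hp
    rcases Finset.mem_insert.1 hp with rfl | hp
    · refine ⟨-(b p - a) * u, ?_⟩
      linear_combination (b p - a) * huv
    · have h1 : (p:ℤ)^(e p) ∣ ∏ p ∈ P, (p:ℤ)^(e p) := Finset.dvd_prod_of_mem _ hp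
      have : a + (b q - a) * (v * ∏ p ∈ P, (p:ℤ)^(e p)) - b p = (a - b p) + (b q - a) * v * ∏ p ∈ P, (p:ℤ)^(e p) := by ring
      rw [this]
      exact dvd_add (ha p hp) (Dvd.dvd.mul_left h1 _)

lemma global_sol {ι : Type*} [Fintype ι] [DecidableEq ι] (D : ι → ι → ℤ) (o e1 : ι)
    (he1 : e1 ≠ o)
    (hanti : ∀ i j, D i j = - D j i)
    (hpl : ∀ j k l, D o k * D j l = D o j * D k l + D o l * D j k)
    (htr : ∀ (d : ℤ) i j l, d ∣ D i j → d ∣ D j l → d ∣ D i l)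
    (hne : ∀ k, k ≠ o → D o k ≠ 0)
    (h2 : ∀ (p : ℕ), p.Prime → ∀ (S : Finset ι), S.card = p + 1 → ∀ w : ℕ, 1 ≤ w →
      ¬ (∀ i ∈ S, ∀ j ∈ S, i ≠ j → (p:ℤ)^w ∣ D i j ∧ ¬ (p:ℤ)^(w+1) ∣ D i j)) :
    ∃ (a : ℤ) (A : ι → ℤ), ∀ k, a * D o k - D e1 k = D o e1 * A k ∧ IsCoprime (A k) (D o k) := by
  have hc2 := hne e1 he1
  have hD0 : ∀ i, D i i = 0 := fun i => by have := hanti i i; omega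
  have hloc : ∀ p : ℕ, ∃ b : ℤ, p.Prime → ∀ k,
      (p:ℤ)^(padicValInt p (D o e1)) ∣ b * D o k - D e1 k ∧
      ((p:ℤ) ∣ D o k → ¬ (p:ℤ)^(padicValInt p (D o e1) + 1) ∣ b * D o k - D e1 k) := by
    intro p
    by_cases hp : p.Prime
    · have : Fact p.Prime := ⟨hp⟩
      obtain ⟨b, hb⟩ := local_sol D o e1 he1 hanti hpl htr hne p hp (h2 p hp) (padicValInt p (D o e1))
        ((padicValInt_dvd_iff _ _).2 (Or.inr le_rfl))
        (by rw [padicValInt_dvd_iff]; omega)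
      exact ⟨b, fun _ => hb⟩
    · exact ⟨0, fun h => absurd h hp⟩
  choose b hb using hloc
  let P : Finset ℕ := (Finset.univ.biUnion fun k => (D o k).natAbs.primeFactors)
  obtain ⟨a, ha⟩ := crt_int P (by
    intro p hp
    obtain ⟨k, _, hk⟩ := Finset.mem_biUnion.1 hp
    exact Nat.prime_of_mem_primeFactors hk) (fun p => padicValInt p (D o e1) + 1) b
  have hmem : ∀ (p : ℕ) k, p.Prime → k ≠ o → (p:ℤ) ∣ D o k → p ∈ P := by
    intro p k hp hk hd
    refine Finset.mem_biUnion.2 ⟨k, Finset.mem_univ _, ?_⟩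
    rw [Nat.mem_primeFactors]
    exact ⟨hp, Int.natCast_dvd.1 hd, by simpa using hne k hk⟩
  have hdiff : ∀ p ∈ P, ∀ k, (p:ℤ)^(padicValInt p (D o e1) + 1) ∣
      (a * D o k - D e1 k) - (b p * D o k - D e1 k) := by
    intro p hp k
    have : (a * D o k - D e1 k) - (b p * D o k - D e1 k) = (a - b p) * D o k := by ring
    rw [this]; exact Dvd.dvd.mul_right (ha p hp) _
  have hdv : ∀ k, D o e1 ∣ a * D o k - D e1 k := by
    intro k
    rw [← Int.natAbs_dvd_natAbs, Nat.dvd_iff_prime_pow_dvd_dvd]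
    intro p t hp ht
    have : Fact p.Prime := ⟨hp⟩
    rcases Nat.eq_zero_or_pos t with rfl | ht0
    · simp
    have ht' : (p:ℤ)^t ∣ D o e1 := by
      rw [← Int.natCast_dvd] at ht; exact_mod_cast ht
    have hpP : p ∈ P := hmem p e1 hp he1 ((dvd_pow_self _ (by omega)).trans ht')
    have hle : t ≤ padicValInt p (D o e1) := by
      rcases (padicValInt_dvd_iff _ _).1 ht' with h | h
      · exact absurd h hc2
      · exact h
    have h1 : (p:ℤ)^t ∣ b p * D o k - D e1 k := (pow_dvd_pow _ hle).trans (hb p hp k).1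
    have h3 : (p:ℤ)^t ∣ a * D o k - D e1 k :=
      (dvd_iff_dvd_of_dvd_sub ((pow_dvd_pow _ (by omega)).trans (hdiff p hpP k))).2 h1
    rw [← Int.natCast_dvd]; exact_mod_cast h3
  choose A hA using hdv
  refine ⟨a, A, fun k => ⟨hA k, ?_⟩⟩
  by_cases hk : k = o
  · subst hk
    have := hA k
    rw [hD0, hanti e1 k] at this
    have : A k = 1 := by
      apply mul_left_cancel₀ hc2; linear_combination -this
    rw [this]; exact isCoprime_one_left
  rw [Int.isCoprime_iff_gcd_eq_one]
  by_contra hg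
  obtain ⟨p, hp, hpd⟩ := Nat.exists_prime_and_dvd hg
  have : Fact p.Prime := ⟨hp⟩
  have hp1 : (p:ℤ) ∣ A k := (Int.natCast_dvd_natCast.2 hpd).trans (Int.gcd_dvd_left ..)
  have hp2 : (p:ℤ) ∣ D o k := (Int.natCast_dvd_natCast.2 hpd).trans (Int.gcd_dvd_right ..)
  have hpP := hmem p k hp hk hp2
  apply (hb p hp k).2 hp2
  refine (dvd_iff_dvd_of_dvd_sub (hdiff p hpP k)).1 ?_
  rw [hA k, pow_succ]
  exact mul_dvd_mul ((padicValInt_dvd_iff _ _).2 (Or.inr le_rfl)) hp1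

/-- a frieze with coefficients `C` on an `n`-gon over the positive integers
appears as a subpolygon of some Conway–Coxeter frieze if and only if
(1) for any triangle `(i,j,l)` the three pairwise gcds of its labels coincide, and
(2) for every prime `p < n` and every `(p+1)`-element subset `S` of the vertices, the
labels of edges and diagonals of the subpolygon on `S` are either all not divisible by
`p`, or do not all have the same `p`-adic valuation. -/
theorem stmt9 (n : ℕ) (hn : 3 ≤ n)
    (C : Fin n → Fin n → ℤ)
    (hCpos : ∀ i j : Fin n, i < j → 0 < C i j)
    (hPtolemy : ∀ i j k l : Fin n, i < j → j < k → k < l →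
      C i k * C j l = C i j * C k l + C i l * C j k) :
    (∃ (m : ℕ) (hm : n ≤ m) (x : Fin m → (Fin 2 → ℤ)),
      (∀ i j : Fin m, i < j → 0 < det2 (x i) (x j)) ∧
      (∀ i : ℕ, ∀ h : i + 1 < m, det2 (x ⟨i, by omega⟩) (x ⟨i + 1, h⟩) = 1) ∧
      det2 (x ⟨0, by omega⟩) (x ⟨m - 1, by omega⟩) = 1 ∧
      ∃ idx : Fin n → Fin m, StrictMono idx ∧
        ∀ r s : Fin n, r < s → C r s = det2 (x (idx r)) (x (idx s)))
    ↔
    ((∀ i j l : Fin n, i < j → j < l →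
        Int.gcd (C i j) (C j l) = Int.gcd (C j l) (C i l) ∧
        Int.gcd (C j l) (C i l) = Int.gcd (C i j) (C i l)) ∧
     (∀ p : ℕ, p.Prime → p < n →
        ∀ S : Finset (Fin n), S.card = p + 1 →
          (∀ i ∈ S, ∀ j ∈ S, i < j → ¬ ((p : ℤ) ∣ C i j)) ∨
          ¬ (∃ v : ℕ, ∀ i ∈ S, ∀ j ∈ S, i < j → padicValInt p (C i j) = v))) := by
  constructor
  · rintro ⟨m, hm, x, hx1, hx2, hx3, idx, hidx, hC⟩
    refine forward n C hCpos (fun i => x (idx i)) (fun i => ?_) hC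
    generalize idx i = q
    by_cases hq : q.1 + 1 < m
    · exact ⟨_, hx2 q.1 hq⟩
    · have : q = ⟨m - 1, by omega⟩ := Fin.ext (by have := q.2; simp only; omega)
      rw [this]
      refine ⟨fun t => - x ⟨0, by omega⟩ t, ?_⟩
      rw [← hx3]; simp only [det2]; ring
  · rintro ⟨hA, hB⟩
    obtain ⟨D, hD⟩ : ∃ D : Fin n → Fin n → ℤ, D = fun i j => if i < j then C i j else if j < i then - C j i else 0 := ⟨_, rfl⟩
    have hDlt : ∀ i j, i < j → D i j = C i j := by intro i j h; simp [hD, h]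
    have hDii : ∀ i, D i i = 0 := by intro i; simp [hD]
    have hanti : ∀ i j, D i j = - D j i := by
      intro i j
      rcases lt_trichotomy i j with h | h | h
      · simp [hD, h, h.not_gt]
      · subst h; simp [hDii]
      · simp [hD, h, h.not_gt]
    let o : Fin n := ⟨0, by omega⟩
    let e1 : Fin n := ⟨1, by omega⟩
    have he1 : e1 ≠ o := by simp [e1, o]
    have hopos : ∀ k, k ≠ o → o < k := by
      intro k hk
      rw [Fin.lt_def]
      have : k.1 ≠ 0 := fun h => hk (Fin.ext h)
      simp only [o]; omega
    have hP : ∀ i j k l, i < j → j < k → k < l → D i k * D j l = D i j * D k l + D i l * D j k := by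
      intro i j k l h1 h2 h3
      rw [hDlt _ _ h1, hDlt _ _ h2, hDlt _ _ h3, hDlt _ _ (h1.trans h2), hDlt _ _ (h2.trans h3),
        hDlt _ _ (h1.trans (h2.trans h3))]
      exact hPtolemy i j k l h1 h2 h3
    have hpl : ∀ j k l, D o k * D j l = D o j * D k l + D o l * D j k := by
      intro j k l
      by_cases hj : j = o
      · rw [hj, hDii]; have := hanti o l; have := hanti k o; rw [hanti k l, hanti l k]
        have := hanti k l; linear_combination
      by_cases hk : k = o
      · rw [hk, hDii, hanti j o]; ring
      by_cases hl : l = o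
      · rw [hl, hDii, hanti j o, hanti k o]; ring
      have hj' := hopos j hj
      have hk' := hopos k hk
      have hl' := hopos l hl
      rcases lt_trichotomy j k with h | h | h
      · rcases lt_trichotomy k l with h' | h' | h'
        · exact hP o j k l hj' h h'
        · rw [h', hDii]; ring
        · rcases lt_trichotomy j l with h'' | h'' | h''
          · rw [hanti k l]; linear_combination - hP o j l k hj' h'' h'
          · rw [h'', hDii, hanti k l]; ring
          · rw [hanti j l, hanti k l]; linear_combination hP o l j k hl' h'' h
      · rw [h, hDii]; ring
      · rw [hanti j k]
        rcases lt_trichotomy k l with h' | h' | h'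
        · rcases lt_trichotomy j l with h'' | h'' | h''
          · linear_combination - hP o k j l hk' h h''
          · rw [h'', hDii]; ring
          · rw [hanti j l]; linear_combination hP o k l j hk' h' h''
        · rw [h', hDii, hanti j l]; ring
        · rw [hanti j l, hanti k l]; linear_combination - hP o l k j hl' h' h
    have hT : ∀ (d : ℤ) i j l, i < j → j < l → (d ∣ D i j → d ∣ D j l → d ∣ D i l) ∧
        (d ∣ D i j → d ∣ D i l → d ∣ D j l) ∧ (d ∣ D j l → d ∣ D i l → d ∣ D i j) := by
      intro d i j l h1 h2
      rw [hDlt _ _ h1, hDlt _ _ h2, hDlt _ _ (h1.trans h2)]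
      obtain ⟨g1, g2⟩ := hA i j l h1 h2
      refine ⟨fun a b => ?_, fun a b => ?_, fun a b => ?_⟩
      · have := Int.dvd_coe_gcd a b
        rw [g1] at this
        exact this.trans (Int.gcd_dvd_right ..)
      · have := Int.dvd_coe_gcd a b
        rw [← g2] at this
        exact this.trans (Int.gcd_dvd_left ..)
      · have := Int.dvd_coe_gcd a b
        rw [g2] at this
        exact this.trans (Int.gcd_dvd_left ..)
    have hsw : ∀ (d : ℤ) i j, d ∣ D i j → d ∣ D j i := by
      intro d i j h; rw [hanti]; exact dvd_neg.2 h
    have htr : ∀ (d : ℤ) i j l, d ∣ D i j → d ∣ D j l → d ∣ D i l := by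
      intro d i j l ha hb
      rcases lt_trichotomy i j with h | h | h
      · rcases lt_trichotomy j l with h' | h' | h'
        · exact (hT d i j l h h').1 ha hb
        · rw [← h']; exact ha
        · rcases lt_trichotomy i l with h'' | h'' | h''
          · exact (hT d i l j h'' h').2.2 (hsw _ _ _ hb) ha
          · rw [h'', hDii]; exact dvd_zero _
          · exact hsw _ _ _ ((hT d l i j h'' h).2.2 ha (hsw _ _ _ hb))
      · rw [h]; exact hb
      · rcases lt_trichotomy j l with h' | h' | h'
        · rcases lt_trichotomy i l with h'' | h'' | h''
          · exact (hT d j i l h h'').2.1 (hsw _ _ _ ha) hb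
          · rw [h'', hDii]; exact dvd_zero _
          · exact hsw _ _ _ ((hT d j l i h' h'').2.1 hb (hsw _ _ _ ha))
        · rw [← h']; exact ha
        · exact hsw _ _ _ ((hT d l j i h' h).1 (hsw _ _ _ hb) (hsw _ _ _ ha))
    have hne : ∀ k, k ≠ o → D o k ≠ 0 := by
      intro k hk
      rw [hDlt _ _ (hopos k hk)]; exact (hCpos _ _ (hopos k hk)).ne'
    have h2 : ∀ (p : ℕ), p.Prime → ∀ (S : Finset (Fin n)), S.card = p + 1 → ∀ w : ℕ, 1 ≤ w →
      ¬ (∀ i ∈ S, ∀ j ∈ S, i ≠ j → (p:ℤ)^w ∣ D i j ∧ ¬ (p:ℤ)^(w+1) ∣ D i j) := by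
      intro p hp S hS w hw hall
      have : Fact p.Prime := ⟨hp⟩
      have hpn : p < n := by
        have := Finset.card_le_univ S
        rw [Fintype.card_fin] at this; omega
      rcases hB p hp hpn S hS with h | h
      · obtain ⟨i, hi, j, hj, hij⟩ := Finset.one_lt_card.1 (show 1 < S.card by have := hp.pos; omega)
        rcases lt_or_gt_of_ne hij with h' | h'
        · apply h i hi j hj h'
          rw [← hDlt _ _ h']
          exact (dvd_pow_self _ (by omega)).trans (hall i hi j hj hij).1
        · apply h j hj i hi h'
          rw [← hDlt _ _ h']
          exact (dvd_pow_self _ (by omega)).trans (hall j hj i hi hij.symm).1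
      · apply h
        refine ⟨w, fun i hi j hj hij => ?_⟩
        have h3 := hall i hi j hj hij.ne
        rw [hDlt _ _ hij, padicValInt_dvd_iff, padicValInt_dvd_iff] at h3
        have := hCpos i j hij
        omega
    obtain ⟨a, A, hAA⟩ := global_sol D o e1 he1 hanti hpl htr hne h2
    have hprim : ∀ k, Prim (![A k, D o k]) := by
      intro k
      obtain ⟨u, v, huv⟩ := (hAA k).2
      refine ⟨![-v, u], ?_⟩
      simp only [det2, Matrix.cons_val_zero, Matrix.cons_val_one]
      linear_combination huv
    have hdet : ∀ r s : Fin n, r < s → C r s = det2 (![A r, D o r]) (![A s, D o s]) := by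
      intro r s hrs
      rw [← hDlt _ _ hrs]
      apply mul_left_cancel₀ (hne e1 he1)
      simp only [det2, Matrix.cons_val_zero, Matrix.cons_val_one]
      linear_combination D o s * (hAA r).1 - D o r * (hAA s).1 - hpl e1 r s
    obtain ⟨m, hm, x, hx1, hx2, hx3, hx4⟩ :=
      extend_fin n hn C hCpos (fun k => ![A k, D o k]) hprim hdet
    exact ⟨m, hm, x, hx1, fun i h => hx2 _ _ rfl, hx3 _ _ rfl rfl, hx4⟩
end
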